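/- arXiv:1111.2207 — 3 statements merged into one kernel-verified Lean document; each statement's English description precedes it below -/
import Mathlib

section
/- Fix β ∈ (0, +∞]. Assume (SA), that f is nondecreasing on some interval [M, β) with M > 0, and that ρ is radially symmetric and radially nonincreasing (ρ(x) = ρ₀(|x|) with ρ₀ nonincreasing) with ρ(x) = |x|^{−α} for all |x| ≥ 1, for some α > 2. Then every solution u of (E) with lim_{|x|→+∞} u(x) = β is radially symmetric. -/
open MeasureTheory Filter Set

noncomputable def laplacian {D : ℕ} (u : EuclideanSpace ℝ (Fin D) → ℝ)
    (x : EuclideanSpace ℝ (Fin D)) : ℝ :=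
  ∑ i, fderiv ℝ (fun y => fderiv ℝ u y (EuclideanSpace.single i 1)) x (EuclideanSpace.single i 1)

open scoped Laplacian RealInnerProductSpace

section Calculus

variable {E : Type*} [NormedAddCommGroup E] [InnerProductSpace ℝ E]

/-- The second derivative of `u` at `x` as a quadratic form. -/
noncomputable def hess (u : E → ℝ) (x v : E) : ℝ := fderiv ℝ (fderiv ℝ u) x v v

theorem laplacian_eq_sum_hess [FiniteDimensional ℝ E] {ι : Type*} [Fintype ι]
    (b : OrthonormalBasis ι ℝ E) (u : E → ℝ) (x : E) : Δ u x = ∑ i, hess u x (b i) := by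
  simp [InnerProductSpace.laplacian_eq_iteratedFDeriv_orthonormalBasis u b,
    iteratedFDeriv_two_apply, hess]

theorem laplacian_eq_mathlib {D : ℕ} {u : EuclideanSpace ℝ (Fin D) → ℝ} (hu : ContDiff ℝ 2 u)
    (x : EuclideanSpace ℝ (Fin D)) : laplacian u x = Δ u x := by
  rw [laplacian_eq_sum_hess (EuclideanSpace.basisFun (Fin D) ℝ)]
  refine Finset.sum_congr rfl fun i _ => ?_
  have h : DifferentiableAt ℝ (fderiv ℝ u) x :=
    (hu.fderiv_right (m := 1) (by norm_num)).differentiable (by norm_num) x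
  rw [fderiv_clm_apply h (by fun_prop)]
  simp [hess]

theorem second_deriv_nonpos_of_isLocalMax {φ φ' : ℝ → ℝ} {t c : ℝ} (hmax : IsLocalMax φ t)
    (h1 : ∀ᶠ s in nhds t, HasDerivAt φ (φ' s) s) (h2 : HasDerivAt φ' c t) :
    φ' t = 0 ∧ c ≤ 0 := by
  have h0 : φ' t = 0 := hmax.hasDerivAt_eq_zero h1.self_of_nhds
  refine ⟨h0, not_lt.1 fun hc => ?_⟩
  have hd : deriv φ =ᶠ[nhds t] φ' := h1.mono fun s hs => hs.deriv
  have hdd : deriv (deriv φ) t = c := by rw [hd.deriv_eq, h2.deriv]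
  have hmin : IsLocalMin φ t := isLocalMin_of_deriv_deriv_pos (by rw [hdd]; exact hc)
    (by rw [h1.self_of_nhds.deriv, h0]) h1.self_of_nhds.continuousAt
  have hconst : φ =ᶠ[nhds t] fun _ => φ t := by
    filter_upwards [hmax, hmin] with s hs hs' using le_antisymm hs hs'
  have : deriv φ =ᶠ[nhds t] fun _ => 0 := by
    filter_upwards [hconst.deriv] with s hs using by simpa using hs
  rw [this.deriv_eq] at hdd
  simp at hdd
  exact hc.ne hdd

theorem hasDerivAt_comp_curve {u : E → ℝ} (hu : ContDiff ℝ 2 u) {Γ : ℝ → E} {Γ' : E} {t : ℝ}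
    (h : HasDerivAt Γ Γ' t) : HasDerivAt (fun s => u (Γ s)) (fderiv ℝ u (Γ t) Γ') t :=
  ((hu.differentiable (by norm_num) (Γ t)).hasFDerivAt).comp_hasDerivAt t h

theorem hasDerivAt_fderiv_comp_curve {u : E → ℝ} (hu : ContDiff ℝ 2 u) {Γ Γ' : ℝ → E} {Γ'' : E}
    {t : ℝ} (h : HasDerivAt Γ (Γ' t) t) (h' : HasDerivAt Γ' Γ'' t) :
    HasDerivAt (fun s => fderiv ℝ u (Γ s) (Γ' s))
      (hess u (Γ t) (Γ' t) + fderiv ℝ u (Γ t) Γ'') t := by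
  have h2 : DifferentiableAt ℝ (fderiv ℝ u) (Γ t) :=
    (hu.fderiv_right (m := 1) (by norm_num)).differentiable (by norm_num) _
  exact (h2.hasFDerivAt.comp_hasDerivAt t h).clm_apply h'

theorem hasDerivAt_line (x v : E) (t : ℝ) : HasDerivAt (fun s : ℝ => x + s • v) v t := by
  simpa using ((hasDerivAt_id t).smul_const v).const_add x

theorem hess_eq_of_line {u : E → ℝ} (hu : ContDiff ℝ 2 u) {x v : E} {φ' : ℝ → ℝ} {c : ℝ}
    (h1 : ∀ s, HasDerivAt (fun s : ℝ => u (x + s • v)) (φ' s) s) (h2 : HasDerivAt φ' c 0) :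
    hess u x v = c := by
  have h := hasDerivAt_fderiv_comp_curve hu (Γ' := fun _ => v) (hasDerivAt_line x v 0)
    (hasDerivAt_const 0 v)
  have he : (fun s : ℝ => fderiv ℝ u (x + s • v) v) = φ' :=
    funext fun s => (hasDerivAt_comp_curve hu (hasDerivAt_line x v s)).unique (h1 s)
  rw [he] at h
  simpa using h.unique h2

theorem hess_nonpos_of_isLocalMax {u : E → ℝ} (hu : ContDiff ℝ 2 u) {x : E}
    (hmax : IsLocalMax u x) (v : E) : hess u x v ≤ 0 := by
  have hl := hasDerivAt_line x v 0
  have h := hasDerivAt_fderiv_comp_curve hu (Γ' := fun _ => v) hl (hasDerivAt_const 0 v)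
  have hm : IsLocalMax (fun s : ℝ => u (x + s • v)) 0 := by
    have : Tendsto (fun s : ℝ => x + s • v) (nhds 0) (nhds x) := by
      simpa using hl.continuousAt.tendsto
    simpa [IsLocalMax, IsMaxFilter] using this.eventually hmax
  have := (second_deriv_nonpos_of_isLocalMax hm (Eventually.of_forall fun s =>
    hasDerivAt_comp_curve hu (hasDerivAt_line x v s)) h).2
  simpa using this

variable [FiniteDimensional ℝ E]

theorem laplacian_nonpos_of_isLocalMax {u : E → ℝ} (hu : ContDiff ℝ 2 u) {x : E}
    (hmax : IsLocalMax u x) : Δ u x ≤ 0 := by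
  rw [laplacian_eq_sum_hess (stdOrthonormalBasis ℝ E)]
  exact Finset.sum_nonpos fun i _ => hess_nonpos_of_isLocalMax hu hmax _

theorem laplacian_comp_of_fderiv_isometry {u : E → ℝ} (hu : ContDiff ℝ 2 u) (L : E ≃ₗᵢ[ℝ] E)
    (a x : E) : Δ (fun y => u (L y + a)) x = Δ u (L x + a) := by
  have hL : ContDiff ℝ 2 fun y => L y + a := L.contDiff.add contDiff_const
  rw [laplacian_eq_sum_hess (stdOrthonormalBasis ℝ E),
    laplacian_eq_sum_hess ((stdOrthonormalBasis ℝ E).map L)]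
  refine Finset.sum_congr rfl fun i _ => ?_
  set v := stdOrthonormalBasis ℝ E i
  have hl : ∀ s : ℝ, HasDerivAt (fun s : ℝ => L x + a + s • L v) (L v) s :=
    fun s => hasDerivAt_line _ _ s
  have h2 := hasDerivAt_fderiv_comp_curve hu (Γ' := fun _ => L v) (hl 0) (hasDerivAt_const 0 (L v))
  have := hess_eq_of_line (hu.comp hL) (x := x) (v := v)
    (φ' := fun s : ℝ => fderiv ℝ u (L x + a + s • L v) (L v)) (fun s => by
      have := hasDerivAt_comp_curve hu (hl s)
      refine this.congr_of_eventuallyEq (Eventually.of_forall fun r => ?_)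
      simp only [Function.comp, map_add, map_smul]
      congr 1
      abel) h2
  simpa [Function.comp_def] using this

end Calculus

section Barriers

variable {E : Type*} [NormedAddCommGroup E] [InnerProductSpace ℝ E]

theorem contDiff_decay (p : ℝ) : ContDiff ℝ 2 fun x : E => (1 + ‖x‖ ^ 2 : ℝ) ^ (-p) :=
  (contDiff_const.add (contDiff_norm_sq ℝ)).rpow_const_of_ne fun x => by positivity

theorem contDiff_exp_slab (N c : ℝ) (e : E) :
    ContDiff ℝ 2 fun x : E => Real.exp (-(N * (⟪e, x⟫ - c))) :=
  (contDiff_const.mul ((contDiff_const.inner ℝ contDiff_id).sub contDiff_const)).neg.exp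

theorem contDiff_quadratic (a b c : ℝ) (e y : E) : ContDiff ℝ 2 fun x : E =>
    a * ‖x - y‖ ^ 2 + b * ⟪e, x - y⟫ ^ 2 + c * ⟪e, x - y⟫ := by
  have h : ContDiff ℝ 2 fun x : E => x - y := contDiff_id.sub contDiff_const
  have hi : ContDiff ℝ 2 fun x : E => ⟪e, x - y⟫ := contDiff_const.inner ℝ h
  exact ((contDiff_const.mul (h.norm_sq ℝ)).add (contDiff_const.mul (hi.pow 2))).add
    (contDiff_const.mul hi)

variable [FiniteDimensional ℝ E]

theorem laplacian_linear_combination {φ ψ : E → ℝ} (hφ : ContDiff ℝ 2 φ) (hψ : ContDiff ℝ 2 ψ)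
    (a b : ℝ) (x : E) : Δ (fun y => a * φ y + b * ψ y) x = a * Δ φ x + b * Δ ψ x := by
  have h := (contDiff_const.mul hφ : ContDiff ℝ 2 fun y => a * φ y).contDiffAt.laplacian_add
    (contDiff_const.mul hψ : ContDiff ℝ 2 fun y => b * ψ y).contDiffAt (x := x)
  have h1 := InnerProductSpace.laplacian_smul a hφ.contDiffAt (x := x)
  have h2 := InnerProductSpace.laplacian_smul b hψ.contDiffAt (x := x)
  simp only [smul_eq_mul] at h1 h2
  rw [← h1, ← h2]
  exact h

theorem laplacian_const_mul {φ : E → ℝ} (hφ : ContDiff ℝ 2 φ) (a : ℝ) (x : E) :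
    Δ (fun y => a * φ y) x = a * Δ φ x :=
  InnerProductSpace.laplacian_smul a hφ.contDiffAt

theorem laplacian_le_of_isLocalMax_sub {φ ψ : E → ℝ} (hφ : ContDiff ℝ 2 φ) (hψ : ContDiff ℝ 2 ψ)
    {x : E} (h : IsLocalMax (fun y => φ y - ψ y) x) : Δ φ x ≤ Δ ψ x := by
  have h1 := laplacian_nonpos_of_isLocalMax (hφ.sub hψ) h
  have h2 := laplacian_linear_combination hφ hψ 1 (-1) x
  have h3 : (fun y => 1 * φ y + -1 * ψ y) = fun y => φ y - ψ y := by
    ext y; ring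
  rw [h3] at h2
  linarith

theorem sum_sq_inner_basis (e : E) :
    ∑ i, ⟪e, stdOrthonormalBasis ℝ E i⟫ ^ 2 = ‖e‖ ^ 2 := by
  have := (stdOrthonormalBasis ℝ E).sum_inner_mul_inner e e
  rw [real_inner_self_eq_norm_sq] at this
  rw [← this]
  refine Finset.sum_congr rfl fun i _ => ?_
  rw [real_inner_comm e, sq]

theorem laplacian_decay (p : ℝ) (x : E) :
    Δ (fun y : E => (1 + ‖y‖ ^ 2 : ℝ) ^ (-p)) x =
      -(2 * p * Module.finrank ℝ E) * (1 + ‖x‖ ^ 2) ^ (-p - 1) +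
        4 * p * (p + 1) * ‖x‖ ^ 2 * (1 + ‖x‖ ^ 2) ^ (-p - 2) := by
  have key : ∀ i, hess (fun y : E => (1 + ‖y‖ ^ 2 : ℝ) ^ (-p)) x (stdOrthonormalBasis ℝ E i) =
      -(2 * p) * (1 + ‖x‖ ^ 2) ^ (-p - 1) +
        4 * p * (p + 1) * (1 + ‖x‖ ^ 2) ^ (-p - 2) * ⟪x, stdOrthonormalBasis ℝ E i⟫ ^ 2 := by
    intro i
    set v := stdOrthonormalBasis ℝ E i
    have hv : ‖v‖ = 1 := (stdOrthonormalBasis ℝ E).norm_eq_one i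
    have hexp : ∀ s : ℝ, 1 + ‖x + s • v‖ ^ 2 = 1 + ‖x‖ ^ 2 + 2 * ⟪x, v⟫ * s + s ^ 2 := by
      intro s
      rw [norm_add_sq_real, norm_smul, hv, inner_smul_right]
      simp
      ring
    have hQ : ∀ s : ℝ, HasDerivAt (fun s => 1 + ‖x‖ ^ 2 + 2 * ⟪x, v⟫ * s + s ^ 2)
        (2 * ⟪x, v⟫ + 2 * s) s := by
      intro s
      have := (((hasDerivAt_id s).const_mul (2 * ⟪x, v⟫)).const_add (1 + ‖x‖ ^ 2)).add
        ((hasDerivAt_id s).pow 2)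
      refine HasDerivAt.congr_deriv this ?_
      simp
    have hpos : ∀ s : ℝ, (1 + ‖x‖ ^ 2 + 2 * ⟪x, v⟫ * s + s ^ 2) ≠ 0 := by
      intro s
      rw [← hexp]
      positivity
    refine hess_eq_of_line (contDiff_decay p) (φ' := fun s => (2 * ⟪x, v⟫ + 2 * s) * (-p) *
      (1 + ‖x‖ ^ 2 + 2 * ⟪x, v⟫ * s + s ^ 2) ^ (-p - 1)) (fun s => ?_) ?_
    · simp only [hexp]
      exact (hQ s).rpow_const (Or.inl (hpos s))
    · have h1 : HasDerivAt (fun s : ℝ => (2 * ⟪x, v⟫ + 2 * s) * (-p)) (2 * (-p)) 0 := by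
        have := (((hasDerivAt_id (0 : ℝ)).const_mul 2).const_add (2 * ⟪x, v⟫)).mul_const (-p)
        simpa using this
      have h2 := (hQ 0).rpow_const (p := -p - 1) (Or.inl (hpos 0))
      refine (h1.mul h2).congr_deriv ?_
      have : -p - 1 - 1 = -p - 2 := by ring
      simp [this]
      ring
  rw [laplacian_eq_sum_hess (stdOrthonormalBasis ℝ E), Finset.sum_congr rfl fun i _ => key i,
    Finset.sum_add_distrib, ← Finset.mul_sum _ _ (4 * p * (p + 1) * (1 + ‖x‖ ^ 2) ^ (-p - 2)),
    sum_sq_inner_basis]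
  simp
  ring

theorem laplacian_decay_le (hD : 3 ≤ Module.finrank ℝ E) {p : ℝ} (hp : 0 < p) (x : E) :
    Δ (fun y : E => (1 + ‖y‖ ^ 2 : ℝ) ^ (-p)) x ≤
      -(2 * p * (1 - 2 * p)) * (1 + ‖x‖ ^ 2) ^ (-p - 1) := by
  rw [laplacian_decay]
  have hQ : 0 < 1 + ‖x‖ ^ 2 := by positivity
  have hD' : (3 : ℝ) ≤ Module.finrank ℝ E := by exact_mod_cast hD
  have h1 : (1 + ‖x‖ ^ 2) ^ (-p - 1) = (1 + ‖x‖ ^ 2) * (1 + ‖x‖ ^ 2) ^ (-p - 2) := by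
    rw [← Real.rpow_one_add' hQ.le (by linarith)]
    congr 1; ring
  rw [h1]
  have hP : 0 < (1 + ‖x‖ ^ 2) ^ (-p - 2) := by positivity
  set P := (1 + ‖x‖ ^ 2) ^ (-p - 2)
  have : 0 ≤ p * P * (1 + ‖x‖ ^ 2) * (Module.finrank ℝ E - 3) := by
    have : (0 : ℝ) ≤ Module.finrank ℝ E - 3 := by linarith
    positivity
  have : 0 ≤ p * (p + 1) * P := by positivity
  nlinarith

theorem laplacian_exp_slab (N c : ℝ) {e : E} (he : ‖e‖ = 1) (x : E) :
    Δ (fun y : E => Real.exp (-(N * (⟪e, y⟫ - c)))) x =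
      N ^ 2 * Real.exp (-(N * (⟪e, x⟫ - c))) := by
  have key : ∀ i, hess (fun y : E => Real.exp (-(N * (⟪e, y⟫ - c)))) x
      (stdOrthonormalBasis ℝ E i) =
      N ^ 2 * Real.exp (-(N * (⟪e, x⟫ - c))) * ⟪e, stdOrthonormalBasis ℝ E i⟫ ^ 2 := by
    intro i
    set v := stdOrthonormalBasis ℝ E i
    have hQ : ∀ s : ℝ, HasDerivAt (fun s : ℝ => Real.exp (-(N * (⟪e, x + s • v⟫ - c))))
        (Real.exp (-(N * (⟪e, x + s • v⟫ - c))) * (-(N * ⟪e, v⟫))) s := by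
      intro s
      refine HasDerivAt.exp ?_
      have := ((((hasDerivAt_id s).mul_const ⟪e, v⟫).const_add ⟪e, x⟫).sub_const c).const_mul N
      refine (this.neg.congr_deriv (by simp)).congr_of_eventuallyEq
        (Eventually.of_forall fun r => ?_)
      simp [inner_add_right, inner_smul_right]
    refine hess_eq_of_line (contDiff_exp_slab N c e) hQ ?_
    refine ((hQ 0).mul_const _).congr_deriv ?_
    simp
    ring
  rw [laplacian_eq_sum_hess (stdOrthonormalBasis ℝ E), Finset.sum_congr rfl fun i _ => key i,
    ← Finset.mul_sum, sum_sq_inner_basis, he]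
  simp

theorem laplacian_quadratic (a b c : ℝ) {e : E} (he : ‖e‖ = 1) (y x : E) :
    Δ (fun x : E => a * ‖x - y‖ ^ 2 + b * ⟪e, x - y⟫ ^ 2 + c * ⟪e, x - y⟫) x =
      2 * a * Module.finrank ℝ E + 2 * b := by
  have key : ∀ i, hess (fun x : E => a * ‖x - y‖ ^ 2 + b * ⟪e, x - y⟫ ^ 2 + c * ⟪e, x - y⟫) x
      (stdOrthonormalBasis ℝ E i) = 2 * a + 2 * b * ⟪e, stdOrthonormalBasis ℝ E i⟫ ^ 2 := by
    intro i
    set v := stdOrthonormalBasis ℝ E i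
    have hv : ‖v‖ = 1 := (stdOrthonormalBasis ℝ E).norm_eq_one i
    have hexp : ∀ s : ℝ, a * ‖x + s • v - y‖ ^ 2 + b * ⟪e, x + s • v - y⟫ ^ 2 +
        c * ⟪e, x + s • v - y⟫ = (a * ‖x - y‖ ^ 2 + b * ⟪e, x - y⟫ ^ 2 + c * ⟪e, x - y⟫) +
          (2 * a * ⟪x - y, v⟫ + 2 * b * ⟪e, x - y⟫ * ⟪e, v⟫ + c * ⟪e, v⟫) * s +
          (a + b * ⟪e, v⟫ ^ 2) * s ^ 2 := by
      intro s
      have : x + s • v - y = (x - y) + s • v := by abel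
      rw [this, norm_add_sq_real, norm_smul, hv, inner_smul_right, inner_add_right,
        inner_smul_right]
      simp
      ring
    refine hess_eq_of_line (contDiff_quadratic a b c e y) (φ' := fun s =>
      (2 * a * ⟪x - y, v⟫ + 2 * b * ⟪e, x - y⟫ * ⟪e, v⟫ + c * ⟪e, v⟫) +
          2 * (a + b * ⟪e, v⟫ ^ 2) * s) (fun s => ?_) ?_
    · simp only [hexp]
      have := (((hasDerivAt_id s).const_mul (2 * a * ⟪x - y, v⟫ + 2 * b * ⟪e, x - y⟫ * ⟪e, v⟫ +
        c * ⟪e, v⟫)).const_add (a * ‖x - y‖ ^ 2 + b * ⟪e, x - y⟫ ^ 2 + c * ⟪e, x - y⟫)).add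
        (((hasDerivAt_id s).pow 2).const_mul (a + b * ⟪e, v⟫ ^ 2))
      refine this.congr_deriv ?_
      simp
      ring
    · refine (((hasDerivAt_id (0 : ℝ)).const_mul (2 * (a + b * ⟪e, v⟫ ^ 2))).const_add
        _).congr_deriv ?_
      ring
  rw [laplacian_eq_sum_hess (stdOrthonormalBasis ℝ E), Finset.sum_congr rfl fun i _ => key i,
    Finset.sum_add_distrib, ← Finset.mul_sum _ _ (2 * b), sum_sq_inner_basis, he]
  simp
  ring

end Barriers

section PlaneReflection

variable {E : Type*} [NormedAddCommGroup E] [InnerProductSpace ℝ E]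

/-- Reflection across the hyperplane `⟪e, x⟫ = c` (for a unit vector `e`). -/
noncomputable def planeRefl (e : E) (c : ℝ) (x : E) : E := x - (2 * (⟪e, x⟫ - c)) • e

theorem planeRefl_eq {e : E} (he : ‖e‖ = 1) (c : ℝ) (x : E) :
    planeRefl e c x = (ℝ ∙ e)ᗮ.reflection x + (2 * c) • e := by
  rw [Submodule.reflection_orthogonal_apply, Submodule.reflection_singleton_apply, he, planeRefl]
  simp [mul_sub, sub_smul, mul_smul, two_smul]
  abel

theorem norm_sq_planeRefl {e : E} (he : ‖e‖ = 1) (c : ℝ) (x : E) :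
    ‖planeRefl e c x‖ ^ 2 = ‖x‖ ^ 2 - 4 * c * (⟪e, x⟫ - c) := by
  rw [planeRefl, norm_sub_sq_real, norm_smul, inner_smul_right, he, real_inner_comm, mul_one,
    Real.norm_eq_abs, sq_abs]
  ring

theorem planeRefl_of_mem {e : E} {c : ℝ} {x : E} (h : ⟪e, x⟫ = c) : planeRefl e c x = x := by
  simp [planeRefl, h]

theorem norm_planeRefl_le {e : E} (he : ‖e‖ = 1) {c : ℝ} (hc : 0 ≤ c) {x : E} (h : c ≤ ⟪e, x⟫) :
    ‖planeRefl e c x‖ ≤ ‖x‖ := by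
  refine le_of_sq_le_sq ?_ (norm_nonneg _)
  rw [norm_sq_planeRefl he]
  have := mul_nonneg hc (sub_nonneg.2 h)
  linarith

theorem norm_planeRefl_lt {e : E} (he : ‖e‖ = 1) {c : ℝ} (hc : 0 < c) {x : E} (h : c < ⟪e, x⟫) :
    ‖planeRefl e c x‖ < ‖x‖ := by
  refine lt_of_pow_lt_pow_left₀ 2 (norm_nonneg _) ?_
  rw [norm_sq_planeRefl he]
  have := mul_pos hc (sub_pos.2 h)
  linarith

theorem continuous_planeRefl (e : E) : Continuous fun p : ℝ × E => planeRefl e p.1 p.2 := by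
  unfold planeRefl
  fun_prop

theorem contDiff_planeRefl (e : E) (c : ℝ) : ContDiff ℝ 2 (planeRefl e c) :=
  contDiff_id.sub ((contDiff_const.mul
    ((contDiff_const.inner ℝ contDiff_id).sub contDiff_const)).smul contDiff_const)

theorem laplacian_comp_planeRefl [FiniteDimensional ℝ E] {u : E → ℝ} (hu : ContDiff ℝ 2 u) {e : E}
    (he : ‖e‖ = 1) (c : ℝ) (x : E) :
    Δ (fun y => u (planeRefl e c y)) x = Δ u (planeRefl e c x) := by
  simp only [planeRefl_eq he]
  exact laplacian_comp_of_fderiv_isometry hu _ _ _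

theorem exists_planeRefl_eq {x y : E} (hxy : ‖x‖ = ‖y‖) (hne : x ≠ y) :
    ∃ e : E, ‖e‖ = 1 ∧ 0 < ⟪e, x⟫ ∧ planeRefl e 0 x = y := by
  have hd : 0 < ‖x - y‖ := norm_pos_iff.2 (sub_ne_zero.2 hne)
  have hin : ⟪x - y, x⟫ = ‖x - y‖ ^ 2 / 2 := by
    have h1 := norm_sub_sq_real x y
    rw [inner_sub_left, real_inner_self_eq_norm_sq, real_inner_comm]
    rw [hxy] at h1 ⊢
    linarith
  have he : ⟪‖x - y‖⁻¹ • (x - y), x⟫ = ‖x - y‖ / 2 := by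
    rw [inner_smul_left, hin]
    simp only [conj_trivial]
    field_simp
  refine ⟨‖x - y‖⁻¹ • (x - y), ?_, by rw [he]; positivity, ?_⟩
  · rw [norm_smul, norm_inv, norm_norm, inv_mul_cancel₀ hd.ne']
  · rw [planeRefl, he, smul_smul]
    have : 2 * (‖x - y‖ / 2 - 0) * ‖x - y‖⁻¹ = 1 := by field_simp; ring
    rw [this, one_smul, sub_sub_cancel]

end PlaneReflection

section MovingPlanes

variable {E : Type*} [NormedAddCommGroup E] [InnerProductSpace ℝ E]

/-- A positive supersolution adapted to the half space `c ≤ ⟪e, x⟫`: it is uniformly positive,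
and very concave in a slab of width `1 / N` next to the boundary hyperplane. -/
noncomputable def slabBarrier (p N : ℝ) (e : E) (c : ℝ) (x : E) : ℝ :=
  2 + (1 * (1 + ‖x‖ ^ 2 : ℝ) ^ (-p) + -1 * Real.exp (-(N * (⟪e, x⟫ - c))))

theorem contDiff_slabBarrier (p N : ℝ) (e : E) (c : ℝ) : ContDiff ℝ 2 (slabBarrier p N e c) :=
  contDiff_const.add ((contDiff_const.mul (contDiff_decay p)).add
    (contDiff_const.mul (contDiff_exp_slab N c e)))

theorem one_le_slabBarrier {p N : ℝ} (hN : 0 ≤ N) {e x : E} {c : ℝ} (hx : c ≤ ⟪e, x⟫) :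
    1 ≤ slabBarrier p N e c x := by
  have h1 : 0 < (1 + ‖x‖ ^ 2 : ℝ) ^ (-p) := by positivity
  have h2 : Real.exp (-(N * (⟪e, x⟫ - c))) ≤ 1 :=
    Real.exp_le_one_iff.2 (by nlinarith)
  unfold slabBarrier
  linarith

theorem slabBarrier_le {p N : ℝ} (hp : 0 ≤ p) {e x : E} {c : ℝ} :
    slabBarrier p N e c x ≤ 3 := by
  have h1 : (1 + ‖x‖ ^ 2 : ℝ) ^ (-p) ≤ 1 :=
    Real.rpow_le_one_of_one_le_of_nonpos (by nlinarith [sq_nonneg ‖x‖]) (by linarith)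
  have h2 := Real.exp_pos (-(N * (⟪e, x⟫ - c)))
  unfold slabBarrier
  linarith

variable [FiniteDimensional ℝ E]

theorem laplacian_slabBarrier_le (hD : 3 ≤ Module.finrank ℝ E) {p : ℝ} (hp : 0 < p) (N : ℝ)
    {e : E} (he : ‖e‖ = 1) (c : ℝ) (x : E) :
    Δ (slabBarrier p N e c) x ≤ -(2 * p * (1 - 2 * p)) * (1 + ‖x‖ ^ 2) ^ (-p - 1) -
      N ^ 2 * Real.exp (-(N * (⟪e, x⟫ - c))) := by
  have h1 := laplacian_linear_combination (contDiff_decay (E := E) p) (contDiff_exp_slab N c e)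
    1 (-1) x
  rw [laplacian_exp_slab N c he] at h1
  have h2 := laplacian_decay_le hD hp x
  have h3 : Δ (slabBarrier p N e c) x = Δ (fun x : E => 1 * (1 + ‖x‖ ^ 2 : ℝ) ^ (-p) +
      -1 * Real.exp (-(N * (⟪e, x⟫ - c)))) x := by
    have h := laplacian_linear_combination (φ := fun _ : E => (2 : ℝ)) contDiff_const
      ((contDiff_const.mul (contDiff_decay p)).add
        (contDiff_const.mul (contDiff_exp_slab N c e)) : ContDiff ℝ 2
          fun x : E => 1 * (1 + ‖x‖ ^ 2 : ℝ) ^ (-p) + -1 * Real.exp (-(N * (⟪e, x⟫ - c))))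
      1 1 x
    simp only [one_mul] at h
    rw [InnerProductSpace.laplacian_const] at h
    rw [Pi.zero_apply, zero_add] at h
    have hs : slabBarrier p N e c = fun x : E =>
        2 + (1 * (1 + ‖x‖ ^ 2 : ℝ) ^ (-p) + -1 * Real.exp (-(N * (⟪e, x⟫ - c)))) := rfl
    simpa only [hs, one_mul] using h
  rw [h3, h1]
  linarith

/-- The properties of a solution `u` of `Δ u = ρ f(u)` which make the moving plane
method work. -/
structure MovingPlaneData (u : E → ℝ) (f : ℝ → ℝ) (ρ : E → ℝ) (α L : ℝ) : Prop where
  finrank : 3 ≤ Module.finrank ℝ E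
  contDiff : ContDiff ℝ 2 u
  eqn : ∀ x, Δ u x = ρ x * f (u x)
  f_pos : ∀ x, 0 < f (u x)
  rho_pos : ∀ x, 0 < ρ x
  rho_anti : ∀ x z, ‖z‖ ≤ ‖x‖ → ρ x ≤ ρ z
  rho_strictAnti : ∀ x z, ‖z‖ < ‖x‖ → 1 < ‖x‖ → ρ x < ρ z
  rho_decay : ∀ x, 1 ≤ ‖x‖ → ρ x ≤ ‖x‖ ^ (-α)
  alpha : 2 < α
  L_nonneg : 0 ≤ L
  oneSided : ∀ x z, ‖z‖ ≤ ‖x‖ → u x ≤ u z → f (u x) - f (u z) ≤ L * (u z - u x)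
  locLip : ∀ r : ℝ, ∃ C : ℝ, 0 ≤ C ∧ ∀ x z, ‖x‖ ≤ r → ‖z‖ ≤ r →
    f (u x) - f (u z) ≤ C * |u x - u z|
  atInfinity : ∀ η : ℝ, 0 < η → ∃ R : ℝ, ∀ x z, ‖z‖ ≤ ‖x‖ → R ≤ ‖x‖ → u z - η ≤ u x

namespace MovingPlaneData

variable {u : E → ℝ} {f : ℝ → ℝ} {ρ : E → ℝ} {α L : ℝ}

theorem exists_barrier (h : MovingPlaneData u f ρ α L) : ∃ p N R : ℝ, 0 < p ∧ 0 < N ∧ 1 ≤ R ∧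
    ∀ (e : E) (c : ℝ) (x : E), ‖e‖ = 1 → c < ⟪e, x⟫ → (R < ‖x‖ ∨ ⟪e, x⟫ - c < 1 / N) →
      Δ (slabBarrier p N e c) x < -(3 * L * ρ x) := by
  obtain ⟨p, hp, hp1, hp2⟩ : ∃ p : ℝ, 0 < p ∧ p < 1 / 2 ∧ 0 < α - 2 * p - 2 := by
    have := h.alpha
    refine ⟨min ((α - 2) / 4) (1 / 4), lt_min (by linarith) (by norm_num),
      (min_le_right _ _).trans_lt (by norm_num), ?_⟩
    have := min_le_left ((α - 2) / 4) (1 / 4)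
    linarith
  have hK : 0 < 2 * p * (1 - 2 * p) := by
    have : 0 < 1 - 2 * p := by linarith
    positivity
  obtain ⟨R, hR1, hR⟩ : ∃ R : ℝ, 1 ≤ R ∧ ∀ r, R ≤ r →
      3 * L / (2 * p * (1 - 2 * p) * 2 ^ (-p - 1)) < r ^ (α - 2 * p - 2) := by
    have := ((tendsto_rpow_atTop hp2).eventually_gt_atTop
      (3 * L / (2 * p * (1 - 2 * p) * 2 ^ (-p - 1)))).and (eventually_ge_atTop 1)
    obtain ⟨R, hR⟩ := eventually_atTop.1 this
    exact ⟨R, (hR R le_rfl).2, fun r hr => (hR r hr).1⟩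
  have hL := h.L_nonneg
  have hρ0 := h.rho_pos 0
  have hLρ : 0 ≤ 3 * L * ρ 0 := by positivity
  refine ⟨p, 3 * (1 + 3 * L * ρ 0), R, hp, by positivity, hR1, fun e c x he hx hcase => ?_⟩
  refine (laplacian_slabBarrier_le h.finrank hp _ he c x).trans_lt ?_
  set N := 3 * (1 + 3 * L * ρ 0) with hN
  have hNpos : 0 < N := by positivity
  have hexp := Real.exp_pos (-(N * (⟪e, x⟫ - c)))
  have hQ : 0 < (1 + ‖x‖ ^ 2 : ℝ) ^ (-p - 1) := by positivity
  rcases hcase with hxR | hslab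
  · have hx1 : 1 ≤ ‖x‖ := hR1.trans hxR.le
    have hx0 : 0 < ‖x‖ := by linarith
    have h1 : 2 ^ (-p - 1) * ‖x‖ ^ (-2 * p - 2) ≤ (1 + ‖x‖ ^ 2 : ℝ) ^ (-p - 1) := by
      have : ‖x‖ ^ (-2 * p - 2) = (‖x‖ ^ 2) ^ (-p - 1) := by
        rw [← Real.rpow_natCast, ← Real.rpow_mul hx0.le]
        congr 1
        push_cast
        ring
      rw [this, ← Real.mul_rpow (by norm_num) (by positivity)]
      exact Real.rpow_le_rpow_of_nonpos (by positivity) (by nlinarith) (by linarith)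
    have h2 := hR ‖x‖ hxR.le
    rw [div_lt_iff₀ (by positivity)] at h2
    have h3 : ‖x‖ ^ (α - 2 * p - 2) * ‖x‖ ^ (-α) = ‖x‖ ^ (-2 * p - 2) := by
      rw [← Real.rpow_add hx0]
      congr 1
      ring
    have hα : 0 < ‖x‖ ^ (-α) := by positivity
    have h4 := mul_lt_mul_of_pos_right h2 hα
    have h5 : 3 * L * ρ x ≤ 3 * L * ‖x‖ ^ (-α) :=
      mul_le_mul_of_nonneg_left (h.rho_decay x hx1) (by positivity)
    have h6 := mul_le_mul_of_nonneg_left h1 hK.le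
    have h7 : ‖x‖ ^ (α - 2 * p - 2) * (2 * p * (1 - 2 * p) * 2 ^ (-p - 1)) * ‖x‖ ^ (-α) =
        2 * p * (1 - 2 * p) * (2 ^ (-p - 1) * ‖x‖ ^ (-2 * p - 2)) := by
      rw [← h3]; ring
    have h8 : 0 ≤ N ^ 2 * Real.exp (-(N * (⟪e, x⟫ - c))) := by positivity
    linarith
  · have h1 : N * (⟪e, x⟫ - c) < 1 := by
      rw [lt_div_iff₀ hNpos] at hslab
      linarith
    have h2 : 1 / 3 < Real.exp (-(N * (⟪e, x⟫ - c))) := by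
      have h3 : Real.exp (-1) ≤ Real.exp (-(N * (⟪e, x⟫ - c))) :=
        Real.exp_le_exp.2 (by linarith)
      have h4 : (1 : ℝ) / 3 < Real.exp (-1) := by
        rw [Real.exp_neg, ← one_div]
        exact one_div_lt_one_div_of_lt (Real.exp_pos 1) (Real.exp_one_lt_d9.trans (by norm_num))
      linarith
    have h3 : 3 * L * ρ x ≤ 3 * L * ρ 0 :=
      mul_le_mul_of_nonneg_left (h.rho_anti x 0 (by simp)) (by positivity)
    have h4 : N ^ 2 * (1 / 3) < N ^ 2 * Real.exp (-(N * (⟪e, x⟫ - c))) :=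
      mul_lt_mul_of_pos_left h2 (by positivity)
    have h5 : 3 * L * ρ 0 ≤ N ^ 2 * (1 / 3) := by nlinarith
    have h6 : 0 ≤ 2 * p * (1 - 2 * p) * (1 + ‖x‖ ^ 2 : ℝ) ^ (-p - 1) := by positivity
    linarith

theorem laplacian_planeRefl_sub (h : MovingPlaneData u f ρ α L) {e : E} (he : ‖e‖ = 1) (c : ℝ)
    (x : E) : Δ (fun y => 1 * u (planeRefl e c y) + -1 * u y) x =
      ρ (planeRefl e c x) * f (u (planeRefl e c x)) - ρ x * f (u x) := by
  have hur : ContDiff ℝ 2 fun y => u (planeRefl e c y) := h.contDiff.comp (contDiff_planeRefl e c)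
  rw [laplacian_linear_combination hur h.contDiff,
    laplacian_comp_planeRefl h.contDiff he, h.eqn, h.eqn]
  ring

theorem le_of_le_on_core (h : MovingPlaneData u f ρ α L) {p N R c : ℝ} {e : E} (hp : 0 < p)
    (hN : 0 < N) (he : ‖e‖ = 1) (hc : 0 < c)
    (hbar : ∀ x, c < ⟪e, x⟫ → (R < ‖x‖ ∨ ⟪e, x⟫ - c < 1 / N) →
      Δ (slabBarrier p N e c) x < -(3 * L * ρ x))
    (hcore : ∀ x, ‖x‖ ≤ R → c + 1 / N ≤ ⟪e, x⟫ → u (planeRefl e c x) ≤ u x)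
    (x : E) (hx : c ≤ ⟪e, x⟫) : u (planeRefl e c x) ≤ u x := by
  by_contra! hlt
  have hu := h.contDiff
  have hur : ContDiff ℝ 2 fun y => u (planeRefl e c y) := hu.comp (contDiff_planeRefl e c)
  have hv2 : ContDiff ℝ 2 fun y => 1 * u (planeRefl e c y) + -1 * u y :=
    (contDiff_const.mul hur).add (contDiff_const.mul hu)
  have hg2 := contDiff_slabBarrier p N e c
  have hlap := h.laplacian_planeRefl_sub he c
  set v : E → ℝ := fun y => 1 * u (planeRefl e c y) + -1 * u y with hv
  set g : E → ℝ := slabBarrier p N e c with hg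
  have hg1 : ∀ y, c ≤ ⟪e, y⟫ → 1 ≤ g y := fun y hy => one_le_slabBarrier hN.le hy
  have hvx : 0 < v x := by simp only [hv]; linarith
  have hqx : 0 < v x / g x := div_pos hvx (by linarith [hg1 x hx])
  obtain ⟨R₁, hR₁⟩ := h.atInfinity (v x / g x) hqx
  have hclosed : IsClosed {y : E | c ≤ ⟪e, y⟫} :=
    isClosed_le continuous_const (continuous_const.inner continuous_id)
  have hcpt : IsCompact ({y : E | c ≤ ⟪e, y⟫} ∩ Metric.closedBall 0 (max R₁ ‖x‖)) :=
    (isCompact_closedBall _ _).inter_left hclosed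
  have hxmem : x ∈ {y : E | c ≤ ⟪e, y⟫} ∩ Metric.closedBall 0 (max R₁ ‖x‖) := by
    simp [hx]
  have hqc : ContinuousOn (fun y => v y / g y)
      ({y : E | c ≤ ⟪e, y⟫} ∩ Metric.closedBall 0 (max R₁ ‖x‖)) :=
    hv2.continuous.continuousOn.div hg2.continuous.continuousOn
      fun y hy => by linarith [hg1 y hy.1]
  obtain ⟨x₀, hx₀, hmax⟩ := hcpt.exists_isMaxOn ⟨x, hxmem⟩ hqc
  set k := v x₀ / g x₀ with hk
  have hkx : v x / g x ≤ k := hmax hxmem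
  have hkpos : 0 < k := hqx.trans_le hkx
  have hgx₀ := hg1 x₀ hx₀.1
  have hvk : v x₀ = k * g x₀ := by rw [hk, div_mul_cancel₀]; linarith
  have hglob : ∀ y, c ≤ ⟪e, y⟫ → v y ≤ k * g y := by
    intro y hy
    have hgy := hg1 y hy
    by_cases hyR : ‖y‖ ≤ max R₁ ‖x‖
    · have : v y / g y ≤ k := hmax (show y ∈ _ from ⟨hy, by simpa using hyR⟩)
      rwa [div_le_iff₀ (by linarith)] at this
    · push Not at hyR
      have := hR₁ y (planeRefl e c y) (norm_planeRefl_le he hc.le hy)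
        ((le_max_left _ _).trans hyR.le)
      have h1 : v y ≤ k := by simp only [hv]; linarith
      nlinarith
  have hx₀c : c < ⟪e, x₀⟫ := by
    refine lt_of_le_of_ne hx₀.1 fun heq => ?_
    have : v x₀ = 0 := by simp [hv, planeRefl_of_mem heq.symm]
    rw [hvk] at this
    have : 0 < k * g x₀ := by positivity
    linarith
  have hloc : IsLocalMax (fun y => v y - k * g y) x₀ := by
    have hopen : {y : E | c < ⟪e, y⟫} ∈ nhds x₀ :=
      (isOpen_lt continuous_const (continuous_const.inner continuous_id)).mem_nhds hx₀c
    filter_upwards [hopen] with y hy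
    have := hglob y (le_of_lt hy)
    linarith
  have hkg2 : ContDiff ℝ 2 fun y => k * g y := contDiff_const.mul hg2
  have hcmp := laplacian_le_of_isLocalMax_sub hv2 hkg2 hloc
  rw [hlap, laplacian_const_mul hg2] at hcmp
  have hcase : R < ‖x₀‖ ∨ ⟪e, x₀⟫ - c < 1 / N := by
    by_contra! hcon
    have h1 := hcore x₀ hcon.1 (by linarith [hcon.2])
    have h2 : v x₀ ≤ 0 := by simp only [hv]; linarith
    rw [hvk] at h2
    have : 0 < k * g x₀ := by positivity
    linarith
  have hΔ := mul_lt_mul_of_pos_left (hbar x₀ hx₀c hcase) hkpos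
  have hz := norm_planeRefl_le he hc.le hx₀.1
  set z := planeRefl e c x₀ with hzdef
  have hvz : v x₀ = u z - u x₀ := by simp only [hv, ← hzdef]; ring
  have huz : u x₀ ≤ u z := by
    have : 0 < k * g x₀ := by positivity
    linarith
  have h1 := h.oneSided x₀ z hz huz
  have h2 := mul_le_mul_of_nonneg_right (h.rho_anti x₀ z hz) (h.f_pos z).le
  have hρ := h.rho_pos x₀
  have h3 := mul_le_mul_of_nonneg_left h1 hρ.le
  have h4 : g x₀ ≤ 3 := slabBarrier_le hp.le
  have h5 : ρ x₀ * (L * (u z - u x₀)) ≤ ρ x₀ * L * k * 3 := by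
    rw [← hvz, hvk]
    have h0 : 0 ≤ ρ x₀ * L * k := mul_nonneg (mul_nonneg hρ.le h.L_nonneg) hkpos.le
    have := mul_le_mul_of_nonneg_left h4 h0
    linarith
  have h6 : Δ g x₀ = Δ (slabBarrier p N e c) x₀ := rfl
  nlinarith

end MovingPlaneData
end MovingPlanes

section HopfLemma

variable {E : Type*} [NormedAddCommGroup E] [InnerProductSpace ℝ E] [FiniteDimensional ℝ E]

/-- Hopf's boundary point lemma in a half space. -/
theorem not_isLocalMin_of_pos_halfSpace {w : E → ℝ} (hw : ContDiff ℝ 2 w) {e : E} (he : ‖e‖ = 1)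
    {y : E} {K : ℝ} (hK : 0 ≤ K) (hw0 : w y = 0) (hnonneg : ∀ x, ⟪e, x - y⟫ = 0 → 0 ≤ w x)
    (hpos : ∀ x, 0 < ⟪e, x - y⟫ → 0 < w x)
    (hΔ : ∀ x, 0 < ⟪e, x - y⟫ → ‖x - y‖ ≤ 1 → Δ w x ≤ K * w x) : ¬ IsLocalMin w y := by
  intro hmin
  set A : ℝ := Module.finrank ℝ E + 1 with hA
  have hA1 : 1 ≤ A := by simp [hA]
  set τ : ℝ := 1 / ((A + 1) * (K + 1)) with hτ
  have hτpos : 0 < τ := by positivity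
  have hτA : τ * (A + 1) = 1 / (K + 1) := by rw [hτ]; field_simp
  have hK1 : 1 / (K + 1) ≤ 1 := by
    rw [div_le_one (by positivity)]; linarith
  have hKK : K * (1 / (K + 1)) < 2 := by
    rw [mul_one_div, div_lt_iff₀ (by positivity)]; linarith
  have hτ1 : τ ≤ 1 := by nlinarith
  have hvs := contDiff_quadratic (-1) A 1 e y
  have hΔv := laplacian_quadratic (-1) A 1 he y
  set v : E → ℝ := fun x => -1 * ‖x - y‖ ^ 2 + A * ⟪e, x - y⟫ ^ 2 + 1 * ⟪e, x - y⟫ with hv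
  have ht : Continuous fun x : E => ⟪e, x - y⟫ := by fun_prop
  set G : Set E := {x | 0 ≤ ⟪e, x - y⟫ ∧ ⟪e, x - y⟫ ≤ τ ∧ 0 ≤ v x} with hG
  have hGv : ∀ x, 0 ≤ ⟪e, x - y⟫ → ⟪e, x - y⟫ ≤ τ → v x + ‖x - y‖ ^ 2 ≤ 1 / (K + 1) := by
    intro x h0 h1
    rw [← hτA]
    have h2 : ⟪e, x - y⟫ ^ 2 ≤ τ := by nlinarith
    have h3 := mul_le_mul_of_nonneg_left h2 (by linarith : 0 ≤ A)
    simp only [hv]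
    linarith
  have hGball : ∀ x ∈ G, ‖x - y‖ ≤ 1 := by
    intro x hx
    have := hGv x hx.1 hx.2.1
    have h2 := hx.2.2
    nlinarith [norm_nonneg (x - y)]
  have hGcpt : IsCompact G := by
    refine (isCompact_closedBall y 1).of_isClosed_subset ?_ fun x hx => ?_
    · exact (isClosed_le continuous_const ht).inter
        ((isClosed_le ht continuous_const).inter (isClosed_le continuous_const hvs.continuous))
    · rw [mem_closedBall_iff_norm]; exact hGball x hx
  have hline : ∀ s : ℝ, ⟪e, y + s • e - y⟫ = s ∧ v (y + s • e) = s + (A - 1) * s ^ 2 := by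
    intro s
    have h1 : ⟪e, y + s • e - y⟫ = s := by
      simp [inner_smul_right, he]
    refine ⟨h1, ?_⟩
    simp only [hv, h1]
    rw [add_sub_cancel_left, norm_smul, he, mul_one, Real.norm_eq_abs, sq_abs]
    ring
  have hlineG : ∀ s : ℝ, 0 ≤ s → s ≤ τ → y + s • e ∈ G := by
    intro s h0 h1
    obtain ⟨h2, h3⟩ := hline s
    refine ⟨by rw [h2]; exact h0, by rw [h2]; exact h1, ?_⟩
    rw [h3]
    have := mul_nonneg (sub_nonneg.2 hA1) (sq_nonneg s)
    linarith
  obtain ⟨x₂, hx₂, hx₂min⟩ := (hGcpt.inter_right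
    (isClosed_eq ht (continuous_const (y := τ)))).exists_isMinOn
    ⟨y + τ • e, hlineG τ hτpos.le le_rfl, (hline τ).1⟩ hw.continuous.continuousOn
  set η := w x₂ with hη
  have hηpos : 0 < η := hpos x₂ (by rw [hx₂.2]; exact hτpos)
  have hcd : ContDiff ℝ 2 fun x => η * v x := contDiff_const.mul hvs
  obtain ⟨x₁, hx₁, hx₁min⟩ := hGcpt.exists_isMinOn ⟨y, by simpa using hlineG 0 le_rfl hτpos.le⟩
    (hw.sub hcd).continuous.continuousOn
  have hcomp : 0 ≤ w x₁ - η * v x₁ := by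
    by_contra! hneg
    have hw₁ : 0 ≤ w x₁ := by
      rcases hx₁.1.eq_or_lt with h | h
      · exact hnonneg _ h.symm
      · exact (hpos _ h).le
    have hv₁ : 0 < v x₁ := by
      by_contra! hcon
      have := mul_nonpos_of_nonneg_of_nonpos hηpos.le hcon
      linarith
    have ht₁ : 0 < ⟪e, x₁ - y⟫ := by
      refine lt_of_le_of_ne hx₁.1 fun heq => ?_
      simp only [hv, ← heq] at hv₁
      nlinarith [sq_nonneg ‖x₁ - y‖]
    have hv1 := hGv x₁ hx₁.1 hx₁.2.1
    have htτ : ⟪e, x₁ - y⟫ < τ := by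
      refine lt_of_le_of_ne hx₁.2.1 fun heq => ?_
      have : η ≤ w x₁ := hx₂min ⟨hx₁, heq⟩
      nlinarith [sq_nonneg ‖x₁ - y‖]
    have hloc : IsLocalMax (fun x => η * v x - w x) x₁ := by
      have h1 : ∀ᶠ x in nhds x₁, 0 < ⟪e, x - y⟫ := ht.continuousAt.eventually_const_lt ht₁
      have h2 : ∀ᶠ x in nhds x₁, ⟪e, x - y⟫ < τ := ht.continuousAt.eventually_lt_const htτ
      have h3 : ∀ᶠ x in nhds x₁, 0 < v x := hvs.continuous.continuousAt.eventually_const_lt hv₁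
      filter_upwards [h1, h2, h3] with x a b c
      have : w x₁ - η * v x₁ ≤ w x - η * v x := hx₁min ⟨a.le, b.le, c.le⟩
      linarith
    have hle := laplacian_le_of_isLocalMax_sub hcd hw hloc
    rw [laplacian_const_mul hvs, hΔv] at hle
    have h4 := hΔ x₁ ht₁ (hGball x₁ hx₁)
    have h5 : K * w x₁ ≤ K * (η * v x₁) := mul_le_mul_of_nonneg_left (by linarith) hK
    have h6 : K * (η * v x₁) ≤ η * (K * (1 / (K + 1))) := by
      have : v x₁ ≤ 1 / (K + 1) := by nlinarith [sq_nonneg ‖x₁ - y‖]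
      have := mul_le_mul_of_nonneg_left this (mul_nonneg hηpos.le hK)
      linarith
    have h7 := mul_lt_mul_of_pos_left hKK hηpos
    have h8 : 2 * (-1) * (Module.finrank ℝ E : ℝ) + 2 * A = 2 := by rw [hA]; ring
    rw [h8] at hle
    linarith
  have hder : HasDerivAt (fun s : ℝ => w (y + s • e)) 0 0 := by
    have h1 := hasDerivAt_comp_curve hw (hasDerivAt_line y e 0)
    have h2 : fderiv ℝ w (y + (0 : ℝ) • e) = 0 := by
      rw [zero_smul, add_zero]; exact hmin.fderiv_eq_zero
    rw [h2] at h1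
    simpa using h1
  rw [hasDerivAt_iff_tendsto_slope] at hder
  have hev := (hder.mono_left (nhdsWithin_mono 0 fun s (hs : s ∈ Ioi 0) =>
    (ne_of_gt hs : s ≠ 0))).eventually_lt_const hηpos
  obtain ⟨s, hs1, hs0, hs2⟩ := (hev.and (Ioc_mem_nhdsGT hτpos)).exists
  have h1 : 0 ≤ w (y + s • e) - η * v (y + s • e) := hcomp.trans (hx₁min (hlineG s hs0.le hs2))
  rw [(hline s).2] at h1
  rw [slope_def_field, div_lt_iff₀ (by linarith)] at hs1
  simp only [zero_smul, add_zero, hw0, sub_zero] at hs1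
  have := mul_nonneg hηpos.le (mul_nonneg (sub_nonneg.2 hA1) (sq_nonneg s))
  linarith

end HopfLemma

namespace MovingPlaneData

variable {E : Type*} [NormedAddCommGroup E] [InnerProductSpace ℝ E] [FiniteDimensional ℝ E]
  {u : E → ℝ} {f : ℝ → ℝ} {ρ : E → ℝ} {α L : ℝ}

theorem norm_le_one_of_eq (h : MovingPlaneData u f ρ α L) {e : E} (he : ‖e‖ = 1) {c : ℝ}
    (hc : 0 < c) (hle : ∀ x, c ≤ ⟪e, x⟫ → u (planeRefl e c x) ≤ u x) {x : E} (hx : c < ⟪e, x⟫)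
    (heq : u (planeRefl e c x) = u x) : ‖x‖ ≤ 1 := by
  by_contra! hx1
  have hur : ContDiff ℝ 2 fun y => u (planeRefl e c y) := h.contDiff.comp (contDiff_planeRefl e c)
  have hmax : IsLocalMax (fun y => u (planeRefl e c y) - u y) x := by
    have : ∀ᶠ y in nhds x, c < ⟪e, y⟫ :=
      (by fun_prop : Continuous fun y : E => ⟪e, y⟫).continuousAt.eventually_const_lt hx
    filter_upwards [this] with y hy
    have := hle y hy.le
    linarith
  have h1 := laplacian_le_of_isLocalMax_sub hur h.contDiff hmax
  rw [laplacian_comp_planeRefl h.contDiff he, h.eqn, h.eqn, heq] at h1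
  have h2 := h.rho_strictAnti x _ (norm_planeRefl_lt he hc hx) hx1
  have h3 := mul_lt_mul_of_pos_right h2 (h.f_pos x)
  linarith

theorem lt_of_le_planeRefl (h : MovingPlaneData u f ρ α L) {e : E} (he : ‖e‖ = 1) {c : ℝ}
    (hc : 0 < c) (hle : ∀ x, c ≤ ⟪e, x⟫ → u (planeRefl e c x) ≤ u x) {x : E}
    (hx : c < ⟪e, x⟫) : u (planeRefl e c x) < u x := by
  by_contra! hge
  have hx0 : u (planeRefl e c x) = u x := le_antisymm (hle x hx.le) hge
  have hur : ContDiff ℝ 2 fun y => u (planeRefl e c y) := h.contDiff.comp (contDiff_planeRefl e c)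
  have hinner : Continuous fun y : E => ⟪e, y⟫ := by fun_prop
  have hZ : IsCompact ({y : E | ⟪e, x⟫ ≤ ⟪e, y⟫ ∧ u (planeRefl e c y) = u y} ∩
      Metric.closedBall 0 1) :=
    (isCompact_closedBall _ _).inter_left ((isClosed_le continuous_const hinner).inter
      (isClosed_eq hur.continuous h.contDiff.continuous))
  obtain ⟨y, hy, hymax⟩ := hZ.exists_isMaxOn ⟨x, ⟨le_rfl, hx0⟩, by
    simpa using h.norm_le_one_of_eq he hc hle hx hx0⟩ hinner.continuousOn
  have hyc : c < ⟪e, y⟫ := hx.trans_le hy.1.1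
  have hw2 : ContDiff ℝ 2 fun z => 1 * u z + -1 * u (planeRefl e c z) :=
    (contDiff_const.mul h.contDiff).add (contDiff_const.mul hur)
  obtain ⟨C, hC, hlip⟩ := h.locLip (‖y‖ + 1)
  refine not_isLocalMin_of_pos_halfSpace hw2 he (y := y) (K := ρ 0 * C)
    (mul_nonneg (h.rho_pos 0).le hC) (by rw [hy.1.2]; ring) (fun z hz => ?_) (fun z hz => ?_)
    (fun z hz hzy => ?_) ?_
  · rw [inner_sub_right] at hz
    have := hle z (by linarith)
    linarith
  · rw [inner_sub_right] at hz
    have hzc : c < ⟪e, z⟫ := by linarith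
    rcases (hle z hzc.le).eq_or_lt with heq | hlt
    · have : ⟪e, z⟫ ≤ ⟪e, y⟫ := hymax ⟨⟨by linarith [hy.1.1], heq⟩, by
        simpa using h.norm_le_one_of_eq he hc hle hzc heq⟩
      linarith
    · linarith
  · rw [inner_sub_right] at hz
    have hzc : c ≤ ⟪e, z⟫ := by linarith
    rw [laplacian_linear_combination h.contDiff hur, laplacian_comp_planeRefl h.contDiff he,
      h.eqn, h.eqn]
    have hzn : ‖z‖ ≤ ‖y‖ + 1 := by
      have := norm_add_le (z - y) y
      rw [sub_add_cancel] at this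
      linarith
    have hrn := norm_planeRefl_le he hc.le hzc
    have h1 := hlip z _ hzn (hrn.trans hzn)
    have h2 := hle z hzc
    rw [abs_of_nonneg (by linarith)] at h1
    have h3 := mul_le_mul_of_nonneg_right (h.rho_anti z _ hrn) (h.f_pos (planeRefl e c z)).le
    have h4 := mul_le_mul_of_nonneg_left h1 (h.rho_pos z).le
    have h5 := mul_le_mul_of_nonneg_right (h.rho_anti z 0 (by simp))
      (mul_nonneg hC (sub_nonneg.2 h2))
    linarith
  · have : ∀ᶠ z in nhds y, c < ⟪e, z⟫ := hinner.continuousAt.eventually_const_lt hyc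
    filter_upwards [this] with z hz
    have := hle z hz.le
    rw [hy.1.2]
    linarith

theorem le_planeRefl_of_large (h : MovingPlaneData u f ρ α L) {p N R c : ℝ} {e : E} (hp : 0 < p)
    (hN : 0 < N) (he : ‖e‖ = 1) (hc : 0 < c) (hRc : R < c)
    (hbar : ∀ x, c < ⟪e, x⟫ → (R < ‖x‖ ∨ ⟪e, x⟫ - c < 1 / N) →
      Δ (slabBarrier p N e c) x < -(3 * L * ρ x)) {x : E} (hx : c ≤ ⟪e, x⟫) :
    u (planeRefl e c x) ≤ u x := by
  refine h.le_of_le_on_core hp hN he hc hbar (fun y hy1 hy2 => ?_) x hx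
  have h1 := real_inner_le_norm e y
  have h2 : 0 < 1 / N := by positivity
  rw [he] at h1
  linarith

theorem eventually_le_planeRefl (h : MovingPlaneData u f ρ α L) {p N R c : ℝ} {e : E} (hp : 0 < p)
    (hN : 0 < N) (he : ‖e‖ = 1) (hc : 0 < c)
    (hbar : ∀ (c : ℝ) (x : E), c < ⟪e, x⟫ → (R < ‖x‖ ∨ ⟪e, x⟫ - c < 1 / N) →
      Δ (slabBarrier p N e c) x < -(3 * L * ρ x))
    (hle : ∀ x, c ≤ ⟪e, x⟫ → u (planeRefl e c x) ≤ u x) :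
    ∀ᶠ d in nhds c, ∀ x, d ≤ ⟪e, x⟫ → u (planeRefl e d x) ≤ u x := by
  have hinner : Continuous fun y : E => ⟪e, y⟫ := by fun_prop
  have hN' : 0 < 1 / N := by positivity
  have hK : IsCompact ({x : E | c + 1 / N / 2 ≤ ⟪e, x⟫} ∩ Metric.closedBall 0 R) :=
    (isCompact_closedBall _ _).inter_left (isClosed_le continuous_const hinner)
  have hopen : IsOpen {q : ℝ × E | u (planeRefl e q.1 q.2) < u q.2} :=
    isOpen_lt (h.contDiff.continuous.comp (continuous_planeRefl e))
      (h.contDiff.continuous.comp continuous_snd)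
  have hev : ∀ᶠ d in nhds c, ∀ x ∈ {x : E | c + 1 / N / 2 ≤ ⟪e, x⟫} ∩ Metric.closedBall 0 R,
      u (planeRefl e d x) < u x := by
    refine hK.eventually_forall_of_forall_eventually fun x hx => ?_
    exact hopen.mem_nhds (h.lt_of_le_planeRefl he hc hle
      (lt_of_lt_of_le (by linarith) hx.1) : u (planeRefl e c x) < u x)
  filter_upwards [hev, lt_mem_nhds hc, lt_mem_nhds (by linarith : c - 1 / N / 2 < c)] with d h1 h2 h3
  refine h.le_of_le_on_core hp hN he h2 (hbar d) fun x hx1 hx2 => ?_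
  exact (h1 x ⟨by show c + 1 / N / 2 ≤ ⟪e, x⟫; linarith, by simpa using hx1⟩).le

theorem le_planeRefl_zero (h : MovingPlaneData u f ρ α L) {e : E} (he : ‖e‖ = 1) {x : E}
    (hx : 0 < ⟪e, x⟫) : u (planeRefl e 0 x) ≤ u x := by
  obtain ⟨p, N, R, hp, hN, hR, hbar⟩ := h.exists_barrier
  set Λ : Set ℝ := {c | ∀ x, c ≤ ⟪e, x⟫ → u (planeRefl e c x) ≤ u x} with hΛ
  have hcont : ∀ x : E, Continuous fun c : ℝ => u (planeRefl e c x) := fun x =>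
    h.contDiff.continuous.comp ((continuous_planeRefl e).comp
      (continuous_id.prodMk continuous_const))
  have hpos : ∀ a, 0 < a → a ∈ Λ := by
    intro a ha
    set b := max a (R + 1) with hb
    have hab : a ≤ b := le_max_left _ _
    have hbΛ : b ∈ Λ := fun y hy => h.le_planeRefl_of_large hp hN he (ha.trans_le hab)
      (lt_of_lt_of_le (by linarith) (le_max_right _ _)) (fun z => hbar e b z he) hy
    have hclosed : IsClosed Λ := by
      have : Λ = ⋂ x : E, {c | ⟪e, x⟫ ≤ c} ∪ {c | u (planeRefl e c x) ≤ u x} := by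
        ext c
        refine ⟨fun hc => mem_iInter.2 fun y => ?_, fun hc y hy => ?_⟩
        · exact (le_total ⟪e, y⟫ c).imp id (hc y)
        · rcases mem_iInter.1 hc y with h1 | h1
          · rw [planeRefl_of_mem (le_antisymm h1 hy)]
          · exact h1
      rw [this]
      exact isClosed_iInter fun y => (isClosed_le continuous_const continuous_id).union
        (isClosed_le (hcont y) continuous_const)
    refine (hclosed.inter isClosed_Icc).Icc_subset_of_forall_exists_lt hbΛ (fun c hc y hy => ?_)
      ⟨le_rfl, hab⟩
    have hev := h.eventually_le_planeRefl hp hN he (ha.trans hc.2.1)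
      (fun d z => hbar e d z he) hc.1
    obtain ⟨d, hd, hd2⟩ := ((hev.filter_mono nhdsWithin_le_nhds).and
      (Ico_mem_nhdsLT (mem_Iio.1 hy))).exists
    exact ⟨d, hd, hd2⟩
  have hlim : Tendsto (fun c : ℝ => u (planeRefl e c x)) (nhdsWithin 0 (Ioi 0))
      (nhds (u (planeRefl e 0 x))) := (hcont x).continuousAt.continuousWithinAt
  refine le_of_tendsto hlim ?_
  filter_upwards [Ioo_mem_nhdsGT hx] with c hc
  exact hpos c hc.1 x hc.2.le

theorem eq_of_norm_eq (h : MovingPlaneData u f ρ α L) {x y : E} (hxy : ‖x‖ = ‖y‖) : u x = u y := by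
  have key : ∀ x y : E, ‖x‖ = ‖y‖ → u y ≤ u x := by
    intro x y hxy
    rcases eq_or_ne x y with rfl | hne
    · rfl
    obtain ⟨e, he, hpos, hrefl⟩ := exists_planeRefl_eq hxy hne
    rw [← hrefl]
    exact h.le_planeRefl_zero he hpos
  exact le_antisymm (key y x hxy.symm) (key x y hxy)

end MovingPlaneData

section RadialComparison

variable {E : Type*} [NormedAddCommGroup E] [InnerProductSpace ℝ E]

theorem hess_smul (u : E → ℝ) (x v : E) (r : ℝ) : hess u x (r • v) = r ^ 2 * hess u x v := by
  simp [hess]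
  ring

theorem hess_neg (u : E → ℝ) (x v : E) : hess (fun y => -u y) x v = -hess u x v := by
  simp only [hess]
  rw [show fderiv ℝ (fun y => -u y) = fun y => -fderiv ℝ u y from funext fun y => fderiv_fun_neg,
    fderiv_fun_neg]
  rfl

/-- At a maximum over a sphere, the second derivatives in tangential directions are controlled by
the normal derivative. -/
theorem hess_le_of_max_on_sphere {u : E → ℝ} (hu : ContDiff ℝ 2 u) {ω v : E} {r : ℝ} (hr : 0 < r)
    (hω : ‖ω‖ = 1) (hv : ‖v‖ = 1) (hωv : ⟪ω, v⟫ = 0)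
    (hmax : ∀ y, ‖y‖ = r → u y ≤ u (r • ω)) :
    hess u (r • ω) v ≤ fderiv ℝ u (r • ω) ω / r := by
  have hΓ : ∀ s : ℝ, HasDerivAt (fun s : ℝ => (r * Real.cos s) • ω + (r * Real.sin s) • v)
      ((r * -Real.sin s) • ω + (r * Real.cos s) • v) s := fun s =>
    (((Real.hasDerivAt_cos s).const_mul r).smul_const ω).add
      (((Real.hasDerivAt_sin s).const_mul r).smul_const v)
  have hΓ' : HasDerivAt (fun s : ℝ => (r * -Real.sin s) • ω + (r * Real.cos s) • v)
      ((r * -Real.cos 0) • ω + (r * -Real.sin 0) • v) 0 :=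
    (((Real.hasDerivAt_sin 0).neg.const_mul r).smul_const ω).add
      (((Real.hasDerivAt_cos 0).const_mul r).smul_const v)
  have hnorm : ∀ s : ℝ, ‖(r * Real.cos s) • ω + (r * Real.sin s) • v‖ = r := by
    intro s
    rw [← sq_eq_sq₀ (norm_nonneg _) hr.le, norm_add_sq_real, norm_smul, norm_smul, hω, hv,
      inner_smul_left, inner_smul_right, hωv, mul_one, mul_one, Real.norm_eq_abs, Real.norm_eq_abs,
      sq_abs, sq_abs]
    have := Real.sin_sq_add_cos_sq s
    linear_combination r ^ 2 * this
  have hloc : IsLocalMax (fun s : ℝ => u ((r * Real.cos s) • ω + (r * Real.sin s) • v)) 0 := by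
    refine Eventually.of_forall fun s => ?_
    simpa using hmax _ (hnorm s)
  have h1 := (second_deriv_nonpos_of_isLocalMax hloc
    (Eventually.of_forall fun s => hasDerivAt_comp_curve hu (hΓ s))
    (hasDerivAt_fderiv_comp_curve hu (hΓ 0) hΓ')).2
  simp only [Real.cos_zero, Real.sin_zero, mul_one, mul_zero, neg_zero, zero_smul, add_zero,
    zero_add, hess_smul, map_smul, smul_eq_mul] at h1
  rw [le_div_iff₀ hr]
  nlinarith

theorem hasDerivAt_rpow_curve (m ε : ℝ) (ω : E) {s : ℝ} (hs : ε < s) :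
    HasDerivAt (fun s => (s - ε) ^ (-m) • ω) ((-m * (s - ε) ^ (-m - 1)) • ω) s := by
  have := ((hasDerivAt_id s).sub_const ε).rpow_const (p := -m) (Or.inl (sub_pos.2 hs).ne')
  exact (this.smul_const ω).congr_deriv (by simp)

theorem hasDerivAt_rpow_curve' (m ε : ℝ) (ω : E) {s : ℝ} (hs : ε < s) :
    HasDerivAt (fun s => (-m * (s - ε) ^ (-m - 1)) • ω)
      ((m * (m + 1) * (s - ε) ^ (-m - 2)) • ω) s := by
  have := (((hasDerivAt_id s).sub_const ε).rpow_const (p := -m - 1)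
    (Or.inl (sub_pos.2 hs).ne')).const_mul (-m)
  refine (this.smul_const ω).congr_deriv ?_
  have h2 : -m - 1 - 1 = -m - 2 := by ring
  simp only [h2, id_eq]
  congr 1
  ring

variable [FiniteDimensional ℝ E]

theorem laplacian_le_of_max_on_sphere {u : E → ℝ} (hu : ContDiff ℝ 2 u) {ω : E} {r : ℝ}
    (hr : 0 < r) (hω : ‖ω‖ = 1) (hmax : ∀ y, ‖y‖ = r → u y ≤ u (r • ω)) :
    Δ u (r • ω) ≤ hess u (r • ω) ω +
      (Module.finrank ℝ E - 1) * (fderiv ℝ u (r • ω) ω / r) := by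
  classical
  obtain ⟨n, hn⟩ : ∃ n, Module.finrank ℝ E = n + 1 :=
    Nat.exists_eq_succ_of_ne_zero fun h0 => by
      have := Module.finrank_zero_iff.1 h0
      simp [Subsingleton.elim ω 0] at hω
  have hon : Orthonormal ℝ (({0} : Set (Fin (n + 1))).domRestrict fun _ => ω) := by
    refine ⟨fun _ => hω, fun i j hij => absurd (Subsingleton.elim i j) hij⟩
  obtain ⟨b, hb⟩ := hon.exists_orthonormalBasis_extension_of_card_eq (by simp [hn])
  have hb0 : b 0 = ω := hb 0 rfl
  rw [laplacian_eq_sum_hess b, Fin.sum_univ_succ, hb0]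
  have hle : ∀ i ∈ (Finset.univ : Finset (Fin n)),
      hess u (r • ω) (b i.succ) ≤ fderiv ℝ u (r • ω) ω / r := fun i _ =>
    hess_le_of_max_on_sphere hu hr hω (b.norm_eq_one _)
      (by rw [← hb0]; exact b.inner_eq_zero (Fin.succ_ne_zero i).symm) hmax
  have := Finset.sum_le_sum hle
  simp only [Finset.sum_const, Finset.card_univ, Fintype.card_fin, nsmul_eq_mul] at this
  rw [hn]
  push_cast
  linarith

theorem le_laplacian_of_min_on_sphere {u : E → ℝ} (hu : ContDiff ℝ 2 u) {ω : E} {r : ℝ}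
    (hr : 0 < r) (hω : ‖ω‖ = 1) (hmin : ∀ y, ‖y‖ = r → u (r • ω) ≤ u y) :
    hess u (r • ω) ω + (Module.finrank ℝ E - 1) * (fderiv ℝ u (r • ω) ω / r) ≤ Δ u (r • ω) := by
  have h := laplacian_le_of_max_on_sphere hu.neg hr hω fun y hy => neg_le_neg (hmin y hy)
  have h1 : Δ (fun y => -u y) (r • ω) = -Δ u (r • ω) := by
    simpa using laplacian_const_mul hu (-1) (r • ω)
  rw [h1, hess_neg, fderiv_fun_neg, neg_apply, neg_div] at h
  linarith

/-- Comparison of the Laplacians at a constrained maximum of `u x - u y`, where the constraint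
couples the radii of `x` and `y` through the variable `|x| ^ (-1 / m)`. -/
theorem laplacian_le_laplacian_of_radial_max {u : E → ℝ} (hu : ContDiff ℝ 2 u) {ω ω' : E}
    (hω : ‖ω‖ = 1) (hω' : ‖ω'‖ = 1) {m ε τ : ℝ} (hm : 0 < m)
    (hmD : m + 1 ≤ m * (Module.finrank ℝ E - 1)) (hε : 0 < ε) (hετ : ε < τ)
    (hloc : IsLocalMax (fun s => u (s ^ (-m) • ω) - u ((s - ε) ^ (-m) • ω')) τ)
    (hmax : ∀ y, ‖y‖ = τ ^ (-m) → u y ≤ u (τ ^ (-m) • ω))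
    (hmin : ∀ y, ‖y‖ = (τ - ε) ^ (-m) → u ((τ - ε) ^ (-m) • ω') ≤ u y)
    (hb : 0 ≤ fderiv ℝ u ((τ - ε) ^ (-m) • ω') ω') :
    (τ ^ (-m - 1)) ^ 2 * Δ u (τ ^ (-m) • ω) ≤
      ((τ - ε) ^ (-m - 1)) ^ 2 * Δ u ((τ - ε) ^ (-m) • ω') := by
  have hτ : 0 < τ := hε.trans hετ
  have hσ : 0 < τ - ε := sub_pos.2 hετ
  have hd1 : ∀ s : ℝ, 0 < s → HasDerivAt (fun s : ℝ => s ^ (-m) • ω)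
      ((-m * s ^ (-m - 1)) • ω) s := fun s hs => by
    simpa using hasDerivAt_rpow_curve m 0 ω hs
  have hd2 : HasDerivAt (fun s : ℝ => (-m * s ^ (-m - 1)) • ω)
      ((m * (m + 1) * τ ^ (-m - 2)) • ω) τ := by
    simpa using hasDerivAt_rpow_curve' m 0 ω hτ
  have hev : ∀ᶠ s in nhds τ, HasDerivAt (fun s => u (s ^ (-m) • ω) - u ((s - ε) ^ (-m) • ω'))
      (fderiv ℝ u (s ^ (-m) • ω) ((-m * s ^ (-m - 1)) • ω) -
        fderiv ℝ u ((s - ε) ^ (-m) • ω') ((-m * (s - ε) ^ (-m - 1)) • ω')) s := by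
    filter_upwards [lt_mem_nhds hετ] with s hs
    exact (hasDerivAt_comp_curve hu (hd1 s (hε.trans hs))).sub
      (hasDerivAt_comp_curve hu (hasDerivAt_rpow_curve m ε ω' hs))
  obtain ⟨h1, h2⟩ := second_deriv_nonpos_of_isLocalMax hloc hev
    ((hasDerivAt_fderiv_comp_curve hu (Γ' := fun s : ℝ => (-m * s ^ (-m - 1)) • ω)
      (hd1 τ hτ) hd2).sub (hasDerivAt_fderiv_comp_curve hu
        (Γ' := fun s : ℝ => (-m * (s - ε) ^ (-m - 1)) • ω') (hasDerivAt_rpow_curve m ε ω' hετ)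
        (hasDerivAt_rpow_curve' m ε ω' hετ)))
  have h3 := laplacian_le_of_max_on_sphere hu (Real.rpow_pos_of_pos hτ (-m)) hω hmax
  have h4 := le_laplacian_of_min_on_sphere hu (Real.rpow_pos_of_pos hσ (-m)) hω' hmin
  simp only [map_smul, smul_eq_mul, hess_smul] at h1 h2
  have hpow : ∀ t : ℝ, 0 < t → t ^ (-m) = t * t ^ (-m - 1) ∧ t ^ (-m - 2) = t ^ (-m - 1) / t := by
    intro t ht
    constructor
    · nth_rewrite 2 [← Real.rpow_one t]
      rw [← Real.rpow_add ht]
      congr 1; ring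
    · rw [eq_div_iff ht.ne']
      nth_rewrite 2 [← Real.rpow_one t]
      rw [← Real.rpow_add ht]
      congr 1; ring
  have hP : 0 < τ ^ (-m - 1) := by positivity
  have hQ : 0 < (τ - ε) ^ (-m - 1) := by positivity
  generalize Δ u (τ ^ (-m) • ω) = X at *
  generalize Δ u ((τ - ε) ^ (-m) • ω') = Y at *
  generalize fderiv ℝ u (τ ^ (-m) • ω) ω = a at *
  generalize fderiv ℝ u ((τ - ε) ^ (-m) • ω') ω' = b at *
  generalize hess u (τ ^ (-m) • ω) ω = A at *
  generalize hess u ((τ - ε) ^ (-m) • ω') ω' = B at *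
  rw [(hpow τ hτ).1] at h3
  rw [(hpow _ hσ).1] at h4
  rw [(hpow τ hτ).2, (hpow _ hσ).2] at h2
  have hσ1 : 1 / τ ≤ 1 / (τ - ε) := one_div_le_one_div_of_le hσ (by linarith)
  generalize τ ^ (-m - 1) = P at *
  generalize τ - ε = σ at *
  generalize σ ^ (-m - 1) = Q at *
  set d : ℝ := (Module.finrank ℝ E : ℝ) - 1
  have hc : P * a = Q * b := by
    have : m * (P * a - Q * b) = 0 := by linarith
    have := (mul_eq_zero.1 this).resolve_left hm.ne'
    linarith
  have hc0 : 0 ≤ Q * b := mul_nonneg hQ.le hb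
  have e3 : P ^ 2 * X ≤ P ^ 2 * A + d * (Q * b) * (1 / τ) := by
    have := mul_le_mul_of_nonneg_left h3 (sq_nonneg P)
    have e : P ^ 2 * (A + d * (a / (τ * P))) = P ^ 2 * A + d * (P * a) * (1 / τ) := by
      field_simp
    rwa [e, hc] at this
  have e4 : Q ^ 2 * B + d * (Q * b) * (1 / σ) ≤ Q ^ 2 * Y := by
    have := mul_le_mul_of_nonneg_left h4 (sq_nonneg Q)
    have e : Q ^ 2 * (B + d * (b / (σ * Q))) = Q ^ 2 * B + d * (Q * b) * (1 / σ) := by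
      field_simp
    rwa [e] at this
  have e2 : m * (P ^ 2 * A) + (m + 1) * (Q * b) * (1 / τ) ≤
      m * (Q ^ 2 * B) + (m + 1) * (Q * b) * (1 / σ) := by
    have e : m * (m * (P ^ 2 * A) + (m + 1) * (P * a) * (1 / τ) -
        (m * (Q ^ 2 * B) + (m + 1) * (Q * b) * (1 / σ))) ≤ 0 := by
      refine le_of_eq_of_le ?_ h2
      field_simp
    rw [hc] at e
    have := nonpos_of_mul_nonpos_right e hm
    linarith
  have e5 : 0 ≤ (m * d - (m + 1)) * (Q * b) * (1 / σ - 1 / τ) :=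
    mul_nonneg (mul_nonneg (by linarith) hc0) (by linarith)
  have e6 := mul_le_mul_of_nonneg_left e3 hm.le
  have e7 := mul_le_mul_of_nonneg_left e4 hm.le
  refine le_of_mul_le_mul_left ?_ hm
  linarith

end RadialComparison

section RadialOscillation

variable {E : Type*} [NormedAddCommGroup E] [InnerProductSpace ℝ E] [FiniteDimensional ℝ E]

theorem sub_le_of_norm_lt {u : E → ℝ} (hD : 3 ≤ Module.finrank ℝ E) (hu : ContDiff ℝ 2 u)
    {f : ℝ → ℝ} {M R₀ α C₀ : ℝ} (hα : 2 < α) (hR₀ : 0 < R₀) (hM : 0 < M) (hC₀ : 0 ≤ C₀)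
    (hmono : MonotoneOn f (Ici M)) (hfpos : ∀ t, M ≤ t → 0 < f t)
    (heq : ∀ x, R₀ ≤ ‖x‖ → Δ u x = ‖x‖ ^ (-α) * f (u x)) (huM : ∀ x, R₀ ≤ ‖x‖ → M ≤ u x)
    (hlim : Tendsto u (cocompact E) atTop) (hC : ∀ x, ‖x‖ = R₀ → u x ≤ C₀)
    {x y : E} (hx : R₀ ≤ ‖x‖) (hxy : ‖x‖ < ‖y‖) : u x - u y ≤ C₀ := by
  by_contra! hlt
  obtain ⟨m, hm1, hmα⟩ : ∃ m : ℝ, 1 ≤ m ∧ 2 < m * (α - 2) := by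
    have h2 : 0 < α - 2 := by linarith
    refine ⟨1 + 2 / (α - 2), ?_, ?_⟩
    · have : 0 < 2 / (α - 2) := by positivity
      linarith
    · rw [add_mul, div_mul_cancel₀ _ h2.ne']
      linarith
  have hm : 0 < m := by linarith
  have hT1 : ∀ r : ℝ, 0 < r → (r ^ (-m⁻¹)) ^ (-m) = r := by
    intro r hr
    rw [← Real.rpow_mul hr.le, neg_mul_neg, inv_mul_cancel₀ hm.ne', Real.rpow_one]
  have hT2 : ∀ s : ℝ, 0 < s → (s ^ (-m)) ^ (-m⁻¹) = s := by
    intro s hs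
    rw [← Real.rpow_mul hs.le, neg_mul_neg, mul_inv_cancel₀ hm.ne', Real.rpow_one]
  set T : E → ℝ := fun z => (max R₀ ‖z‖) ^ (-m⁻¹) with hT
  have hTpos : ∀ z, 0 < T z := fun z => Real.rpow_pos_of_pos (lt_max_of_lt_left hR₀) _
  have hTz : ∀ z, R₀ ≤ ‖z‖ → T z = ‖z‖ ^ (-m⁻¹) := fun z hz => by simp only [hT, max_eq_right hz]
  have hTcont : Continuous T :=
    (continuous_const.max continuous_norm).rpow_const
      fun z => Or.inl (lt_max_of_lt_left hR₀).ne'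
  have hTm : ∀ z, R₀ ≤ ‖z‖ → T z ^ (-m) = ‖z‖ := fun z hz => by
    rw [hTz z hz, hT1 _ (hR₀.trans_le hz)]
  have hTinj : ∀ z z', R₀ ≤ ‖z‖ → T z' < T z → R₀ ≤ ‖z'‖ → ‖z‖ < ‖z'‖ := by
    intro z z' hz hlt hz'
    rw [← hTm z hz, ← hTm z' hz']
    exact Real.rpow_lt_rpow_of_neg (hTpos _) hlt (by linarith)
  set ε := T x - T y with hε
  have hεpos : 0 < ε := by
    rw [hε, hTz x hx, hTz y (hx.trans hxy.le)]
    have := Real.rpow_lt_rpow_of_neg (hR₀.trans_le hx) hxy (neg_neg_of_pos (inv_pos.2 hm))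
    linarith
  set S : Set (E × E) := {q | R₀ ≤ ‖q.1‖ ∧ R₀ ≤ ‖q.2‖ ∧ T q.2 + ε ≤ T q.1} with hS
  have hSclosed : IsClosed S :=
    (isClosed_le continuous_const continuous_fst.norm).inter
      ((isClosed_le continuous_const continuous_snd.norm).inter
        (isClosed_le ((hTcont.comp continuous_snd).add continuous_const)
          (hTcont.comp continuous_fst)))
  have hxyS : (x, y) ∈ S := ⟨hx, hx.trans hxy.le, by simp only [hε]; linarith⟩
  have hB1 : ∀ q ∈ S, ‖q.1‖ ≤ ε ^ (-m) := by
    intro q hq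
    rw [← hTm q.1 hq.1]
    exact Real.rpow_le_rpow_of_nonpos hεpos (by linarith [hq.2.2, hTpos q.2]) (by linarith)
  obtain ⟨CB, hCB⟩ := (isCompact_closedBall (0 : E) (ε ^ (-m))).bddAbove_image
    hu.continuous.continuousOn
  obtain ⟨B2, hB2⟩ : ∃ B2 : ℝ, ∀ z : E, B2 < ‖z‖ → CB - C₀ ≤ u z := by
    have := hlim.eventually_ge_atTop (CB - C₀)
    rw [← Metric.cobounded_eq_cocompact, ← comap_norm_atTop, eventually_comap] at this
    obtain ⟨B, hB⟩ := eventually_atTop.1 this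
    exact ⟨B, fun z hz => hB ‖z‖ hz.le z rfl⟩
  have hfar : ∀ q ∈ S, C₀ < u q.1 - u q.2 → ‖q.2‖ ≤ B2 := by
    intro q hq hqlt
    by_contra! hcon
    have h1 := hB2 _ hcon
    have h2 : u q.1 ≤ CB := hCB ⟨q.1, by simpa using hB1 q hq, rfl⟩
    linarith
  have hcpt : IsCompact (S ∩ Metric.closedBall 0 (ε ^ (-m)) ×ˢ Metric.closedBall 0 B2) :=
    ((isCompact_closedBall _ _).prod (isCompact_closedBall _ _)).inter_left hSclosed
  have hcontq : Continuous fun q : E × E => u q.1 - u q.2 :=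
    (hu.continuous.comp continuous_fst).sub (hu.continuous.comp continuous_snd)
  have hmem : ∀ q ∈ S, C₀ < u q.1 - u q.2 →
      q ∈ S ∩ Metric.closedBall 0 (ε ^ (-m)) ×ˢ Metric.closedBall 0 B2 := fun q hq hqlt =>
    ⟨hq, by simpa using hB1 q hq, by simpa using hfar q hq hqlt⟩
  obtain ⟨⟨x₀, y₀⟩, hq₀, hmax⟩ := hcpt.exists_isMaxOn ⟨_, hmem _ hxyS hlt⟩ hcontq.continuousOn
  have hlt₀ : C₀ < u x₀ - u y₀ := hlt.trans_le (hmax (hmem _ hxyS hlt))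
  have hglob : ∀ a b, (a, b) ∈ S → u a - u b ≤ u x₀ - u y₀ := by
    intro a b hab
    by_cases hab' : C₀ < u a - u b
    · exact hmax (hmem _ hab hab')
    · linarith
  obtain ⟨hx₀, hy₀, hTxy⟩ := hq₀.1
  simp only at hx₀ hy₀ hTxy
  have hx₀R : R₀ < ‖x₀‖ := by
    refine lt_of_le_of_ne hx₀ fun h => ?_
    have := hC x₀ h.symm
    have := huM y₀ hy₀
    linarith
  have hx₀pos : 0 < ‖x₀‖ := hR₀.trans hx₀R
  have hxy₀ : ‖x₀‖ < ‖y₀‖ := hTinj _ _ hx₀ (by linarith) hy₀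
  have hy₀pos : 0 < ‖y₀‖ := hx₀pos.trans hxy₀
  have hevR : ∀ᶠ z in nhds x₀, R₀ < ‖z‖ := continuous_norm.continuousAt.eventually_const_lt hx₀R
  have hTact : T y₀ + ε = T x₀ := by
    refine le_antisymm hTxy (not_lt.1 fun hcon => ?_)
    have hloc : IsLocalMax u x₀ := by
      filter_upwards [hTcont.continuousAt.eventually_const_lt hcon, hevR] with z hz hzR
      have := hglob z y₀ ⟨hzR.le, hy₀, hz.le⟩
      linarith
    have h1 := laplacian_nonpos_of_isLocalMax hu hloc
    rw [heq x₀ hx₀] at h1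
    have := mul_pos (Real.rpow_pos_of_pos hx₀pos (-α)) (hfpos _ (huM x₀ hx₀))
    linarith
  set τ := T x₀ with hτ
  have hσ : τ - ε = T y₀ := by linarith
  have hετ : ε < τ := by linarith [hTpos y₀]
  have hτpos := hTpos x₀
  have hτm : τ ^ (-m) = ‖x₀‖ := hTm _ hx₀
  have hσm : (τ - ε) ^ (-m) = ‖y₀‖ := by rw [hσ]; exact hTm _ hy₀
  set ω := ‖x₀‖⁻¹ • x₀ with hωdef
  set ω' := ‖y₀‖⁻¹ • y₀ with hω'def
  have hω : ‖ω‖ = 1 := by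
    rw [hωdef, norm_smul, norm_inv, norm_norm, inv_mul_cancel₀ hx₀pos.ne']
  have hω' : ‖ω'‖ = 1 := by
    rw [hω'def, norm_smul, norm_inv, norm_norm, inv_mul_cancel₀ hy₀pos.ne']
  have hxω : ‖x₀‖ • ω = x₀ := by rw [hωdef, smul_smul, mul_inv_cancel₀ hx₀pos.ne', one_smul]
  have hyω : ‖y₀‖ • ω' = y₀ := by rw [hω'def, smul_smul, mul_inv_cancel₀ hy₀pos.ne', one_smul]
  have hnω : ∀ {s : ℝ} {v : E}, 0 < s → ‖v‖ = 1 → ‖s ^ (-m) • v‖ = s ^ (-m) := by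
    intro s v hs hv
    rw [norm_smul, hv, mul_one, Real.norm_of_nonneg (by positivity)]
  have key := laplacian_le_laplacian_of_radial_max hu hω hω' hm (ε := ε) (τ := τ) ?_ hεpos hετ
    ?_ ?_ ?_ ?_
  · rw [hσm, hτm, hxω, hyω, heq _ hx₀, heq _ hy₀, ← hτm, ← hσm] at key
    have hpow : ∀ t : ℝ, 0 < t → ∀ F : ℝ, (t ^ (-m - 1)) ^ 2 * ((t ^ (-m)) ^ (-α) * F) =
        t ^ (m * (α - 2) - 2) * F := by
      intro t ht F
      rw [← Real.rpow_natCast, ← Real.rpow_mul ht.le, ← Real.rpow_mul ht.le, ← mul_assoc,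
        ← Real.rpow_add ht]
      congr 2
      push_cast
      ring
    have hσpos : 0 < τ - ε := by linarith
    rw [hpow τ hτpos, hpow _ hσpos] at key
    have h1 : f (u y₀) ≤ f (u x₀) := hmono (huM _ hy₀) (huM _ hx₀) (by linarith)
    have h2 := hfpos _ (huM _ hy₀)
    have h3 : (τ - ε) ^ (m * (α - 2) - 2) < τ ^ (m * (α - 2) - 2) :=
      Real.rpow_lt_rpow hσpos.le (by linarith) (by linarith)
    have h4 := mul_lt_mul_of_pos_right h3 h2
    have h5 := mul_le_mul_of_nonneg_left h1 (Real.rpow_pos_of_pos hτpos (m * (α - 2) - 2)).le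
    linarith
  · have : (3 : ℝ) ≤ Module.finrank ℝ E := by exact_mod_cast hD
    nlinarith
  · have hs : ∀ᶠ s in nhds τ, R₀ < s ^ (-m) := by
      refine (Real.continuousAt_rpow_const τ (-m) (Or.inl hτpos.ne')).eventually_const_lt ?_
      simpa only [hτm] using hx₀R
    filter_upwards [hs, lt_mem_nhds hετ] with s hsR hs
    have hs0 : 0 < s := hεpos.trans hs
    have hsε : 0 < s - ε := sub_pos.2 hs
    rw [hτm, hσm, hxω, hyω]
    have hle : s ^ (-m) ≤ (s - ε) ^ (-m) :=
      Real.rpow_le_rpow_of_nonpos hsε (by linarith) (by linarith)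
    have h1 := hnω hs0 hω
    have h2 := hnω hsε hω'
    have h3 : R₀ ≤ ‖s ^ (-m) • ω‖ := by rw [h1]; exact hsR.le
    have h4 : R₀ ≤ ‖(s - ε) ^ (-m) • ω'‖ := by rw [h2]; exact hsR.le.trans hle
    refine hglob _ _ ⟨h3, h4, ?_⟩
    simp only
    rw [hTz _ h3, hTz _ h4, h1, h2, hT2 _ hs0, hT2 _ hsε]
    linarith
  · intro z hz
    rw [hτm] at hz ⊢
    rw [hxω]
    have : T z = T x₀ := by simp only [hT, hz]
    have := hglob z y₀ ⟨by rw [hz]; exact hx₀, hy₀, by simp only; rw [this, ← hτ]; exact hTxy⟩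
    linarith
  · intro z hz
    rw [hσm] at hz ⊢
    rw [hyω]
    have : T z = T y₀ := by simp only [hT, hz]
    have := hglob x₀ z ⟨hx₀, by rw [hz]; exact hy₀, by simp only; rw [this]; exact hTxy⟩
    linarith
  · rw [hσm, hyω]
    have hder := hasDerivAt_comp_curve hu (hasDerivAt_line y₀ ω' 0)
    rw [zero_smul, add_zero, hasDerivAt_iff_tendsto_slope] at hder
    refine ge_of_tendsto (hder.mono_left (nhdsWithin_mono 0 fun s (hs : s ∈ Ioi 0) =>
      (ne_of_gt hs : s ≠ 0))) ?_
    filter_upwards [self_mem_nhdsWithin] with s hs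
    have hs0 : (0 : ℝ) < s := hs
    have hn : ‖y₀ + s • ω'‖ = ‖y₀‖ + s := by
      have : y₀ + s • ω' = (‖y₀‖ + s) • ω' := by rw [add_smul, hyω]
      rw [this, norm_smul, hω', mul_one, Real.norm_of_nonneg (by positivity)]
    have hR : R₀ ≤ ‖y₀ + s • ω'‖ := by rw [hn]; linarith
    have hTle : T (y₀ + s • ω') ≤ T y₀ := by
      rw [hTz _ hR, hTz _ hy₀, hn]
      exact Real.rpow_le_rpow_of_nonpos hy₀pos (by linarith)
        (neg_nonpos.2 (inv_pos.2 hm).le)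
    have := hglob x₀ (y₀ + s • ω') ⟨hx₀, hR, by simp only; linarith⟩
    rw [slope_def_field, zero_smul, add_zero, sub_zero]
    exact div_nonneg (by linarith) hs0.le

theorem sub_le_of_norm_eq {u : E → ℝ} (hD : 3 ≤ Module.finrank ℝ E) (hu : ContDiff ℝ 2 u)
    {f : ℝ → ℝ} {M R₀ α C₀ : ℝ} (hα : 2 < α) (hR₀ : 0 < R₀) (hM : 0 < M) (hC₀ : 0 ≤ C₀)
    (hmono : MonotoneOn f (Ici M)) (hfpos : ∀ t, M ≤ t → 0 < f t)
    (heq : ∀ x, R₀ ≤ ‖x‖ → Δ u x = ‖x‖ ^ (-α) * f (u x)) (huM : ∀ x, R₀ ≤ ‖x‖ → M ≤ u x)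
    (hlim : Tendsto u (cocompact E) atTop) (hC : ∀ x, ‖x‖ = R₀ → u x ≤ C₀)
    {x y : E} (hx : R₀ ≤ ‖x‖) (hxy : ‖x‖ = ‖y‖) : u x - u y ≤ C₀ := by
  have hcont : Continuous fun s : ℝ => u x - u ((1 + s) • y) :=
    continuous_const.sub (hu.continuous.comp (by fun_prop))
  have ht : Tendsto (fun s : ℝ => u x - u ((1 + s) • y)) (nhdsWithin 0 (Ioi 0))
      (nhds (u x - u y)) := by
    have := hcont.continuousAt (x := 0)
    simp only [ContinuousAt, add_zero, one_smul] at this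
    exact this.mono_left nhdsWithin_le_nhds
  refine le_of_tendsto ht ?_
  filter_upwards [self_mem_nhdsWithin] with s hs
  have hs0 : (0 : ℝ) < s := hs
  refine sub_le_of_norm_lt hD hu hα hR₀ hM hC₀ hmono hfpos heq huM hlim hC hx ?_
  rw [norm_smul, Real.norm_of_nonneg (by positivity), ← hxy]
  nlinarith

end RadialOscillation

section Decay

variable {E : Type*} [NormedAddCommGroup E] [InnerProductSpace ℝ E] [FiniteDimensional ℝ E]

/-- If the oscillation of `u` over spheres is bounded and `u` has the comparison property on
spheres, then the oscillation over spheres decays. -/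
theorem sub_le_decay_of_sub_le {u : E → ℝ} (hD : 3 ≤ Module.finrank ℝ E) (hu : ContDiff ℝ 2 u)
    {R₀ C₀ : ℝ} (hR₀ : 0 < R₀) (hC₀ : 0 < C₀)
    (hosc : ∀ x y, R₀ ≤ ‖x‖ → ‖x‖ = ‖y‖ → u x - u y ≤ C₀)
    (hmono : ∀ x y, R₀ ≤ ‖x‖ → ‖x‖ = ‖y‖ → u y ≤ u x → Δ u y ≤ Δ u x)
    {x y : E} (hx : R₀ ≤ ‖x‖) (hxy : ‖x‖ = ‖y‖) :
    u x - u y ≤ C₀ / (1 + R₀ ^ 2) ^ (-(1 / 4) : ℝ) * (1 + ‖x‖ ^ 2) ^ (-(1 / 4) : ℝ) := by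
  rcases eq_or_ne x y with rfl | hne
  · rw [sub_self]; positivity
  obtain ⟨e, he, hex, rfl⟩ := exists_planeRefl_eq hxy hne
  have hrn : ∀ z, ‖planeRefl e 0 z‖ = ‖z‖ := fun z => by
    rw [← sq_eq_sq₀ (norm_nonneg _) (norm_nonneg _), norm_sq_planeRefl he]
    ring
  set P : ℝ := (1 + R₀ ^ 2) ^ (-(1 / 4) : ℝ) with hP
  have hPpos : 0 < P := by positivity
  have hk : 0 < C₀ / P := by positivity
  set d : ℝ := (Module.finrank ℝ E : ℝ) with hd
  have hdpos : 0 ≤ d := Nat.cast_nonneg _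
  have hur : ContDiff ℝ 2 fun z => u (planeRefl e 0 z) := hu.comp (contDiff_planeRefl e 0)
  have hw2 : ContDiff ℝ 2 fun z => 1 * u z + -1 * u (planeRefl e 0 z) :=
    (contDiff_const.mul hu).add (contDiff_const.mul hur)
  have key : ∀ S, ‖x‖ ≤ S → u x - u (planeRefl e 0 x) ≤
      C₀ / P * (1 + ‖x‖ ^ 2) ^ (-(1 / 4) : ℝ) + C₀ * (1 / S ^ 2 * ‖x - 0‖ ^ 2 +
        -d / S ^ 2 * ⟪e, x - 0⟫ ^ 2 + d / S * ⟪e, x - 0⟫) := by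
    intro S hxS
    by_contra! hlt
    have hS : 0 < S := hR₀.trans_le (hx.trans hxS)
    have hφ := contDiff_decay (E := E) (1 / 4)
    have hΔφ := laplacian_decay_le hD (p := 1 / 4) (by norm_num)
    have hq := contDiff_quadratic (1 / S ^ 2) (-d / S ^ 2) (d / S) e (0 : E)
    have hΔq := laplacian_quadratic (1 / S ^ 2) (-d / S ^ 2) (d / S) he (0 : E)
    set φ : E → ℝ := fun z => (1 + ‖z‖ ^ 2) ^ (-(1 / 4) : ℝ) with hφdef
    set q : E → ℝ := fun z => 1 / S ^ 2 * ‖z - 0‖ ^ 2 + -d / S ^ 2 * ⟪e, z - 0⟫ ^ 2 +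
      d / S * ⟪e, z - 0⟫ with hqdef
    have hB2 : ContDiff ℝ 2 fun z => C₀ / P * φ z + C₀ * q z :=
      (contDiff_const.mul hφ).add (contDiff_const.mul hq)
    have hinner : Continuous fun z : E => ⟪e, z⟫ := by fun_prop
    have hqform : ∀ z, q z = (‖z‖ ^ 2 + d * (⟪e, z⟫ * (S - ⟪e, z⟫))) / S ^ 2 := by
      intro z
      simp only [hqdef, sub_zero]
      field_simp
      ring
    have hcpt : IsCompact ({z : E | 0 ≤ ⟪e, z⟫ ∧ R₀ ≤ ‖z‖} ∩ Metric.closedBall 0 S) :=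
      (isCompact_closedBall _ _).inter_left ((isClosed_le continuous_const hinner).inter
        (isClosed_le continuous_const continuous_norm))
    have hxmem : x ∈ {z : E | 0 ≤ ⟪e, z⟫ ∧ R₀ ≤ ‖z‖} ∩ Metric.closedBall 0 S :=
      ⟨⟨hex.le, hx⟩, by simpa using hxS⟩
    obtain ⟨z, hz, hmax⟩ := hcpt.exists_isMaxOn ⟨x, hxmem⟩ (hw2.sub hB2).continuous.continuousOn
    have hzS : ‖z‖ ≤ S := by simpa using hz.2
    have hpos : C₀ / P * φ z + C₀ * q z < u z - u (planeRefl e 0 z) := by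
      have h1 : (1 * u x + -1 * u (planeRefl e 0 x)) - (C₀ / P * φ x + C₀ * q x) ≤
        (1 * u z + -1 * u (planeRefl e 0 z)) - (C₀ / P * φ z + C₀ * q z) := hmax hxmem
      have h2 : C₀ / P * φ x + C₀ * q x < u x - u (planeRefl e 0 x) := hlt
      linarith
    have hez : ⟪e, z⟫ ≤ S := by
      have := real_inner_le_norm e z
      rw [he] at this
      linarith
    have htq : 0 ≤ d * (⟪e, z⟫ * (S - ⟪e, z⟫)) :=
      mul_nonneg hdpos (mul_nonneg hz.1.1 (by linarith))
    have hqz : 0 ≤ q z := by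
      rw [hqform]
      exact div_nonneg (add_nonneg (sq_nonneg _) htq) (sq_nonneg _)
    have hφz : 0 < φ z := by simp only [hφdef]; positivity
    have hkφ : 0 < C₀ / P * φ z := mul_pos hk hφz
    have hCq : 0 ≤ C₀ * q z := mul_nonneg hC₀.le hqz
    have hwC := hosc z (planeRefl e 0 z) hz.1.2 (hrn z).symm
    have h1 : 0 < ⟪e, z⟫ := by
      refine lt_of_le_of_ne hz.1.1 fun h => ?_
      rw [planeRefl_of_mem h.symm] at hpos
      linarith
    have h2 : R₀ < ‖z‖ := by
      refine lt_of_le_of_ne hz.1.2 fun h => ?_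
      have : C₀ / P * φ z = C₀ := by
        simp only [hφdef, ← h]
        exact div_mul_cancel₀ _ hPpos.ne'
      linarith
    have h3 : ‖z‖ < S := by
      refine lt_of_le_of_ne hzS fun h => ?_
      have : 1 ≤ q z := by
        rw [hqform, le_div_iff₀ (by positivity), h]
        linarith
      have := mul_le_mul_of_nonneg_left this hC₀.le
      linarith
    have hloc : IsLocalMax (fun z => (1 * u z + -1 * u (planeRefl e 0 z)) -
        (C₀ / P * φ z + C₀ * q z)) z := by
      filter_upwards [hinner.continuousAt.eventually_const_lt h1,
        continuous_norm.continuousAt.eventually_const_lt h2,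
        continuous_norm.continuousAt.eventually_lt_const h3] with y' a1 a2 a3
      exact hmax ⟨⟨a1.le, a2.le⟩, by simpa using a3.le⟩
    have hle := laplacian_le_of_isLocalMax_sub hw2 hB2 hloc
    rw [laplacian_linear_combination hu hur, laplacian_linear_combination hφ hq,
      laplacian_comp_planeRefl hu he, hΔq] at hle
    have h4 := hmono z _ h2.le (hrn z).symm (by linarith)
    have h5 : Δ φ z < 0 := (hΔφ z).trans_lt (by
      have : 0 < (1 + ‖z‖ ^ 2 : ℝ) ^ (-(1 / 4) - 1 : ℝ) := by positivity
      linarith)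
    have h6 := mul_neg_of_pos_of_neg hk h5
    have h7 : 2 * (1 / S ^ 2) * (Module.finrank ℝ E : ℝ) + 2 * (-d / S ^ 2) = 0 := by
      rw [← hd]; ring
    rw [h7] at hle
    linarith
  have hlim : Tendsto (fun S : ℝ => C₀ / P * (1 + ‖x‖ ^ 2) ^ (-(1 / 4) : ℝ) +
      C₀ * (1 / S ^ 2 * ‖x - 0‖ ^ 2 + -d / S ^ 2 * ⟪e, x - 0⟫ ^ 2 + d / S * ⟪e, x - 0⟫)) atTop
      (nhds (C₀ / P * (1 + ‖x‖ ^ 2) ^ (-(1 / 4) : ℝ) +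
        C₀ * (0 * ‖x - 0‖ ^ 2 + 0 * ⟪e, x - 0⟫ ^ 2 + 0 * ⟪e, x - 0⟫))) := by
    have hS2 : Tendsto (fun S : ℝ => S ^ 2) atTop atTop := tendsto_pow_atTop (by norm_num)
    exact tendsto_const_nhds.add ((((hS2.const_div_atTop 1).mul_const _).add
      ((hS2.const_div_atTop (-d)).mul_const _)).add
        ((tendsto_id.const_div_atTop d).mul_const _) |>.const_mul C₀)
  have := ge_of_tendsto hlim ((eventually_ge_atTop ‖x‖).mono key)
  simpa using this

end Decay

section Assembly

theorem exists_sub_le_mul_abs_sub {f : ℝ → ℝ} (hf : ContDiffOn ℝ 1 f (Ici 0)) (m : ℝ) :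
    ∃ C, 0 ≤ C ∧ ∀ s ∈ Icc 0 m, ∀ t ∈ Icc 0 m, f s - f t ≤ C * |s - t| := by
  obtain ⟨K, hK⟩ := (hf.mono (t := Icc 0 m) fun _ ht => ht.1).exists_lipschitzOnWith one_ne_zero
    (convex_Icc 0 m) isCompact_Icc
  refine ⟨K, K.coe_nonneg, fun s hs t ht => ?_⟩
  have := hK.dist_le_mul s hs t ht
  rw [Real.dist_eq, Real.dist_eq] at this
  exact (le_abs_self _).trans this

variable {E : Type*} [NormedAddCommGroup E] [InnerProductSpace ℝ E] [FiniteDimensional ℝ E]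

theorem exists_forall_le_norm_of_eventually_cocompact {p : E → Prop}
    (h : ∀ᶠ x in cocompact E, p x) : ∃ R : ℝ, ∀ x, R ≤ ‖x‖ → p x := by
  rw [← Metric.cobounded_eq_cocompact, ← comap_norm_atTop, eventually_comap] at h
  obtain ⟨R, hR⟩ := eventually_atTop.1 h
  exact ⟨R, fun x hx => hR ‖x‖ hx x rfl⟩

theorem exists_forall_norm_le_le {u : E → ℝ} (hu : Continuous u) (r : ℝ) :
    ∃ m, ∀ x, ‖x‖ ≤ r → u x ≤ m := by
  obtain ⟨m, hm⟩ := (isCompact_closedBall (0 : E) r).bddAbove_image hu.continuousOn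
  exact ⟨m, fun x hx => hm ⟨x, by simpa using hx, rfl⟩⟩

/-- A strictly subharmonic function is at most its limit at infinity. -/
theorem le_of_tendsto_cocompact {u : E → ℝ} (hu : ContDiff ℝ 2 u) (hΔ : ∀ x, 0 < Δ u x) {b : ℝ}
    (hlim : Tendsto u (cocompact E) (nhds b)) (x : E) : u x ≤ b := by
  by_contra! hlt
  obtain ⟨y, hy⟩ := hu.continuous.exists_forall_ge' x
    ((hlim.eventually_lt_const hlt).mono fun _ h => h.le)
  exact (laplacian_nonpos_of_isLocalMax hu (Eventually.of_forall hy)).not_gt (hΔ y)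

/-- A strictly subharmonic function on a ball attains its maximum on the boundary sphere. -/
theorem exists_norm_eq_forall_le {u : E → ℝ} (hu : ContDiff ℝ 2 u) (hΔ : ∀ x, 0 < Δ u x) {r : ℝ}
    (hr : 0 ≤ r) : ∃ y, ‖y‖ = r ∧ ∀ z, ‖z‖ ≤ r → u z ≤ u y := by
  obtain ⟨y, hy, hmax⟩ := (isCompact_closedBall (0 : E) r).exists_isMaxOn
    ⟨0, by simpa using hr⟩ hu.continuous.continuousOn
  have hyr : ‖y‖ ≤ r := by simpa using hy
  refine ⟨y, hyr.antisymm (not_lt.1 fun hlt => ?_), fun z hz => hmax (by simpa using hz)⟩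
  refine (laplacian_nonpos_of_isLocalMax hu ?_).not_gt (hΔ y)
  filter_upwards [continuous_norm.continuousAt.eventually_lt_const hlt] with z hz
  exact hmax (by simpa using hz.le)

/-- For a solution tending to infinity, `u` is asymptotically nondecreasing in `‖x‖`. -/
theorem exists_sub_le_of_tendsto_atTop {u : E → ℝ} (hD : 3 ≤ Module.finrank ℝ E)
    (hu : ContDiff ℝ 2 u) {f : ℝ → ℝ} {M R₀ α : ℝ} (hα : 2 < α) (hR₀ : 0 < R₀) (hM : 0 < M)
    (hmono : MonotoneOn f (Ici M)) (hfpos : ∀ t, M ≤ t → 0 < f t) (hΔ : ∀ x, 0 < Δ u x)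
    (heq : ∀ x, R₀ ≤ ‖x‖ → Δ u x = ‖x‖ ^ (-α) * f (u x)) (huM : ∀ x, R₀ ≤ ‖x‖ → M ≤ u x)
    (hlim : Tendsto u (cocompact E) atTop) {η : ℝ} (hη : 0 < η) :
    ∃ R, ∀ x z, ‖z‖ ≤ ‖x‖ → R ≤ ‖x‖ → u z - η ≤ u x := by
  obtain ⟨m, hm⟩ := exists_forall_norm_le_le hu.continuous R₀
  have hC₀ : 0 < max m 1 := lt_max_of_lt_right one_pos
  have hosc : ∀ x y, R₀ ≤ ‖x‖ → ‖x‖ = ‖y‖ → u x - u y ≤ max m 1 := fun x y hx hxy =>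
    sub_le_of_norm_eq hD hu hα hR₀ hM hC₀.le hmono hfpos heq huM hlim
      (fun z hz => (hm z hz.le).trans (le_max_left _ _)) hx hxy
  have hcomp : ∀ x y, R₀ ≤ ‖x‖ → ‖x‖ = ‖y‖ → u y ≤ u x → Δ u y ≤ Δ u x := by
    intro x y hx hxy hle
    rw [heq x hx, heq y (hxy ▸ hx), ← hxy]
    exact mul_le_mul_of_nonneg_left (hmono (huM y (hxy ▸ hx)) (huM x hx) hle) (by positivity)
  set k := max m 1 / (1 + R₀ ^ 2) ^ (-(1 / 4) : ℝ)
  have hdecay : Tendsto (fun r : ℝ => k * (1 + r ^ 2) ^ (-(1 / 4) : ℝ)) atTop (nhds (k * 0)) :=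
    ((tendsto_rpow_neg_atTop (by norm_num)).comp
      (tendsto_atTop_add_const_left _ _ (tendsto_pow_atTop two_ne_zero))).const_mul k
  rw [mul_zero] at hdecay
  obtain ⟨R, hR⟩ := eventually_atTop.1 (hdecay.eventually_lt_const hη)
  refine ⟨max R R₀, fun x z hzx hx => ?_⟩
  obtain ⟨y, hy, hmax⟩ := exists_norm_eq_forall_le hu hΔ (norm_nonneg x)
  have h1 := sub_le_decay_of_sub_le hD hu hR₀ hC₀ hosc hcomp
    (((le_max_right _ _).trans hx).trans hy.ge) hy
  have h2 := hR ‖x‖ ((le_max_left _ _).trans hx)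
  have h3 := hmax z hzx
  rw [hy] at h1
  linarith

end Assembly

/-- Under (SA), with `f` nondecreasing on `[M, β)`, `ρ` radially
symmetric, radially nonincreasing and equal to `|x|^{-α}` for `|x| ≥ 1` (`α > 2`),
every solution of `Δu = ρ f(u)`, `u > 0` with limit `β ∈ (0, +∞]` at infinity is
radially symmetric. -/
theorem stmt6 (D : ℕ) (hD : 3 ≤ D)
    (f : ℝ → ℝ) (ρ : EuclideanSpace ℝ (Fin D) → ℝ)
    (hf : ContDiffOn ℝ 1 f (Ici 0)) (hf0 : f 0 = 0)
    (hfpos : ∀ t : ℝ, 0 < t → 0 < f t)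
    (hKO : ∃ b : ℝ, 0 < b ∧
      IntegrableOn (fun s => 1 / Real.sqrt (∫ t in (0:ℝ)..s, f t)) (Ici b))
    (hρ : ContDiff ℝ 1 ρ) (hρpos : ∀ x, 0 < ρ x)
    (hHρ : Tendsto (fun x : EuclideanSpace ℝ (Fin D) =>
      ∫ y : EuclideanSpace ℝ (Fin D), ‖x - y‖ ^ (2 - (D:ℝ)) * ρ y) (cocompact _) (nhds 0))
    (β : EReal) (hβ : 0 < β)
    (M : ℝ) (hM : 0 < M)
    (hfmono : MonotoneOn f {t : ℝ | M ≤ t ∧ (t : EReal) < β})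
    (ρ₀ : ℝ → ℝ) (hρ₀ : ∀ x, ρ x = ρ₀ ‖x‖) (hρ₀anti : AntitoneOn ρ₀ (Ici 0))
    (α : ℝ) (hα : 2 < α)
    (hρpow : ∀ x : EuclideanSpace ℝ (Fin D), 1 ≤ ‖x‖ → ρ x = ‖x‖ ^ (-α))
    (u : EuclideanSpace ℝ (Fin D) → ℝ)
    (hu : ContDiff ℝ 2 u) (hupos : ∀ x, 0 < u x)
    (hueq : ∀ x, laplacian u x = ρ x * f (u x))
    (hulim : Tendsto (fun x => ((u x : ℝ) : EReal)) (cocompact _) (nhds β)) :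
    ∀ x y : EuclideanSpace ℝ (Fin D), ‖x‖ = ‖y‖ → u x = u y := by
  have hΔ : ∀ x, Δ u x = ρ x * f (u x) := fun x => by
    rw [← laplacian_eq_mathlib hu, hueq]
  have hΔpos : ∀ x, 0 < Δ u x := fun x => by
    rw [hΔ]
    exact mul_pos (hρpos x) (hfpos _ (hupos x))
  have hfin : 3 ≤ Module.finrank ℝ (EuclideanSpace ℝ (Fin D)) := by
    rwa [finrank_euclideanSpace_fin]
  have hanti : ∀ x z, ‖z‖ ≤ ‖x‖ → ρ x ≤ ρ z := fun x z h => by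
    rw [hρ₀ x, hρ₀ z]
    exact hρ₀anti (norm_nonneg z) (norm_nonneg x) h
  have hstrict : ∀ x z, ‖z‖ < ‖x‖ → 1 < ‖x‖ → ρ x < ρ z := by
    intro x z hzx hx
    rcases le_or_gt 1 ‖z‖ with hz | hz
    · rw [hρpow x hx.le, hρpow z hz]
      exact Real.rpow_lt_rpow_of_neg (one_pos.trans_le hz) hzx (by linarith)
    · have hv : ‖‖x‖⁻¹ • x‖ = 1 := by
        rw [norm_smul, norm_inv, norm_norm, inv_mul_cancel₀ (one_pos.trans hx).ne']
      have h1 := hanti (‖x‖⁻¹ • x) z (by rw [hv]; exact hz.le)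
      rw [hρpow _ hv.ge, hv, Real.one_rpow] at h1
      rw [hρpow x hx.le]
      exact (Real.rpow_lt_one_of_one_lt_of_neg hx (by linarith)).trans_le h1
  have hlip : ∀ r : ℝ, ∃ C : ℝ, 0 ≤ C ∧ ∀ x z, ‖x‖ ≤ r → ‖z‖ ≤ r →
      f (u x) - f (u z) ≤ C * |u x - u z| := by
    intro r
    obtain ⟨m, hm⟩ := exists_forall_norm_le_le hu.continuous r
    obtain ⟨C, hC, h⟩ := exists_sub_le_mul_abs_sub hf m
    exact ⟨C, hC, fun x z hx hz => h _ ⟨(hupos x).le, hm x hx⟩ _ ⟨(hupos z).le, hm z hz⟩⟩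
  suffices h : ∃ L, 0 ≤ L ∧
      (∀ x z, ‖z‖ ≤ ‖x‖ → u x ≤ u z → f (u x) - f (u z) ≤ L * (u z - u x)) ∧
      ∀ η : ℝ, 0 < η → ∃ R : ℝ, ∀ x z, ‖z‖ ≤ ‖x‖ → R ≤ ‖x‖ → u z - η ≤ u x by
    obtain ⟨L, hL, hone, hinf⟩ := h
    have hdata : MovingPlaneData u f ρ α L :=
      { finrank := hfin
        contDiff := hu
        eqn := hΔ
        f_pos := fun x => hfpos _ (hupos x)
        rho_pos := hρpos
        rho_anti := hanti
        rho_strictAnti := hstrict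
        rho_decay := fun x hx => (hρpow x hx).le
        alpha := hα
        L_nonneg := hL
        oneSided := hone
        locLip := hlip
        atInfinity := hinf }
    exact fun x y hxy => hdata.eq_of_norm_eq hxy
  induction β with
  | bot => exact absurd hβ not_lt_bot
  | coe b =>
    have hlim : Tendsto u (cocompact _) (nhds b) := EReal.tendsto_coe.1 hulim
    have hub := le_of_tendsto_cocompact hu hΔpos hlim
    obtain ⟨L, hL, h⟩ := exists_sub_le_mul_abs_sub hf b
    refine ⟨L, hL, fun x z _ hxz => ?_, fun η hη => ?_⟩
    · have := h _ ⟨(hupos x).le, hub x⟩ _ ⟨(hupos z).le, hub z⟩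
      rwa [abs_sub_comm, abs_of_nonneg (sub_nonneg.2 hxz)] at this
    · obtain ⟨R, hR⟩ := exists_forall_le_norm_of_eventually_cocompact
        (hlim.eventually_const_lt (sub_lt_self b hη))
      refine ⟨R, fun x z _ hx => ?_⟩
      linarith [hR x hx, hub z]
  | top =>
    have hlim : Tendsto u (cocompact _) atTop := EReal.tendsto_coe_nhds_top_iff.1 hulim
    have hmono : MonotoneOn f (Ici M) := hfmono.mono fun t ht => ⟨ht, EReal.coe_lt_top t⟩
    obtain ⟨R₁, hR₁⟩ := exists_forall_le_norm_of_eventually_cocompact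
      (hlim.eventually_ge_atTop M)
    set R₀ := max R₁ 1
    have huM : ∀ x, R₀ ≤ ‖x‖ → M ≤ u x := fun x hx => hR₁ x ((le_max_left _ _).trans hx)
    have h1R₀ : 1 ≤ R₀ := le_max_right _ _
    obtain ⟨L, hL, h⟩ := hlip R₀
    refine ⟨L, hL, fun x z hzx hxz => ?_, fun η hη => ?_⟩
    · have hnn : 0 ≤ u z - u x := sub_nonneg.2 hxz
      rcases le_total R₀ ‖x‖ with hx | hx
      · have h2 : f (u x) ≤ f (u z) := hmono (huM x hx) ((huM x hx).trans hxz) hxz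
        have := mul_nonneg hL hnn
        linarith
      · have := h x z hx (hzx.trans hx)
        rwa [abs_sub_comm, abs_of_nonneg hnn] at this
    · exact exists_sub_le_of_tendsto_atTop hfin hu hα (one_pos.trans_le h1R₀) hM hmono
        (fun t ht => hfpos t (hM.trans_le ht)) hΔpos
        (fun x hx => by rw [hΔ, hρpow x (h1R₀.trans hx)]) huM hlim hη
end

section
/- Assume (SA) and that ρ is radially symmetric and radially nonincreasing: ρ(x) = ρ₀(|x|) with ρ₀ : [0,∞) → (0,∞) nonincreasing. Then for every C² function u : ℝ^D → ℝ with u > 0 and Δu(x) ≥ ρ₀(|x|) f(u(x)) for all x ∈ ℝ^D, there exists a radially symmetric solution ū of (E) such that u ≤ ū on ℝ^D. -/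
open MeasureTheory Filter Set

/-- The average `∫₀¹ θ^(D-1) h(sθ) dθ`. -/
noncomputable def radialMean (D : ℕ) (h : ℝ → ℝ) (s : ℝ) : ℝ :=
  ∫ θ in (0:ℝ)..1, θ ^ (D - 1) * h (s * θ)

/-- The radial function with value and slope `0` at the origin whose Laplacian in dimension `D`
is the radial function `h`, written as an integral in the variable `σ = s²`. -/
noncomputable def radialPotential (D : ℕ) (h : ℝ → ℝ) (r : ℝ) : ℝ :=
  2⁻¹ * ∫ σ in (0:ℝ)..r ^ 2, radialMean D h (Real.sqrt σ)

lemma continuous_radialMean {D : ℕ} {h : ℝ → ℝ} (hh : Continuous h) :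
    Continuous (radialMean D h) := by
  unfold radialMean
  apply intervalIntegral.continuous_parametric_intervalIntegral_of_continuous'
  fun_prop

lemma continuous_radialMean_sqrt {D : ℕ} {h : ℝ → ℝ} (hh : Continuous h) :
    Continuous fun σ => radialMean D h (Real.sqrt σ) :=
  (continuous_radialMean hh).comp Real.continuous_sqrt

lemma hasDerivAt_integral_radialMean {D : ℕ} {h : ℝ → ℝ} (hh : Continuous h) (τ : ℝ) :
    HasDerivAt (fun τ => 2⁻¹ * ∫ σ in (0:ℝ)..τ, radialMean D h (Real.sqrt σ))
      (2⁻¹ * radialMean D h (Real.sqrt τ)) τ :=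
  ((continuous_radialMean_sqrt hh).integral_hasStrictDerivAt 0 τ).hasDerivAt.const_mul _

lemma hasDerivAt_radialPotential {D : ℕ} {h : ℝ → ℝ} (hh : Continuous h) {r : ℝ} (hr : 0 ≤ r) :
    HasDerivAt (radialPotential D h) (r * radialMean D h r) r := by
  have h1 := (hasDerivAt_integral_radialMean (D := D) hh (r ^ 2)).comp r (hasDerivAt_pow 2 r)
  rw [Real.sqrt_sq hr] at h1
  refine h1.congr_deriv ?_
  simp; ring

lemma continuous_radialPotential {D : ℕ} {h : ℝ → ℝ} (hh : Continuous h) :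
    Continuous (radialPotential D h) := by
  have h1 : Continuous fun τ => 2⁻¹ * ∫ σ in (0:ℝ)..τ, radialMean D h (Real.sqrt σ) :=
    continuous_iff_continuousAt.2 fun τ => (hasDerivAt_integral_radialMean hh τ).continuousAt
  exact h1.comp (continuous_pow 2)

@[simp] lemma radialPotential_zero {D : ℕ} {h : ℝ → ℝ} : radialPotential D h 0 = 0 := by
  simp [radialPotential]

lemma abs_radialMean_le {D : ℕ} {h : ℝ → ℝ} {s B : ℝ} (hs : 0 ≤ s)
    (hB : ∀ t, 0 ≤ t → t ≤ s → |h t| ≤ B) : |radialMean D h s| ≤ B := by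
  have := intervalIntegral.norm_integral_le_of_norm_le_const (a := (0:ℝ)) (b := 1) (C := B)
    (f := fun θ : ℝ => θ ^ (D - 1) * h (s * θ)) (by
      intro θ hθ
      rw [uIoc_of_le zero_le_one] at hθ
      have h1 := hB (s * θ) (mul_nonneg hs hθ.1.le) (mul_le_of_le_one_right hs hθ.2)
      have h2 : θ ^ (D - 1) ≤ 1 := pow_le_one₀ hθ.1.le hθ.2
      have h3 : 0 ≤ θ ^ (D - 1) := pow_nonneg hθ.1.le _
      rw [Real.norm_eq_abs, abs_mul, abs_of_nonneg h3]
      nlinarith [abs_nonneg (h (s * θ))])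
  simpa [radialMean] using this

lemma radialMean_nonneg {D : ℕ} {h : ℝ → ℝ} (hh : ∀ t, 0 ≤ h t) (s : ℝ) :
    0 ≤ radialMean D h s :=
  intervalIntegral.integral_nonneg zero_le_one fun _ hθ =>
    mul_nonneg (pow_nonneg hθ.1 _) (hh _)

/-- Exponentially weighted bound for the radial potential. -/
lemma abs_radialPotential_le_exp {D : ℕ} {h : ℝ → ℝ} {lam B r : ℝ}
    (hl : 0 < lam) (hB0 : 0 ≤ B) (hr : 0 ≤ r)
    (hB : ∀ t, 0 ≤ t → t ≤ r → |h t| ≤ B * Real.exp (lam * t ^ 2)) :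
    |radialPotential D h r| ≤ B / (2 * lam) * Real.exp (lam * r ^ 2) := by
  have key : ∀ σ ∈ Ioc (0:ℝ) (r ^ 2),
      ‖radialMean D h (Real.sqrt σ)‖ ≤ B * Real.exp (lam * σ) := by
    intro σ hσ
    have hs : Real.sqrt σ ≤ r := (Real.sqrt_le_left hr).2 hσ.2
    refine abs_radialMean_le (Real.sqrt_nonneg _) fun t ht0 ht => ?_
    refine (hB t ht0 (ht.trans hs)).trans ?_
    have : t ^ 2 ≤ σ := by
      have := pow_le_pow_left₀ ht0 ht 2
      rwa [Real.sq_sqrt hσ.1.le] at this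
    gcongr
  have hint : ∫ σ in (0:ℝ)..r ^ 2, B * Real.exp (lam * σ)
      = B / lam * Real.exp (lam * r ^ 2) - B / lam := by
    rw [intervalIntegral.integral_eq_sub_of_hasDerivAt
      (f := fun σ => B / lam * Real.exp (lam * σ))]
    · simp
    · intro x _
      refine (((hasDerivAt_id x).const_mul lam).exp.const_mul (B / lam)).congr_deriv ?_
      simp; field_simp
    · exact Continuous.intervalIntegrable (by fun_prop) _ _
  have h1 := intervalIntegral.norm_integral_le_of_norm_le (μ := volume) (sq_nonneg r)
    (Eventually.of_forall key)
    (Continuous.intervalIntegrable (by fun_prop) _ _)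
  rw [hint] at h1
  rw [radialPotential, abs_mul, abs_of_pos (by norm_num : (0:ℝ) < 2⁻¹)]
  have h2 : 0 ≤ B / lam := by positivity
  rw [Real.norm_eq_abs] at h1
  calc _ ≤ 2⁻¹ * (B / lam * Real.exp (lam * r ^ 2)) := by gcongr; linarith
    _ = _ := by field_simp

lemma abs_radialPotential_le {D : ℕ} {h : ℝ → ℝ} {B r : ℝ} (hr : 0 ≤ r)
    (hB : ∀ t, 0 ≤ t → t ≤ r → |h t| ≤ B) :
    |radialPotential D h r| ≤ B * r ^ 2 / 2 := by
  have h1 := intervalIntegral.norm_integral_le_of_norm_le_const (a := (0:ℝ)) (b := r ^ 2) (C := B)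
    (f := fun σ => radialMean D h (Real.sqrt σ)) (by
      intro σ hσ
      rw [uIoc_of_le (sq_nonneg r)] at hσ
      have hs : Real.sqrt σ ≤ r := (Real.sqrt_le_left hr).2 hσ.2
      exact abs_radialMean_le (Real.sqrt_nonneg _) fun t ht0 ht => hB t ht0 (ht.trans hs))
  rw [radialPotential, abs_mul, abs_of_pos (by norm_num : (0:ℝ) < 2⁻¹)]
  rw [Real.norm_eq_abs, sub_zero, abs_of_nonneg (sq_nonneg r)] at h1
  linarith

lemma radialPotential_mono {D : ℕ} {h : ℝ → ℝ} (hc : Continuous h) (hh : ∀ t, 0 ≤ h t) :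
    MonotoneOn (radialPotential D h) (Ici 0) := by
  refine monotoneOn_of_deriv_nonneg (convex_Ici 0) (continuous_radialPotential hc).continuousOn
    ?_ ?_
  · intro r hr
    rw [interior_Ici] at hr
    exact (hasDerivAt_radialPotential hc (le_of_lt hr)).differentiableAt.differentiableWithinAt
  · intro r hr
    rw [interior_Ici] at hr
    rw [(hasDerivAt_radialPotential hc (le_of_lt hr)).deriv]
    exact mul_nonneg (le_of_lt hr) (radialMean_nonneg hh r)

/-- `r^D` times the mean is the integral of `t^(D-1) h(t)` over `[0,r]`. -/
lemma pow_mul_radialMean {D : ℕ} (hD : 1 ≤ D) (h : ℝ → ℝ) (r : ℝ) :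
    r ^ D * radialMean D h r = ∫ t in (0:ℝ)..r, t ^ (D - 1) * h t := by
  have h1 := intervalIntegral.mul_integral_comp_mul_left (a := 0) (b := 1) (c := r)
    (f := fun t => t ^ (D - 1) * h t)
  rw [mul_zero, mul_one] at h1
  rw [← h1, radialMean, ← intervalIntegral.integral_const_mul, ← intervalIntegral.integral_const_mul]
  congr 1
  ext θ
  obtain ⟨k, rfl⟩ : ∃ k, D = k + 1 := ⟨D - 1, by omega⟩
  simp only [Nat.add_sub_cancel]
  ring

section Regularity

variable {E : Type*} [NormedAddCommGroup E] [NormedSpace ℝ E] [ProperSpace E]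

lemma hasFDerivAt_integral_pow_mul_comp_smul (m : ℕ) {g : E → ℝ} (hg : ContDiff ℝ 1 g) (x : E) :
    HasFDerivAt (fun x => ∫ θ in (0:ℝ)..1, θ ^ m * g (θ • x))
      (∫ θ in (0:ℝ)..1, θ ^ (m + 1) • fderiv ℝ g (θ • x)) x := by
  have hc : Continuous (fderiv ℝ g) := hg.continuous_fderiv one_ne_zero
  have hgc := hg.continuous
  obtain ⟨C, hC⟩ := (isCompact_closedBall (0:E) (‖x‖ + 1)).exists_bound_of_continuousOn
    hc.continuousOn
  refine intervalIntegral.hasFDerivAt_integral_of_dominated_of_fderiv_le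
    (F := fun x θ => θ ^ m * g (θ • x)) (F' := fun x θ => θ ^ (m + 1) • fderiv ℝ g (θ • x))
    (bound := fun _ => C)
    (Metric.ball_mem_nhds x one_pos) (Eventually.of_forall fun y => ?_) ?_ ?_ ?_ ?_ ?_
  · exact Continuous.aestronglyMeasurable (by fun_prop)
  · exact Continuous.intervalIntegrable (by fun_prop) _ _
  · exact Continuous.aestronglyMeasurable (by fun_prop)
  · refine Eventually.of_forall fun θ hθ y hy => ?_
    rw [uIoc_of_le zero_le_one] at hθ
    have hy' : ‖y‖ ≤ ‖x‖ + 1 := by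
      have h1 := norm_le_norm_add_norm_sub' y x
      rw [Metric.mem_ball, dist_eq_norm] at hy
      linarith
    have h1 := hC (θ • y) (by
      rw [mem_closedBall_zero_iff, norm_smul, Real.norm_eq_abs, abs_of_pos hθ.1]
      nlinarith [norm_nonneg y, hθ.1, hθ.2])
    rw [norm_smul, Real.norm_eq_abs, abs_of_nonneg (pow_nonneg hθ.1.le _)]
    have h2 : θ ^ (m + 1) ≤ 1 := pow_le_one₀ hθ.1.le hθ.2
    nlinarith [norm_nonneg (fderiv ℝ g (θ • y)), pow_nonneg hθ.1.le (m + 1)]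
  · exact intervalIntegrable_const
  · refine Eventually.of_forall fun θ _ y _ => ?_
    have h1 : HasFDerivAt g (fderiv ℝ g (θ • y)) (θ • y) :=
      (hg.differentiable one_ne_zero).differentiableAt.hasFDerivAt
    have h2 : HasFDerivAt (fun y : E => θ • y) (θ • ContinuousLinearMap.id ℝ E) y :=
      (hasFDerivAt_id y).const_smul θ
    refine ((h1.comp y h2).const_mul (θ ^ m)).congr_fderiv ?_
    ext v
    simp
    ring

lemma contDiff_integral_pow_mul_comp_smul (m : ℕ) {g : E → ℝ} (hg : ContDiff ℝ 1 g) :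
    ContDiff ℝ 1 (fun x => ∫ θ in (0:ℝ)..1, θ ^ m * g (θ • x)) := by
  have hc : Continuous (fderiv ℝ g) := hg.continuous_fderiv one_ne_zero
  rw [contDiff_one_iff_fderiv]
  refine ⟨fun x => (hasFDerivAt_integral_pow_mul_comp_smul m hg x).differentiableAt, ?_⟩
  rw [funext fun x => (hasFDerivAt_integral_pow_mul_comp_smul m hg x).fderiv]
  apply intervalIntegral.continuous_parametric_intervalIntegral_of_continuous'
  fun_prop

/-- Euler's identity for `x ↦ ∫₀¹ θ^m g(θx) dθ`. -/
lemma fderiv_integral_pow_mul_comp_smul_apply_self (m : ℕ) {g : E → ℝ} (hg : ContDiff ℝ 1 g)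
    (x : E) :
    fderiv ℝ (fun x => ∫ θ in (0:ℝ)..1, θ ^ m * g (θ • x)) x x
      = g x - (m + 1) * ∫ θ in (0:ℝ)..1, θ ^ m * g (θ • x) := by
  have hc : Continuous (fderiv ℝ g) := hg.continuous_fderiv one_ne_zero
  have hgc := hg.continuous
  rw [(hasFDerivAt_integral_pow_mul_comp_smul m hg x).fderiv]
  rw [ContinuousLinearMap.intervalIntegral_apply
    (Continuous.intervalIntegrable (by fun_prop) _ _)]
  have h1 : ∫ θ in (0:ℝ)..1, ((θ ^ (m + 1) • fderiv ℝ g (θ • x)) x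
      + (m + 1) * (θ ^ m * g (θ • x))) = g x := by
    rw [intervalIntegral.integral_eq_sub_of_hasDerivAt (f := fun θ => θ ^ (m + 1) * g (θ • x))]
    · simp
    · intro θ _
      have h1 : HasFDerivAt g (fderiv ℝ g (θ • x)) (θ • x) :=
        (hg.differentiable one_ne_zero).differentiableAt.hasFDerivAt
      have h2 : HasDerivAt (fun θ : ℝ => θ • x) ((1:ℝ) • x) θ := (hasDerivAt_id θ).smul_const x
      refine ((hasDerivAt_pow (m + 1) θ).mul (h1.comp_hasDerivAt θ h2)).congr_deriv ?_
      simp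
      ring
    · exact Continuous.intervalIntegrable (by fun_prop) _ _
  rw [intervalIntegral.integral_add (Continuous.intervalIntegrable (by fun_prop) _ _)
    (Continuous.intervalIntegrable (by fun_prop) _ _), intervalIntegral.integral_const_mul] at h1
  linarith

end Regularity

lemma hasFDerivAt_radialPotential_norm {D : ℕ} {h : ℝ → ℝ} (hh : Continuous h)
    {F : Type*} [NormedAddCommGroup F] [InnerProductSpace ℝ F] (x : F) :
    HasFDerivAt (fun x : F => radialPotential D h ‖x‖)
      (radialMean D h ‖x‖ • innerSL ℝ x) x := by
  have h1 := (hasDerivAt_integral_radialMean (D := D) hh (‖x‖ ^ 2))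
  have h2 : HasFDerivAt (fun x : F => ‖x‖ ^ 2) (2 • innerSL ℝ x) x :=
    (hasStrictFDerivAt_norm_sq x).hasFDerivAt
  refine (h1.comp_hasFDerivAt x h2).congr_fderiv ?_
  rw [Real.sqrt_sq (norm_nonneg x)]
  ext v
  simp
  ring

/-- A radial solution of the integral equation is a classical radial solution of
`Δv = ρ G(v)`. -/
lemma contDiff_and_laplacian_of_radial {D : ℕ} (hD : 1 ≤ D)
    {ρ : EuclideanSpace ℝ (Fin D) → ℝ} (hρ : ContDiff ℝ 1 ρ)
    {p : ℝ → ℝ} (hp : Continuous p) (hρp : ∀ x, ρ x = p ‖x‖) {G : ℝ → ℝ} (hG : ContDiff ℝ 1 G)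
    {V : ℝ → ℝ} (hV : Continuous V) {a : ℝ}
    (hVeq : ∀ r, V r = a + radialPotential D (fun t => p t * G (V t)) r) :
    ContDiff ℝ 2 (fun x : EuclideanSpace ℝ (Fin D) => V ‖x‖) ∧
      ∀ x : EuclideanSpace ℝ (Fin D),
        laplacian (fun x : EuclideanSpace ℝ (Fin D) => V ‖x‖) x = ρ x * G (V ‖x‖) := by
  set h : ℝ → ℝ := fun t => p t * G (V t) with hh
  have hGc := hG.continuous
  have hc : Continuous h := by fun_prop
  set v : EuclideanSpace ℝ (Fin D) → ℝ := fun x => V ‖x‖ with hv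
  set g : EuclideanSpace ℝ (Fin D) → ℝ := fun x => ρ x * G (v x) with hg
  have hgh : ∀ x, g x = h ‖x‖ := fun x => by simp only [hg, hh, hv, hρp]
  have hmean : ∀ x : EuclideanSpace ℝ (Fin D),
      radialMean D h ‖x‖ = ∫ θ in (0:ℝ)..1, θ ^ (D - 1) * g (θ • x) := by
    intro x
    refine intervalIntegral.integral_congr fun θ hθ => ?_
    rw [uIcc_of_le zero_le_one] at hθ
    simp only [hgh, norm_smul, Real.norm_eq_abs, abs_of_nonneg hθ.1, mul_comm]
  have hder : ∀ x, HasFDerivAt v (radialMean D h ‖x‖ • innerSL ℝ x) x := by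
    intro x
    have h1 := (hasFDerivAt_radialPotential_norm (D := D) hc x).const_add a
    rwa [show (fun x : EuclideanSpace ℝ (Fin D) => a + radialPotential D h ‖x‖) = v from
      funext fun y => (hVeq ‖y‖).symm] at h1
  have hfd : fderiv ℝ v = fun x => radialMean D h ‖x‖ • innerSL ℝ x :=
    funext fun x => (hder x).fderiv
  have hv1 : ContDiff ℝ 1 v := by
    rw [contDiff_one_iff_fderiv]
    refine ⟨fun x => (hder x).differentiableAt, ?_⟩
    rw [hfd]
    have := continuous_radialMean (D := D) hc
    exact (this.comp continuous_norm).smul (innerSL ℝ).continuous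
  have hg1 : ContDiff ℝ 1 g := hρ.mul (hG.comp hv1)
  have hJ := contDiff_integral_pow_mul_comp_smul (D - 1) hg1
  set J : EuclideanSpace ℝ (Fin D) → ℝ := fun x => ∫ θ in (0:ℝ)..1, θ ^ (D - 1) * g (θ • x)
  have hfd' : fderiv ℝ v = fun x => J x • innerSL ℝ x := by
    rw [hfd]; funext x; rw [hmean]
  constructor
  · rw [show (2 : WithTop ℕ∞) = 1 + 1 by norm_num, contDiff_succ_iff_fderiv]
    refine ⟨hv1.differentiable one_ne_zero, by simp, ?_⟩
    rw [hfd']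
    exact hJ.smul (innerSL ℝ).contDiff
  · intro x
    have hcoord : ∀ i, fderiv ℝ (fun y => fderiv ℝ v y (EuclideanSpace.single i 1)) x
        (EuclideanSpace.single i 1)
        = fderiv ℝ J x (EuclideanSpace.single i 1) * x i + J x := by
      intro i
      have h1 : (fun y => fderiv ℝ v y (EuclideanSpace.single i 1)) = fun y => J y * y i := by
        funext y
        rw [hfd']
        have h0 : inner ℝ y (EuclideanSpace.single i (1:ℝ)) = y i := by
          rw [real_inner_comm]; simp [EuclideanSpace.inner_single_left]
        simp [h0]
      rw [h1]
      have h2 : HasFDerivAt J (fderiv ℝ J x) x :=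
        (hJ.differentiable one_ne_zero).differentiableAt.hasFDerivAt
      have h3 : HasFDerivAt (fun y : EuclideanSpace ℝ (Fin D) => y i)
        (EuclideanSpace.proj i : EuclideanSpace ℝ (Fin D) →L[ℝ] ℝ) x :=
        (EuclideanSpace.proj i : EuclideanSpace ℝ (Fin D) →L[ℝ] ℝ).hasFDerivAt
      have h5 : HasFDerivAt (fun y => J y * y i) _ x := h2.mul h3
      rw [h5.fderiv]
      simp
      ring
    unfold laplacian
    simp only [hcoord]
    rw [Finset.sum_add_distrib]
    have h4 : ∑ i, fderiv ℝ J x (EuclideanSpace.single i 1) * x i = fderiv ℝ J x x := by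
      have h6 := congrArg (fderiv ℝ J x) ((EuclideanSpace.basisFun (Fin D) ℝ).sum_repr x)
      rw [map_sum] at h6
      rw [← h6]
      refine Finset.sum_congr rfl fun i _ => ?_
      simp [mul_comm]
    rw [h4, fderiv_integral_pow_mul_comp_smul_apply_self (D - 1) hg1 x]
    simp only [Finset.sum_const, Finset.card_univ, Fintype.card_fin, nsmul_eq_mul]
    rw [Nat.cast_sub hD, Nat.cast_one]
    change g x - (D - 1 + 1) * J x + D * J x = g x
    ring

/-- Second-order comparison at an interior minimum of `v - u`. -/
lemma laplacian_le_of_isLocalMin {D : ℕ} {u v : EuclideanSpace ℝ (Fin D) → ℝ}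
    (hu : ContDiff ℝ 2 u) (hv : ContDiff ℝ 2 v) {x : EuclideanSpace ℝ (Fin D)}
    (hmin : IsLocalMin (fun y => v y - u y) x) : laplacian u x ≤ laplacian v x := by
  unfold laplacian
  refine Finset.sum_le_sum fun i _ => ?_
  set e : EuclideanSpace ℝ (Fin D) := EuclideanSpace.single i 1
  have hline : ∀ w : EuclideanSpace ℝ (Fin D) → ℝ, ContDiff ℝ 2 w →
      (∀ t : ℝ, HasDerivAt (fun t : ℝ => w (x + t • e)) (fderiv ℝ w (x + t • e) e) t) ∧
      HasDerivAt (fun t : ℝ => fderiv ℝ w (x + t • e) e)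
        (fderiv ℝ (fun y => fderiv ℝ w y e) x e) 0 := by
    intro w hw
    have hl : ∀ t : ℝ, HasDerivAt (fun t : ℝ => x + t • e) e t := fun t => by
      simpa using ((hasDerivAt_id t).smul_const e).const_add x
    refine ⟨fun t => ?_, ?_⟩
    · exact ((hw.differentiable two_ne_zero).differentiableAt.hasFDerivAt).comp_hasDerivAt t (hl t)
    · have h1 : ContDiff ℝ 1 (fun y => fderiv ℝ w y e) :=
        (hw.fderiv_right (m := 1) (by norm_num)).clm_apply contDiff_const
      have h2 : HasFDerivAt (fun y => fderiv ℝ w y e) (fderiv ℝ (fun y => fderiv ℝ w y e) x)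
          (x + (0:ℝ) • e) := by
        simpa using (h1.differentiable one_ne_zero).differentiableAt.hasFDerivAt
      exact h2.comp_hasDerivAt 0 (hl 0)
  obtain ⟨hu1, hu2⟩ := hline u hu
  obtain ⟨hv1, hv2⟩ := hline v hv
  set φ : ℝ → ℝ := fun t => v (x + t • e) - u (x + t • e) with hφ
  have hd : deriv φ = fun t => fderiv ℝ v (x + t • e) e - fderiv ℝ u (x + t • e) e :=
    funext fun t => ((hv1 t).sub (hu1 t)).deriv
  have hdd : deriv (deriv φ) 0 = fderiv ℝ (fun y => fderiv ℝ v y e) x e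
      - fderiv ℝ (fun y => fderiv ℝ u y e) x e := by
    rw [hd]; exact (hv2.sub hu2).deriv
  have hφc : Continuous φ := by
    have := hv.continuous
    have := hu.continuous
    fun_prop
  have hφmin : IsLocalMin φ 0 := by
    have h0 : Tendsto (fun t : ℝ => x + t • e) (nhds 0) (nhds x) := by
      have : Continuous fun t : ℝ => x + t • e := by fun_prop
      simpa using this.tendsto 0
    have := h0.eventually hmin
    simpa [IsLocalMin, IsMinFilter, hφ] using this
  by_contra! hlt
  have hneg : deriv (deriv φ) 0 < 0 := by rw [hdd]; linarith
  have hmax := isLocalMax_of_deriv_deriv_neg hneg hφmin.deriv_eq_zero hφc.continuousAt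
  have hconst : φ =ᶠ[nhds 0] fun _ => φ 0 := by
    filter_upwards [hmax, hφmin] with t h1 h2 using le_antisymm h1 h2
  have := hconst.deriv.deriv_eq
  simp at this
  linarith

lemma radialPotential_abs {D : ℕ} {h : ℝ → ℝ} (r : ℝ) :
    radialPotential D h |r| = radialPotential D h r := by
  simp [radialPotential]

lemma radialPotential_sub {D : ℕ} {h₁ h₂ : ℝ → ℝ} (hh₁ : Continuous h₁) (hh₂ : Continuous h₂)
    (r : ℝ) :
    radialPotential D (fun t => h₁ t - h₂ t) r = radialPotential D h₁ r - radialPotential D h₂ r := by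
  have h1 : radialMean D (fun t => h₁ t - h₂ t) = fun s => radialMean D h₁ s - radialMean D h₂ s := by
    funext s
    simp only [radialMean, mul_sub]
    exact intervalIntegral.integral_sub (Continuous.intervalIntegrable (by fun_prop) _ _)
      (Continuous.intervalIntegrable (by fun_prop) _ _)
  simp only [radialPotential, h1]
  rw [intervalIntegral.integral_sub ((continuous_radialMean_sqrt hh₁).intervalIntegrable _ _)
    ((continuous_radialMean_sqrt hh₂).intervalIntegrable _ _), mul_sub]

/-- Global existence for the radial integral equation with a bounded Lipschitz nonlinearity. -/
lemma exists_radial_solution (D : ℕ) {p : ℝ → ℝ} (hp : Continuous p) {P : ℝ}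
    (hpP : ∀ t, |p t| ≤ P) {G : ℝ → ℝ} {L : NNReal} (hG : LipschitzWith L G) {B : ℝ}
    (hB : ∀ t, |G t| ≤ B) (a : ℝ) :
    ∃ V : ℝ → ℝ, Continuous V ∧
      ∀ r, V r = a + radialPotential D (fun t => p t * G (V t)) r := by
  have hP0 : 0 ≤ P := (abs_nonneg _).trans (hpP 0)
  have hB0 : 0 ≤ B := (abs_nonneg _).trans (hB 0)
  set lam : ℝ := P * L + 1 with hlam
  have hl : 1 ≤ lam := by rw [hlam]; have : 0 ≤ P * L := by positivity
                          linarith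
  have hl0 : 0 < lam := by linarith
  have hGc := hG.continuous
  set H : BoundedContinuousFunction ℝ ℝ → ℝ → ℝ :=
    fun z t => p t * G (Real.exp (lam * t ^ 2) * z t) with hH
  have hHc : ∀ z, Continuous (H z) := fun z => by
    have := z.continuous
    simp only [hH]; fun_prop
  have hcont : ∀ z : BoundedContinuousFunction ℝ ℝ, Continuous
      (fun r => Real.exp (-(lam * r ^ 2)) * (a + radialPotential D (H z) r)) := fun z => by
    have := continuous_radialPotential (D := D) (hHc z)
    fun_prop
  have hbd : ∀ (z : BoundedContinuousFunction ℝ ℝ) (r : ℝ),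
      ‖Real.exp (-(lam * r ^ 2)) * (a + radialPotential D (H z) r)‖ ≤ |a| + P * B := by
    intro z r
    have h1 : |radialPotential D (H z) r| ≤ P * B * r ^ 2 / 2 := by
      rw [← radialPotential_abs, ← sq_abs r]
      refine abs_radialPotential_le (abs_nonneg r) fun t _ _ => ?_
      simp only [hH]
      rw [abs_mul]
      exact mul_le_mul (hpP t) (hB _) (abs_nonneg _) hP0
    rw [norm_mul, Real.norm_eq_abs, Real.norm_eq_abs, abs_of_pos (Real.exp_pos _)]
    have h2 : Real.exp (-(lam * r ^ 2)) ≤ 1 := Real.exp_le_one_iff.2 (by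
      have : 0 ≤ lam * r ^ 2 := by positivity
      linarith)
    have h3 : Real.exp (-(lam * r ^ 2)) * r ^ 2 ≤ 1 := by
      rw [Real.exp_neg, inv_mul_le_iff₀ (Real.exp_pos _), mul_one]
      have := Real.add_one_le_exp (lam * r ^ 2)
      nlinarith [sq_nonneg r]
    have h4 : |a + radialPotential D (H z) r| ≤ |a| + P * B * r ^ 2 / 2 :=
      (abs_add_le _ _).trans (by linarith)
    have h5 : 0 ≤ P * B := by positivity
    calc _ ≤ Real.exp (-(lam * r ^ 2)) * (|a| + P * B * r ^ 2 / 2) := by gcongr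
      _ = Real.exp (-(lam * r ^ 2)) * |a| + P * B * (Real.exp (-(lam * r ^ 2)) * r ^ 2) / 2 := by
        ring
      _ ≤ 1 * |a| + P * B * 1 / 2 := by gcongr
      _ ≤ _ := by linarith
  let T : BoundedContinuousFunction ℝ ℝ → BoundedContinuousFunction ℝ ℝ := fun z =>
    BoundedContinuousFunction.ofNormedAddCommGroup _ (hcont z) _ (hbd z)
  have hT : ContractingWith (1 / 2) T := by
    refine ⟨by rw [← NNReal.coe_lt_coe]; norm_num, LipschitzWith.of_dist_le_mul fun z w => ?_⟩
    rw [BoundedContinuousFunction.dist_le (by positivity)]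
    intro r
    have h1 : |radialPotential D (fun t => H z t - H w t) r|
        ≤ (P * L * dist z w) / (2 * lam) * Real.exp (lam * r ^ 2) := by
      rw [← radialPotential_abs, ← sq_abs r]
      refine abs_radialPotential_le_exp hl0 (by positivity) (abs_nonneg r) fun t _ _ => ?_
      simp only [hH]
      rw [← mul_sub, abs_mul]
      have h2 := hG.dist_le_mul (Real.exp (lam * t ^ 2) * z t) (Real.exp (lam * t ^ 2) * w t)
      rw [Real.dist_eq, Real.dist_eq, ← mul_sub, abs_mul, abs_of_pos (Real.exp_pos _)] at h2
      have h3 : |z t - w t| ≤ dist z w := z.dist_coe_le_dist (g := w) t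
      calc _ ≤ P * (L * (Real.exp (lam * t ^ 2) * dist z w)) := by
            gcongr
            · exact hpP t
            · exact h2.trans (by gcongr)
        _ = _ := by ring
    rw [radialPotential_sub (hHc z) (hHc w)] at h1
    change dist (Real.exp (-(lam * r ^ 2)) * (a + radialPotential D (H z) r))
      (Real.exp (-(lam * r ^ 2)) * (a + radialPotential D (H w) r)) ≤ _
    rw [Real.dist_eq, ← mul_sub, abs_mul, abs_of_pos (Real.exp_pos _), add_sub_add_left_eq_sub,
      Real.exp_neg, inv_mul_le_iff₀ (Real.exp_pos _)]
    refine h1.trans ?_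
    have h6 : P * L * dist z w / (2 * lam) ≤ 1 / 2 * dist z w := by
      rw [div_le_iff₀ (by positivity)]
      have := dist_nonneg (x := z) (y := w)
      nlinarith
    have h7 : (((1 / 2 : NNReal)) : ℝ) = 1 / 2 := by norm_num
    rw [h7, mul_comm (Real.exp _)]
    gcongr
  set z := hT.fixedPoint T
  have hz : T z = z := hT.fixedPoint_isFixedPt
  have hz' : ∀ r, z r = Real.exp (-(lam * r ^ 2)) * (a + radialPotential D (H z) r) := by
    intro r
    conv_lhs => rw [← hz]
    rfl
  refine ⟨fun r => Real.exp (lam * r ^ 2) * z r, by have := z.continuous; fun_prop, fun r => ?_⟩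
  change Real.exp (lam * r ^ 2) * z r = a + radialPotential D (H z) r
  rw [hz' r, ← mul_assoc, ← Real.exp_add]
  simp

/-- Stability of the radial integral equation. -/
lemma radial_stability {D : ℕ} {V₁ V₂ h₁ h₂ : ℝ → ℝ} (hV₁ : Continuous V₁) (hV₂ : Continuous V₂)
    (hh₁ : Continuous h₁) (hh₂ : Continuous h₂) {a₁ a₂ R C ε : ℝ} (hC : 0 ≤ C) (hε : 0 ≤ ε)
    (h1 : ∀ r, 0 ≤ r → r ≤ R → V₁ r = a₁ + radialPotential D h₁ r)
    (h2 : ∀ r, 0 ≤ r → r ≤ R → V₂ r = a₂ + radialPotential D h₂ r)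
    (h12 : ∀ r, 0 ≤ r → r ≤ R → |h₁ r - h₂ r| ≤ ε + C * |V₁ r - V₂ r|)
    {r : ℝ} (hr0 : 0 ≤ r) (hrR : r ≤ R) :
    |V₁ r - V₂ r| ≤ (2 * |a₁ - a₂| + ε) * Real.exp ((C + 1) * R ^ 2) := by
  set lam := C + 1 with hlam
  have hl : 0 < lam := by linarith
  obtain ⟨s, ⟨hs0, hsR⟩, hs⟩ := (isCompact_Icc (a := (0:ℝ)) (b := R)).exists_isMaxOn
    ⟨r, hr0, hrR⟩ (f := fun r => Real.exp (-(lam * r ^ 2)) * |V₁ r - V₂ r|)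
    (Continuous.continuousOn (by fun_prop))
  set m := Real.exp (-(lam * s ^ 2)) * |V₁ s - V₂ s| with hm
  have hm0 : 0 ≤ m := by positivity
  have hle : ∀ t, 0 ≤ t → t ≤ R → |V₁ t - V₂ t| ≤ m * Real.exp (lam * t ^ 2) := by
    intro t ht0 htR
    have := hs (show t ∈ Icc 0 R from ⟨ht0, htR⟩)
    simp only [mem_ofPred_eq] at this
    rw [Real.exp_neg, inv_mul_le_iff₀ (Real.exp_pos _)] at this
    linarith
  have h3 : |radialPotential D (fun t => h₁ t - h₂ t) s|
      ≤ (ε + C * m) / (2 * lam) * Real.exp (lam * s ^ 2) := by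
    refine abs_radialPotential_le_exp hl (by positivity) hs0 fun t ht0 hts => ?_
    have h4 := h12 t ht0 (hts.trans hsR)
    have h5 := hle t ht0 (hts.trans hsR)
    have h6 : 1 ≤ Real.exp (lam * t ^ 2) := Real.one_le_exp (by positivity)
    calc _ ≤ ε * Real.exp (lam * t ^ 2) + C * (m * Real.exp (lam * t ^ 2)) := by
          refine h4.trans (add_le_add (by nlinarith) (by gcongr))
      _ = _ := by ring
  rw [radialPotential_sub hh₁ hh₂] at h3
  have h7 : |V₁ s - V₂ s| ≤ |a₁ - a₂| + (ε + C * m) / (2 * lam) * Real.exp (lam * s ^ 2) := by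
    rw [h1 s hs0 hsR, h2 s hs0 hsR]
    calc _ = |(a₁ - a₂) + (radialPotential D h₁ s - radialPotential D h₂ s)| := by ring_nf
      _ ≤ _ := (abs_add_le _ _).trans (by linarith)
  have h8 : m ≤ |a₁ - a₂| + (ε + C * m) / (2 * lam) := by
    have h6 : 1 ≤ Real.exp (lam * s ^ 2) := Real.one_le_exp (by positivity)
    have hme : m * Real.exp (lam * s ^ 2) = |V₁ s - V₂ s| := by
      rw [hm, mul_right_comm, ← Real.exp_add]; simp
    refine le_of_mul_le_mul_right ?_ (Real.exp_pos (lam * s ^ 2))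
    rw [hme, add_mul]
    refine h7.trans ?_
    gcongr
    exact le_mul_of_one_le_right (abs_nonneg _) h6
  have h9 : (ε + C * m) / (2 * lam) ≤ ε / 2 + m / 2 := by
    rw [div_le_iff₀ (by positivity)]
    nlinarith
  have h10 : m ≤ 2 * |a₁ - a₂| + ε := by linarith
  refine (hle r hr0 hrR).trans ?_
  gcongr

/-- Under the Keller–Osserman condition there are arbitrarily large levels `m` above which `√F`
grows at a prescribed linear rate and `∫ 1/√F` is as small as desired. -/
lemma exists_level_of_kellerOsserman {F : ℝ → ℝ} (hFc : Continuous F) (hFpos : ∀ s, 0 < s → 0 < F s)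
    (hFm : MonotoneOn F (Ici 0)) {b : ℝ} (hb : 0 < b)
    (hKO : IntegrableOn (fun s => 1 / Real.sqrt (F s)) (Ici b)) {lam ε : ℝ} (hl : 0 < lam)
    (hε : 0 < ε) (A : ℝ) :
    ∃ m, A ≤ m ∧ 0 < m ∧ (∀ v, m ≤ v → Real.sqrt (F m) + lam * (v - m) ≤ Real.sqrt (F v)) ∧
      ∀ v w, m ≤ v → v ≤ w → ∫ t in v..w, 1 / Real.sqrt (F t) ≤ ε := by
  set g : ℝ → ℝ := fun s => 1 / Real.sqrt (F s) with hg
  have hgint : ∀ v w, b ≤ v → v ≤ w → IntervalIntegrable g volume v w := fun v w hv hvw => by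
    rw [intervalIntegrable_iff_integrableOn_Icc_of_le hvw]
    exact hKO.mono_set fun x hx => hv.trans hx.1
  set ε' := min ε (1 / (2 * lam)) with hε'
  have hε'0 : 0 < ε' := lt_min hε (by positivity)
  have hlim := intervalIntegral_tendsto_integral_Ioi b (hKO.mono_set Ioi_subset_Ici_self)
    tendsto_id
  obtain ⟨N, hN⟩ := (Metric.tendsto_atTop.1 hlim) (ε' / 2) (by positivity)
  set b' := max (max A b) N with hb'
  have hb'b : b ≤ b' := (le_max_right _ _).trans (le_max_left _ _)
  have hb'A : A ≤ b' := (le_max_left _ _).trans (le_max_left _ _)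
  have hb'N : N ≤ b' := le_max_right _ _
  have htail : ∀ v w, b' ≤ v → v ≤ w → ∫ t in v..w, g t ≤ ε' := by
    intro v w hv hvw
    have h1 := hN v (hb'N.trans hv)
    have h2 := hN w (hb'N.trans (hv.trans hvw))
    have h3 := intervalIntegral.integral_add_adjacent_intervals
      (hgint b v le_rfl (hb'b.trans hv)) (hgint v w (hb'b.trans hv) hvw)
    simp only [id, Real.dist_eq] at h1 h2
    rw [abs_lt] at h1 h2
    linarith [h1.1, h1.2, h2.1, h2.2]
  have hgrow : ∀ v, b' ≤ v → 2 * lam * (v - b') ≤ Real.sqrt (F v) := by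
    intro v hv
    have hv0 : 0 < v := hb.trans_le (hb'b.trans hv)
    have hHv : 0 < Real.sqrt (F v) := Real.sqrt_pos.2 (hFpos v hv0)
    have h1 : ∫ _ in b'..v, g v ≤ ∫ t in b'..v, g t := by
      refine intervalIntegral.integral_mono_on hv intervalIntegrable_const
        (hgint b' v hb'b hv) fun t ht => ?_
      have ht0 : 0 < t := hb.trans_le (hb'b.trans ht.1)
      exact one_div_le_one_div_of_le (Real.sqrt_pos.2 (hFpos t ht0))
        (Real.sqrt_le_sqrt (hFm ht0.le hv0.le ht.2))
    rw [intervalIntegral.integral_const, smul_eq_mul] at h1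
    have h2 : (v - b') * g v ≤ 1 / (2 * lam) :=
      h1.trans ((htail b' v le_rfl hv).trans (min_le_right _ _))
    simp only [hg] at h2
    rw [mul_one_div, div_le_div_iff₀ hHv (by positivity)] at h2
    linarith
  set ψ : ℝ → ℝ := fun v => Real.sqrt (F v) - lam * v with hψ
  have hψc : Continuous ψ := by fun_prop
  set X := max b' ((ψ b' + 2 * lam * b') / lam) with hX
  obtain ⟨m, hm, hmin⟩ := (isCompact_Icc (a := b') (b := X)).exists_isMinOn
    ⟨b', le_rfl, le_max_left _ _⟩ hψc.continuousOn
  have hmin' : ∀ v, b' ≤ v → ψ m ≤ ψ v := by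
    intro v hv
    rcases le_total v X with h | h
    · exact hmin ⟨hv, h⟩
    · refine (hmin (show b' ∈ Icc b' X from ⟨le_rfl, le_max_left _ _⟩)).trans ?_
      have h1 := hgrow v hv
      have h2 : (ψ b' + 2 * lam * b') / lam ≤ v := (le_max_right _ _).trans h
      rw [div_le_iff₀ hl] at h2
      have h3 : ψ v = Real.sqrt (F v) - lam * v := rfl
      linarith
  refine ⟨m, hb'A.trans hm.1, hb.trans_le (hb'b.trans hm.1), fun v hv => ?_, fun v w hv hvw => ?_⟩
  · have := hmin' v (hm.1.trans hv)
    simp only [hψ] at this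
    linarith
  · exact (htail v w (hm.1.trans hv) hvw).trans (min_le_left _ _)

/-- Functions with `V' ≥ k √(F(V) - F(m))` cannot survive for unit time after leaving a suitable
level `m`. -/
lemma exists_blowup_level {F : ℝ → ℝ} (hFc : Continuous F) (hFpos : ∀ s, 0 < s → 0 < F s)
    (hFm : MonotoneOn F (Ici 0)) {b : ℝ} (hb : 0 < b)
    (hKO : IntegrableOn (fun s => 1 / Real.sqrt (F s)) (Ici b)) {k : ℝ} (hk : 0 < k) (A : ℝ) :
    ∃ m, A ≤ m ∧ 0 < m ∧ ∀ (V V' : ℝ → ℝ) (r₁ : ℝ), V r₁ = m →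
      (∀ r ∈ Icc r₁ (r₁ + 1), HasDerivAt V (V' r) r) →
      (∀ r ∈ Ioc r₁ (r₁ + 1), m < V r) →
      (∀ r ∈ Icc r₁ (r₁ + 1), k * Real.sqrt (F (V r) - F m) ≤ V' r) → False := by
  obtain ⟨m, hmA, hm0, hmgrow, hmtail⟩ := exists_level_of_kellerOsserman hFc hFpos hFm hb hKO
    (lam := 4 / k) (ε := k / 8) (by positivity) (by positivity) A
  refine ⟨m, hmA, hm0, fun V V' r₁ hV1 hder hgt hineq => ?_⟩
  set Hm := Real.sqrt (F m) with hHm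
  have hHm0 : 0 < Hm := Real.sqrt_pos.2 (hFpos m hm0)
  have hHm2 : Hm ^ 2 = F m := Real.sq_sqrt (hFpos m hm0).le
  have hge : ∀ r ∈ Icc r₁ (r₁ + 1), m ≤ V r := fun r hr => by
    rcases eq_or_lt_of_le hr.1 with h | h
    · rw [← h, hV1]
    · exact (hgt r ⟨h, hr.2⟩).le
  have hHV2 : ∀ r ∈ Icc r₁ (r₁ + 1), Real.sqrt (F (V r)) ^ 2 = F (V r) := fun r hr =>
    Real.sq_sqrt (hFpos _ (hm0.trans_le (hge r hr))).le
  have hVc : ContinuousOn V (Icc r₁ (r₁ + 1)) := fun r hr =>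
    (hder r hr).continuousAt.continuousWithinAt
  have hsub1 : Icc r₁ (r₁ + 1 / 2) ⊆ Icc r₁ (r₁ + 1) := Icc_subset_Icc le_rfl (by linarith)
  have hsub2 : Icc (r₁ + 1 / 2) (r₁ + 1) ⊆ Icc r₁ (r₁ + 1) := Icc_subset_Icc (by linarith) le_rfl
  have hXder : ∀ r ∈ Ioo r₁ (r₁ + 1 / 2),
      HasDerivAt (fun r => Real.sqrt (V r - m)) (V' r / (2 * Real.sqrt (V r - m))) r := by
    intro r hr
    have hr' : r ∈ Ioc r₁ (r₁ + 1) := ⟨hr.1, by linarith [hr.2]⟩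
    exact ((hder r ⟨hr'.1.le, hr'.2⟩).sub_const m).sqrt (by linarith [hgt r hr'])
  have hphase1 := (convex_Icc r₁ (r₁ + 1 / 2)).mul_sub_le_image_sub_of_le_deriv
    (f := fun r => Real.sqrt (V r - m)) (C := k / 2 * Real.sqrt (4 / k * Hm))
    ((hVc.mono hsub1).sub continuousOn_const).sqrt
    (by
      rw [interior_Icc]
      exact fun r hr => (hXder r hr).differentiableAt.differentiableWithinAt)
    (by
      rw [interior_Icc]
      intro r hr
      have hr' : r ∈ Ioc r₁ (r₁ + 1) := ⟨hr.1, by linarith [hr.2]⟩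
      have hr'' : r ∈ Icc r₁ (r₁ + 1) := ⟨hr'.1.le, hr'.2⟩
      have hpos : 0 < V r - m := by linarith [hgt r hr']
      rw [(hXder r hr).deriv, le_div_iff₀ (by have := Real.sqrt_pos.2 hpos; positivity)]
      refine le_trans ?_ (hineq r hr'')
      have h1 : 4 / k * Hm * (V r - m) ≤ F (V r) - F m := by
        have h2 := hmgrow (V r) (hge r hr'')
        rw [← hHV2 r hr'', ← hHm2]
        have h3 : 0 ≤ 4 / k * (V r - m) := by positivity
        nlinarith
      have h4 := Real.sqrt_le_sqrt h1
      rw [Real.sqrt_mul (by positivity)] at h4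
      nlinarith)
    r₁ ⟨le_rfl, by linarith⟩ (r₁ + 1 / 2) ⟨by linarith, le_rfl⟩ (by linarith)
  have hmid : r₁ + 1 / 2 ∈ Icc r₁ (r₁ + 1) := ⟨by linarith, by linarith⟩
  simp only [hV1, sub_self, Real.sqrt_zero, sub_zero] at hphase1
  have hVmid : k / 4 * Hm ≤ V (r₁ + 1 / 2) - m := by
    have h1 : 0 ≤ k / 2 * Real.sqrt (4 / k * Hm) * (r₁ + 1 / 2 - r₁) := by
      have : r₁ + 1 / 2 - r₁ = 1 / 2 := by ring
      rw [this]; positivity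
    have h2 := pow_le_pow_left₀ h1 hphase1 2
    rw [Real.sq_sqrt (by linarith [hge _ hmid]), mul_pow, mul_pow,
      Real.sq_sqrt (by positivity)] at h2
    refine le_trans (le_of_eq ?_) h2
    field_simp
    ring
  have hHmid : 2 * Hm ≤ Real.sqrt (F (V (r₁ + 1 / 2))) := by
    have h1 := hmgrow _ (hge _ hmid)
    have h2 : 4 / k * (k / 4 * Hm) ≤ 4 / k * (V (r₁ + 1 / 2) - m) := by gcongr
    have h3 : 4 / k * (k / 4 * Hm) = Hm := by field_simp
    linarith
  have hVmono : MonotoneOn V (Icc r₁ (r₁ + 1)) := by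
    refine monotoneOn_of_deriv_nonneg (convex_Icc _ _) hVc ?_ ?_
    · exact fun r hr => (hder r (interior_subset hr)).differentiableAt.differentiableWithinAt
    · intro r hr
      rw [(hder r (interior_subset hr)).deriv]
      exact le_trans (by positivity) (hineq r (interior_subset hr))
  set q : ℝ → ℝ := fun t => 1 / Real.sqrt (F (max t m)) with hq
  have hqc : Continuous q := by
    refine continuous_const.div (by fun_prop) fun t => ?_
    exact (Real.sqrt_pos.2 (hFpos _ (hm0.trans_le (le_max_right _ _)))).ne'
  have hΘ : ∀ r ∈ Icc r₁ (r₁ + 1),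
      HasDerivAt (fun r => ∫ t in m..V r, q t) (q (V r) * V' r) r := fun r hr =>
    (hqc.integral_hasStrictDerivAt m (V r)).hasDerivAt.comp r (hder r hr)
  have hphase2 := (convex_Icc (r₁ + 1 / 2) (r₁ + 1)).mul_sub_le_image_sub_of_le_deriv
    (f := fun r => ∫ t in m..V r, q t) (C := k / 2)
    (fun r hr => (hΘ r (hsub2 hr)).continuousAt.continuousWithinAt)
    (fun r hr => (hΘ r (hsub2 (interior_subset hr))).differentiableAt.differentiableWithinAt)
    (by
      intro r hr
      have hr1 := interior_subset hr
      have hr2 := hsub2 hr1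
      rw [(hΘ r hr2).deriv]
      have h1 : 2 * Hm ≤ Real.sqrt (F (V r)) := by
        refine hHmid.trans (Real.sqrt_le_sqrt (hFm ?_ ?_ (hVmono hmid hr2 hr1.1)))
        · exact (hm0.trans_le (hge _ hmid)).le
        · exact (hm0.trans_le (hge _ hr2)).le
      have hHV : 0 < Real.sqrt (F (V r)) := by linarith
      simp only [hq, max_eq_left (hge r hr2)]
      rw [one_div, ← div_eq_inv_mul, le_div_iff₀ hHV]
      refine le_trans ?_ (hineq r hr2)
      have h2 : Real.sqrt (F (V r)) / 2 ≤ Real.sqrt (F (V r) - F m) := by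
        apply Real.le_sqrt_of_sq_le
        have := hHV2 r hr2
        nlinarith
      nlinarith)
    (r₁ + 1 / 2) ⟨le_rfl, by linarith⟩ (r₁ + 1) ⟨by linarith, le_rfl⟩ (by linarith)
  have hend : r₁ + 1 ∈ Icc r₁ (r₁ + 1) := ⟨by linarith, le_rfl⟩
  have hle : V (r₁ + 1 / 2) ≤ V (r₁ + 1) := hVmono hmid hend (by linarith)
  have hsmall := hmtail _ _ (hge _ hmid) hle
  have heq : ∫ t in V (r₁ + 1 / 2)..V (r₁ + 1), 1 / Real.sqrt (F t)
      = ∫ t in V (r₁ + 1 / 2)..V (r₁ + 1), q t := by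
    refine intervalIntegral.integral_congr fun t ht => ?_
    rw [uIcc_of_le hle] at ht
    simp only [hq, max_eq_left ((hge _ hmid).trans ht.1)]
  rw [heq, ← intervalIntegral.integral_interval_sub_left (hqc.intervalIntegrable m _)
    (hqc.intervalIntegrable m _)] at hsmall
  linarith

lemma radialPotential_nonneg {D : ℕ} {h : ℝ → ℝ} (hc : Continuous h) (hh : ∀ t, 0 ≤ h t) {r : ℝ}
    (hr : 0 ≤ r) : 0 ≤ radialPotential D h r := by
  simpa using radialPotential_mono (D := D) hc hh (mem_Ici.2 le_rfl) (mem_Ici.2 hr) hr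

/-- Under the Keller–Osserman condition there are arbitrarily large levels which no radial
solution existing on `[0, R + 1]` can take at a radius in `[r₀, R]`. -/
lemma exists_forbidden_level {D : ℕ} (hD : 1 ≤ D) {p : ℝ → ℝ} (hp : Continuous p)
    (hp0 : ∀ t, 0 < p t) {F g : ℝ → ℝ} (hFc : Continuous F) (hFpos : ∀ s, 0 < s → 0 < F s)
    (hFm : MonotoneOn F (Ici 0)) {b : ℝ} (hb : 0 < b)
    (hKO : IntegrableOn (fun s => 1 / Real.sqrt (F s)) (Ici b)) {α : ℝ}
    (hgF : ∀ s, α ≤ s → HasDerivAt F (g s) s) (hgpos : ∀ s, α ≤ s → 0 < g s)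
    {r₀ R : ℝ} (hr₀ : 0 < r₀) (hR : r₀ ≤ R) (A : ℝ) :
    ∃ m, A ≤ m ∧ ∀ κ, 1 / 2 ≤ κ → ∀ a, α ≤ a → ∀ V h : ℝ → ℝ, Continuous h → (∀ t, 0 ≤ h t) →
      (∀ r, V r = a + radialPotential D h r) →
      (∀ t, 0 ≤ t → t ≤ R + 1 → h t = κ * (p t * g (V t))) →
      ∀ r₁, r₀ ≤ r₁ → r₁ ≤ R → V r₁ ≠ m := by
  obtain ⟨t₀, -, ht₀⟩ := (isCompact_Icc (a := (0:ℝ)) (b := R + 1)).exists_isMinOn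
    ⟨0, le_rfl, by linarith⟩ hp.continuousOn
  set c := r₀ ^ (D - 1) * r₀ ^ (D - 1) * (1 / 2 * p t₀) with hc
  have hc0 : 0 < c := by have := hp0 t₀; positivity
  have hR1 : 0 < (R + 1) ^ (D - 1) := pow_pos (by linarith) _
  obtain ⟨m, hmA, hm0, hm⟩ := exists_blowup_level hFc hFpos hFm hb hKO
    (k := Real.sqrt (2 * c) / (R + 1) ^ (D - 1)) (by positivity) A
  refine ⟨m, hmA, fun κ hκ a ha V h hh hh0 hV hht r₁ hr₁ hr₁R hVm => ?_⟩
  have hVα : ∀ r, 0 ≤ r → α ≤ V r := fun r hr => by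
    rw [hV]; linarith [radialPotential_nonneg (D := D) hh hh0 hr]
  have hhpos : ∀ t, 0 ≤ t → t ≤ R + 1 → 0 < h t := fun t ht0 ht => by
    rw [hht t ht0 ht]
    have := hp0 t
    have := hgpos _ (hVα t ht0)
    have : 0 < κ := by linarith
    positivity
  have hVd : ∀ r, 0 ≤ r → HasDerivAt V (r * radialMean D h r) r := fun r hr => by
    rw [show V = fun r => a + radialPotential D h r from funext hV]
    exact (hasDerivAt_radialPotential hh hr).const_add a
  set W : ℝ → ℝ := fun r => ∫ t in (0:ℝ)..r, t ^ (D - 1) * h t with hW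
  have hWd : ∀ r, HasDerivAt W (r ^ (D - 1) * h r) r := fun r =>
    (Continuous.integral_hasStrictDerivAt (f := fun t => t ^ (D - 1) * h t)
      (by fun_prop) 0 r).hasDerivAt
  have hWV : ∀ r, W r = r ^ (D - 1) * (r * radialMean D h r) := fun r => by
    rw [hW]
    simp only
    rw [← pow_mul_radialMean hD, ← mul_assoc, ← pow_succ, Nat.sub_add_cancel hD]
  have hWpos : ∀ r, 0 < r → r ≤ R + 1 → 0 < W r := fun r hr hrR => by
    refine intervalIntegral.intervalIntegral_pos_of_pos_on
      (Continuous.intervalIntegrable (by fun_prop) _ _) (fun t ht => ?_) hr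
    have := hhpos t ht.1.le (ht.2.le.trans hrR)
    have := ht.1
    positivity
  have hV'pos : ∀ r, 0 < r → r ≤ R + 1 → 0 < r * radialMean D h r := fun r hr hrR => by
    have h1 := hWpos r hr hrR
    rw [hWV] at h1
    exact (mul_pos_iff_of_pos_left (pow_pos hr _)).1 h1
  have hI : ∀ r ∈ Icc r₁ (r₁ + 1), 0 < r ∧ r₀ ≤ r ∧ r ≤ R + 1 := fun r hr =>
    ⟨by linarith [hr.1], by linarith [hr.1], by linarith [hr.2]⟩
  have hVcont : ContinuousOn V (Icc r₁ (r₁ + 1)) := fun r hr =>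
    (hVd r (hI r hr).1.le).continuousAt.continuousWithinAt
  have hVmono : StrictMonoOn V (Icc r₁ (r₁ + 1)) := by
    refine strictMonoOn_of_deriv_pos (convex_Icc _ _) hVcont fun r hr => ?_
    have hr' := hI r (interior_subset hr)
    rw [(hVd r hr'.1.le).deriv]
    exact hV'pos r hr'.1 hr'.2.2
  have hE : MonotoneOn (fun r => W r ^ 2 - 2 * c * F (V r)) (Icc r₁ (r₁ + 1)) := by
    have hd : ∀ r ∈ Icc r₁ (r₁ + 1), HasDerivAt (fun r => W r ^ 2 - 2 * c * F (V r))
        (2 * W r * (r ^ (D - 1) * h r) - 2 * c * (g (V r) * (r * radialMean D h r))) r := by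
      intro r hr
      have h1 := (hgF _ (hVα r (hI r hr).1.le)).comp r (hVd r (hI r hr).1.le)
      have h2 := ((hWd r).pow 2).sub (h1.const_mul (2 * c))
      refine h2.congr_deriv ?_
      norm_num
    refine monotoneOn_of_deriv_nonneg (convex_Icc _ _)
      (fun r hr => (hd r hr).continuousAt.continuousWithinAt)
      (fun r hr => (hd r (interior_subset hr)).differentiableAt.differentiableWithinAt)
      fun r hr => ?_
    have hr' := hI r (interior_subset hr)
    rw [(hd r (interior_subset hr)).deriv, hWV, hht r hr'.1.le hr'.2.2]
    have h1 := (hV'pos r hr'.1 hr'.2.2).le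
    have h2 := (hgpos _ (hVα r hr'.1.le)).le
    have h3 : c ≤ r ^ (D - 1) * r ^ (D - 1) * (κ * p r) := by
      have h4 : p t₀ ≤ p r := ht₀ (show r ∈ Icc 0 (R + 1) from ⟨hr'.1.le, hr'.2.2⟩)
      have h5 := (hp0 t₀).le
      have h6 : r₀ ^ (D - 1) ≤ r ^ (D - 1) := pow_le_pow_left₀ hr₀.le hr'.2.1 _
      have h7 := pow_nonneg hr₀.le (D - 1)
      have h8 := pow_nonneg hr'.1.le (D - 1)
      rw [hc]
      gcongr
    have h4 := mul_nonneg (mul_nonneg h1 h2) (sub_nonneg.2 h3)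
    linarith
  refine hm V (fun r => r * radialMean D h r) r₁ hVm (fun r hr => hVd r (hI r hr).1.le) ?_ ?_
  · intro r hr
    rw [← hVm]
    exact hVmono ⟨le_rfl, by linarith⟩ ⟨hr.1.le, hr.2⟩ hr.1
  · intro r hr
    have hr' := hI r hr
    have h1 := hE ⟨le_rfl, by linarith⟩ hr hr.1
    simp only [hVm] at h1
    have h2 : 2 * c * (F (V r) - F m) ≤ W r ^ 2 := by nlinarith [sq_nonneg (W r₁)]
    have h3 : Real.sqrt (2 * c) * Real.sqrt (F (V r) - F m) ≤ W r := by
      rw [← Real.sqrt_mul (by positivity)]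
      exact (Real.sqrt_le_left (hWpos r hr'.1 hr'.2.2).le).2 h2
    have h4 : W r ≤ (R + 1) ^ (D - 1) * (r * radialMean D h r) := by
      rw [hWV]
      have := (hV'pos r hr'.1 hr'.2.2).le
      exact mul_le_mul_of_nonneg_right (pow_le_pow_left₀ hr'.1.le hr'.2.2 _) this
    rw [div_mul_eq_mul_div, div_le_iff₀ hR1]
    linarith

/-- A radial weight `p` and a nonlinearity `g`, truncated below the level `α`, whose primitive `F`
satisfies the Keller–Osserman condition. -/
structure IsRadialModel (p g F : ℝ → ℝ) (P α b : ℝ) : Prop where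
  continuous_weight : Continuous p
  weight_pos : ∀ t, 0 < p t
  weight_le : ∀ t, p t ≤ P
  contDiff : ContDiff ℝ 1 g
  nonneg : ∀ t, 0 ≤ g t
  eq_zero : ∀ t, t ≤ 0 → g t = 0
  level_pos : 0 < α
  pos : ∀ t, α ≤ t → 0 < g t
  continuous_primitive : Continuous F
  primitive_pos : ∀ s, 0 < s → 0 < F s
  monotoneOn_primitive : MonotoneOn F (Ici 0)
  hasDerivAt_primitive : ∀ s, α ≤ s → HasDerivAt F (g s) s
  base_pos : 0 < b
  integrableOn : IntegrableOn (fun s => 1 / Real.sqrt (F s)) (Ici b)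

/-- `V` is a radial profile with `V 0 = a`, Laplacian `h`, and `0 ≤ h ≤ p g(V)`. -/
structure IsRadialProfile (D : ℕ) (p g : ℝ → ℝ) (a : ℝ) (V h : ℝ → ℝ) : Prop where
  continuous : Continuous V
  continuous_source : Continuous h
  source_nonneg : ∀ t, 0 ≤ h t
  eq : ∀ r, V r = a + radialPotential D h r
  source_le : ∀ t, h t ≤ p t * g (V t)

namespace IsRadialProfile

variable {D : ℕ} {p g V h : ℝ → ℝ} {a : ℝ}

lemma apply_zero (H : IsRadialProfile D p g a V h) : V 0 = a := by simp [H.eq]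

lemma monotoneOn (H : IsRadialProfile D p g a V h) : MonotoneOn V (Ici 0) := by
  intro x hx y hy hxy
  rw [H.eq, H.eq]
  have := radialPotential_mono (D := D) H.continuous_source H.source_nonneg hx hy hxy
  linarith

lemma le_apply (H : IsRadialProfile D p g a V h) {r : ℝ} (hr : 0 ≤ r) : a ≤ V r := by
  rw [← H.apply_zero]
  exact H.monotoneOn (mem_Ici.2 le_rfl) (mem_Ici.2 hr) hr

lemma exists_eq (H : IsRadialProfile D p g a V h) {r y : ℝ} (hr : 0 ≤ r) (ha : a ≤ y)
    (hy : y ≤ V r) : ∃ s, 0 ≤ s ∧ s ≤ r ∧ V s = y := by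
  obtain ⟨s, hs, hsy⟩ := intermediate_value_Icc hr H.continuous.continuousOn
    (show y ∈ Icc (V 0) (V r) from ⟨by rwa [H.apply_zero], hy⟩)
  exact ⟨s, hs.1, hs.2, hsy⟩

end IsRadialProfile

lemma IsRadialModel.exists_radius {D : ℕ} {p g F : ℝ → ℝ} {P α b : ℝ}
    (M : IsRadialModel p g F P α b) (A : ℝ) :
    ∃ r₀, 0 < r₀ ∧ r₀ ≤ 1 ∧ ∀ a V h, IsRadialProfile D p g a V h → 0 ≤ a → a ≤ A →
      ∀ r, 0 ≤ r → r ≤ r₀ → V r ≤ A + 1 := by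
  obtain ⟨C, hC⟩ := (isCompact_Icc (a := (0:ℝ)) (b := A + 1)).exists_bound_of_continuousOn
    M.contDiff.continuous.continuousOn
  have hP : 0 < P := (M.weight_pos 0).trans_le (M.weight_le 0)
  set B := P * |C| + 1 with hB
  have hB1 : 1 ≤ B := by have : 0 ≤ P * |C| := by positivity
                         linarith
  have hB0 : 0 < B := by linarith
  refine ⟨1 / B, by positivity, (div_le_one hB0).2 hB1, fun a V h H ha0 ha r hr0 hr => ?_⟩
  by_contra! hlt
  obtain ⟨s, hs0, hsr, hs⟩ := H.exists_eq hr0 (by linarith) hlt.le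
  have h1 := abs_radialPotential_le (D := D) (h := h) (B := B) hs0 fun t ht0 ht => by
    have hV1 : V t ≤ A + 1 := by rw [← hs]; exact H.monotoneOn ht0 hs0 ht
    have h2 := hC (V t) ⟨ha0.trans (H.le_apply ht0), hV1⟩
    rw [Real.norm_eq_abs] at h2
    rw [abs_of_nonneg (H.source_nonneg t)]
    have h3 := le_abs_self (g (V t))
    have h4 := le_abs_self C
    calc h t ≤ p t * g (V t) := H.source_le t
      _ ≤ P * |C| := by
        gcongr
        · exact M.nonneg _
        · exact M.weight_le t
        · linarith
      _ ≤ B := by linarith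
  have h2 : s ^ 2 ≤ (1 / B) ^ 2 := pow_le_pow_left₀ hs0 (hsr.trans hr) 2
  have h3 : B * s ^ 2 / 2 ≤ 1 / (2 * B) := by
    calc B * s ^ 2 / 2 ≤ B * (1 / B) ^ 2 / 2 := by gcongr
      _ = 1 / (2 * B) := by field_simp
  have h4 : 1 / (2 * B) < 1 := by rw [div_lt_one (by positivity)]; linarith
  have h5 := le_abs_self (radialPotential D h s)
  rw [H.eq] at hs
  linarith

/-- A-priori bound for radial solutions on `[0, R + 1]` in terms of the central value. -/
lemma IsRadialModel.exists_bound {D : ℕ} (hD : 1 ≤ D) {p g F : ℝ → ℝ} {P α b : ℝ}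
    (M : IsRadialModel p g F P α b) (A : ℝ) {R : ℝ} (hR : 1 ≤ R) :
    ∃ m, A + 2 ≤ m ∧ ∀ κ a V h, 1 / 2 ≤ κ → α ≤ a → IsRadialProfile D p g a V h →
      (∀ t, 0 ≤ t → t ≤ R + 1 → h t = κ * (p t * g (V t))) →
      V R ≠ m ∧ (a ≤ A → ∀ r, 0 ≤ r → r ≤ R → V r < m) := by
  obtain ⟨r₀, hr₀, hr₀1, hr₀V⟩ := M.exists_radius (D := D) A
  obtain ⟨m, hm, hmV⟩ := exists_forbidden_level hD M.continuous_weight M.weight_pos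
    M.continuous_primitive M.primitive_pos M.monotoneOn_primitive M.base_pos M.integrableOn
    M.hasDerivAt_primitive M.pos hr₀ (hr₀1.trans hR) (A + 2)
  refine ⟨m, hm, fun κ a V h hκ ha H hh => ?_⟩
  have key := hmV κ hκ a ha V h H.continuous_source H.source_nonneg H.eq hh
  refine ⟨key R (hr₀1.trans hR) le_rfl, fun haA r hr0 hr => ?_⟩
  by_contra! hlt
  obtain ⟨s, hs0, hsr, hs⟩ := H.exists_eq hr0 (by linarith) hlt
  rcases le_total s r₀ with h1 | h1
  · have := hr₀V a V h H (M.level_pos.le.trans ha) haA s hs0 h1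
    linarith
  · exact key s h1 (hsr.trans hr) hs

lemma IsRadialModel.exists_truncation {p g F : ℝ → ℝ} {P α b : ℝ}
    (M : IsRadialModel p g F P α b) (N : ℝ) :
    ∃ (G : ℝ → ℝ) (L : NNReal) (B : ℝ), ContDiff ℝ 1 G ∧ LipschitzWith L G ∧ (∀ t, |G t| ≤ B) ∧
      (∀ t, 0 ≤ G t) ∧ (∀ t, G t ≤ g t) ∧ ∀ t, t ≤ N → G t = g t := by
  set G : ℝ → ℝ := fun t => g t * (1 - Real.smoothTransition (t - N)) with hG
  have hGc : ContDiff ℝ 1 G :=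
    M.contDiff.mul (contDiff_const.sub
      (Real.smoothTransition.contDiff.comp (contDiff_id.sub contDiff_const)))
  have hGs : HasCompactSupport G := by
    refine HasCompactSupport.intro (isCompact_Icc (a := 0) (b := N + 1)) fun t ht => ?_
    rw [mem_Icc, not_and_or, not_le, not_le] at ht
    simp only [hG]
    rcases ht with ht | ht
    · rw [M.eq_zero t ht.le, zero_mul]
    · rw [Real.smoothTransition.one_of_one_le (by linarith), sub_self, mul_zero]
  obtain ⟨L, hL⟩ := ContDiff.lipschitzWith_of_hasCompactSupport hGs hGc one_ne_zero
  obtain ⟨B, hB⟩ := hGc.continuous.bounded_above_of_compact_support hGs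
  refine ⟨G, L, B, hGc, hL, hB, fun t => ?_, fun t => ?_, fun t ht => ?_⟩
  · exact mul_nonneg (M.nonneg t) (sub_nonneg.2 (Real.smoothTransition.le_one _))
  · exact mul_le_of_le_one_right (M.nonneg t)
      (sub_le_self _ (Real.smoothTransition.nonneg _))
  · simp only [hG]
    rw [Real.smoothTransition.zero_of_nonpos (by linarith), sub_zero, mul_one]

/-- For each truncation level there is a family of global radial profiles, indexed by the central
value, depending continuously on it. -/
lemma IsRadialModel.exists_family (D : ℕ) {p g F : ℝ → ℝ} {P α b : ℝ}
    (M : IsRadialModel p g F P α b) (N : ℝ) {κ : ℝ} (hκ0 : 0 ≤ κ) (hκ1 : κ ≤ 1) :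
    ∃ (G : ℝ → ℝ) (V : ℝ → ℝ → ℝ), ContDiff ℝ 1 G ∧ (∀ t, t ≤ N → G t = g t) ∧
      (∃ L : NNReal, LipschitzWith L G) ∧ (∃ B, ∀ t, |G t| ≤ B) ∧
      (∀ a, IsRadialProfile D p g a (V a) (fun t => p t * (κ * G (V a t)))) ∧
      ∀ R, ∃ K, 0 ≤ K ∧ ∀ a a' r, 0 ≤ r → r ≤ R → |V a r - V a' r| ≤ K * |a - a'| := by
  obtain ⟨G, L, B, hGc, hL, hB, hG0, hGg, hGN⟩ := M.exists_truncation N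
  have hκB : ∀ t, |κ * G t| ≤ B := fun t => by
    rw [abs_mul, abs_of_nonneg hκ0]
    exact (mul_le_of_le_one_left (abs_nonneg _) hκ1).trans (hB t)
  have hκL : LipschitzWith L fun t => κ * G t := LipschitzWith.of_dist_le_mul fun x y => by
    rw [Real.dist_eq, ← mul_sub, abs_mul, abs_of_nonneg hκ0]
    exact (mul_le_of_le_one_left (abs_nonneg _) hκ1).trans (hL.dist_le_mul x y)
  have hpP : ∀ t, |p t| ≤ P := fun t => by
    rw [abs_of_pos (M.weight_pos t)]; exact M.weight_le t
  have hP : 0 ≤ P := (abs_nonneg _).trans (hpP 0)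
  choose V hVc hV using fun a => exists_radial_solution D M.continuous_weight hpP hκL hκB a
  have hpc := M.continuous_weight
  have hGc' := hGc.continuous
  have hsc : ∀ a, Continuous fun t => p t * (κ * G (V a t)) := fun a => by
    have := hVc a; fun_prop
  refine ⟨G, V, hGc, hGN, ⟨L, hL⟩, ⟨B, hB⟩, fun a => ⟨hVc a, hsc a, fun t => ?_, hV a,
    fun t => ?_⟩, fun R => ⟨2 * Real.exp ((P * L + 1) * R ^ 2), by positivity,
      fun a a' r hr0 hr => ?_⟩⟩
  · exact mul_nonneg (M.weight_pos t).le (mul_nonneg hκ0 (hG0 _))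
  · refine mul_le_mul_of_nonneg_left ?_ (M.weight_pos t).le
    exact (mul_le_of_le_one_left (hG0 _) hκ1).trans (hGg _)
  · have h1 := radial_stability (D := D) (R := R) (C := P * L) (ε := 0) (hVc a) (hVc a')
      (hsc a) (hsc a') (by positivity) le_rfl (fun r _ _ => hV a r) (fun r _ _ => hV a' r)
      (fun r _ _ => by
        rw [← mul_sub, abs_mul, zero_add, mul_assoc]
        exact mul_le_mul (hpP r) (hκL.dist_le_mul _ _) (abs_nonneg _) hP) hr0 hr
    linarith

/-- There are truncated radial profiles with bounded central value exceeding any level `N` outside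
the ball of radius `2`. -/
lemma IsRadialModel.exists_large_profile {D : ℕ} (hD : 1 ≤ D) {p g F : ℝ → ℝ} {P α b : ℝ}
    (M : IsRadialModel p g F P α b) {A : ℝ} (hA : α ≤ A) :
    ∃ m, A ≤ m ∧ ∀ (κ N : ℝ) (G : ℝ → ℝ) (V : ℝ → ℝ → ℝ), 1 / 2 ≤ κ → m < N →
      (∀ t, t ≤ N → G t = g t) →
      (∀ a, IsRadialProfile D p g a (V a) (fun t => p t * (κ * G (V a t)))) →
      Continuous (fun a => V a 1) → ∃ a, A ≤ a ∧ a ≤ m ∧ N < V a 2 := by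
  obtain ⟨m, hm, hmV⟩ := M.exists_bound hD A le_rfl
  refine ⟨m, by linarith, fun κ N G V hκ hN hG H hc => ?_⟩
  have htrue : ∀ a, V a 2 ≤ N → ∀ t, 0 ≤ t → t ≤ 1 + 1 →
      p t * (κ * G (V a t)) = κ * (p t * g (V a t)) := fun a ha t ht0 ht => by
    have h1 : V a t ≤ V a 2 := (H a).monotoneOn ht0 (mem_Ici.2 (by norm_num)) (by linarith)
    rw [hG _ (h1.trans ha)]
    ring
  by_cases hlt : N < V A 2
  · exact ⟨A, le_rfl, by linarith, hlt⟩
  · have h1 := (hmV κ A (V A) _ hκ hA (H A) (htrue A (not_lt.1 hlt))).2 le_rfl 1 zero_le_one le_rfl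
    have h2 : m ≤ V m 1 := (H m).le_apply zero_le_one
    obtain ⟨a, ha, ham⟩ := intermediate_value_Icc (show A ≤ m by linarith) hc.continuousOn
      (show m ∈ Icc (V A 1) (V m 1) from ⟨h1.le, h2⟩)
    refine ⟨a, ha.1, ha.2, ?_⟩
    by_contra! hle
    exact (hmV κ a (V a) _ hκ (hA.trans ha.1) (H a) (htrue a hle)).1 ham

/-- On every ball a subsolution is dominated by a radial solution with slightly decreased
coefficient, whose central value is bounded independently of the ball. -/
lemma IsRadialModel.exists_dominating {D : ℕ} (hD : 1 ≤ D) {p g F : ℝ → ℝ} {P α b : ℝ}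
    (M : IsRadialModel p g F P α b) {ρ u : EuclideanSpace ℝ (Fin D) → ℝ} (hρ : ContDiff ℝ 1 ρ)
    (hρp : ∀ x, ρ x = p ‖x‖) (hu : ContDiff ℝ 2 u) (hu0 : α ≤ u 0)
    (hsub : ∀ x, α ≤ u x → p ‖x‖ * g (u x) ≤ laplacian u x) :
    ∃ m, ∀ κ n : ℝ, 1 / 2 ≤ κ → κ < 1 → 0 ≤ n →
      ∃ a V h, α ≤ a ∧ a ≤ m ∧ IsRadialProfile D p g a V h ∧
        (∀ t, 0 ≤ t → t ≤ n → h t = κ * (p t * g (V t))) ∧ ∀ x, ‖x‖ ≤ n → u x ≤ V ‖x‖ := by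
  have hbdd : ∀ n : ℝ, ∃ C, ∀ x : EuclideanSpace ℝ (Fin D), ‖x‖ ≤ n → u x ≤ C := fun n => by
    obtain ⟨C, hC⟩ := (isCompact_closedBall (0 : EuclideanSpace ℝ (Fin D)) n).exists_bound_of_continuousOn
      hu.continuous.continuousOn
    exact ⟨C, fun x hx => (le_abs_self _).trans (hC x (by simpa using hx))⟩
  obtain ⟨A₀, hA₀⟩ := hbdd 2
  have hαA : α ≤ A₀ := hu0.trans (hA₀ 0 (by simp))
  obtain ⟨m, hm, hmV⟩ := M.exists_large_profile hD hαA
  refine ⟨m, fun κ n hκ hκ1 hn => ?_⟩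
  obtain ⟨C, hC⟩ := hbdd n
  set N := max (m + 1) C with hN
  obtain ⟨G, V, hGc, hGN, -, -, H, hK⟩ := M.exists_family D N (by linarith) hκ1.le
  obtain ⟨K, hK0, hK⟩ := hK (max n 1)
  have hcont : ∀ r, 0 ≤ r → r ≤ max n 1 → Continuous fun a => V a r := fun r hr0 hr =>
    (LipschitzWith.of_dist_le_mul (K := ⟨K, hK0⟩) fun a a' => hK a a' r hr0 hr).continuous
  obtain ⟨A, hA₀A, hAm, hAN⟩ := hmV κ N G V hκ (lt_of_lt_of_le (by linarith) (le_max_left _ _)) hGN H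
    (hcont 1 zero_le_one (le_max_right _ _))
  set S : Set ℝ := Icc α A ∩ {a | ∀ x : EuclideanSpace ℝ (Fin D), ‖x‖ ≤ n → u x ≤ V a ‖x‖} with hS
  have hSc : IsCompact S := by
    refine isCompact_Icc.inter_right ?_
    simp only [Set.ofPred_forall]
    exact isClosed_iInter fun x => isClosed_iInter fun hx =>
      isClosed_le continuous_const (hcont _ (norm_nonneg x) (hx.trans (le_max_left _ _)))
  have hAS : A ∈ S := by
    refine ⟨⟨hαA.trans hA₀A, le_rfl⟩, fun x hx => ?_⟩
    rcases le_total ‖x‖ 2 with h2 | h2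
    · exact (hA₀ x h2).trans (hA₀A.trans ((H A).le_apply (norm_nonneg x)))
    · exact ((hC x hx).trans (le_max_right _ _)).trans (hAN.le.trans
        ((H A).monotoneOn (mem_Ici.2 (by norm_num)) (norm_nonneg x) h2))
  obtain ⟨a, ⟨⟨hαa, haA⟩, haS⟩, hleast⟩ := hSc.exists_isLeast ⟨A, hAS⟩
  have hVc := (H a).continuous
  have huc := hu.continuous
  obtain ⟨x₀, hx₀, hmin⟩ := (isCompact_closedBall (0 : EuclideanSpace ℝ (Fin D)) n).exists_isMinOn
    ⟨0, by simpa using hn⟩ (f := fun x => V a ‖x‖ - u x) (Continuous.continuousOn (by fun_prop))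
  have hx₀n : ‖x₀‖ ≤ n := by simpa using hx₀
  have htouch : V a ‖x₀‖ = u x₀ := by
    refine le_antisymm ?_ (haS x₀ hx₀n)
    by_contra! hlt
    set δ := V a ‖x₀‖ - u x₀ with hδ
    have hδ0 : 0 < δ := by linarith
    have hδx : ∀ x : EuclideanSpace ℝ (Fin D), ‖x‖ ≤ n → δ ≤ V a ‖x‖ - u x := fun x hx =>
      hmin (show x ∈ Metric.closedBall 0 n by simpa using hx)
    have hα : α < a := by
      have h1 := hδx 0 (by simpa using hn)
      rw [norm_zero, (H a).apply_zero] at h1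
      linarith
    set a' := max α (a - δ / (K + 1)) with ha'
    have hq : 0 < δ / (K + 1) := by positivity
    have ha'a : a' < a := max_lt hα (by linarith)
    have hdist : |a - a'| ≤ δ / (K + 1) := by
      rw [abs_of_pos (by linarith)]
      linarith [le_max_right α (a - δ / (K + 1))]
    have : a' ∈ S := by
      refine ⟨⟨le_max_left _ _, ha'a.le.trans haA⟩, fun x hx => ?_⟩
      have h1 := hK a a' ‖x‖ (norm_nonneg x) (hx.trans (le_max_left _ _))
      have h2 : K * |a - a'| ≤ δ := by
        calc K * |a - a'| ≤ (K + 1) * (δ / (K + 1)) := by gcongr; linarith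
          _ = δ := by field_simp
      have h3 := hδx x hx
      linarith [(abs_le.1 h1).2]
    exact absurd (hleast this) (not_le.2 ha'a)
  have hVN : V a ‖x₀‖ ≤ N := by rw [htouch]; exact (hC x₀ hx₀n).trans (le_max_right _ _)
  have hboundary : ‖x₀‖ = n := by
    refine le_antisymm hx₀n ?_
    by_contra! hlt
    have hκG : ContDiff ℝ 1 fun t => κ * G t := contDiff_const.mul hGc
    obtain ⟨hv, hlap⟩ := contDiff_and_laplacian_of_radial hD hρ M.continuous_weight hρp hκG hVc
      (H a).eq
    have hnhds : Metric.closedBall (0 : EuclideanSpace ℝ (Fin D)) n ∈ nhds x₀ :=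
      Metric.closedBall_mem_nhds_of_mem (by simpa using hlt)
    have h1 := laplacian_le_of_isLocalMin hu hv (hmin.isLocalMin hnhds)
    have hαu : α ≤ u x₀ := by
      rw [← htouch]
      exact hαa.trans ((H a).le_apply (norm_nonneg _))
    rw [hlap, hGN _ hVN, htouch, hρp] at h1
    have h2 := hsub x₀ hαu
    have h3 := mul_pos (M.weight_pos ‖x₀‖) (M.pos _ hαu)
    nlinarith
  refine ⟨a, V a, _, hαa, haA.trans hAm, H a, fun t ht0 ht => ?_, haS⟩
  have h1 : V a t ≤ N :=
    ((H a).monotoneOn ht0 (norm_nonneg x₀) (ht.trans hboundary.ge)).trans hVN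
  simp only [hGN _ h1]
  ring

lemma Filter.EventuallyEq.laplacian_eq {D : ℕ} {v w : EuclideanSpace ℝ (Fin D) → ℝ}
    {x : EuclideanSpace ℝ (Fin D)} (h : v =ᶠ[nhds x] w) : laplacian v x = laplacian w x := by
  unfold laplacian
  refine Finset.sum_congr rfl fun i _ => ?_
  have h1 : (fun y => fderiv ℝ v y (EuclideanSpace.single i 1)) =ᶠ[nhds x]
      fun y => fderiv ℝ w y (EuclideanSpace.single i 1) := by
    filter_upwards [h.fderiv (𝕜 := ℝ)] with y hy
    rw [hy]
  rw [h1.fderiv_eq]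

/-- A sequence of radial solutions with coefficients tending to `1`, defined on growing balls, with
convergent and uniformly bounded central values converges on every bounded interval to a profile
of the limit equation. -/
lemma IsRadialModel.exists_limit {D : ℕ} (hD : 1 ≤ D) {p g F : ℝ → ℝ} {P α b : ℝ}
    (M : IsRadialModel p g F P α b) {κ a : ℕ → ℝ} {V h : ℕ → ℝ → ℝ} {m a₀ : ℝ}
    (hκ : ∀ k, 1 / 2 ≤ κ k) (hκ1 : ∀ k, κ k < 1) (hκlim : Tendsto κ atTop (nhds 1))
    (ha : ∀ k, α ≤ a k) (ham : ∀ k, a k ≤ m) (halim : Tendsto a atTop (nhds a₀))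
    (H : ∀ k, IsRadialProfile D p g (a k) (V k) (h k))
    {ν : ℕ → ℝ} (hν : Tendsto ν atTop atTop)
    (hh : ∀ k t, 0 ≤ t → t ≤ ν k → h k t = κ k * (p t * g (V k t))) {R : ℝ} (hR : 1 ≤ R) :
    ∃ (G Y : ℝ → ℝ), ContDiff ℝ 1 G ∧ Continuous Y ∧
      (∀ r, Y r = a₀ + radialPotential D (fun t => p t * G (Y t)) r) ∧
      ∀ r, 0 ≤ r → r ≤ R → α ≤ Y r ∧ G (Y r) = g (Y r) ∧
        Tendsto (fun k => V k r) atTop (nhds (Y r)) := by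
  obtain ⟨N, -, hN⟩ := M.exists_bound hD m hR
  obtain ⟨G, L, B, hGc, hL, hB, -, -, hGN⟩ := M.exists_truncation N
  have hpP : ∀ t, |p t| ≤ P := fun t => by
    rw [abs_of_pos (M.weight_pos t)]; exact M.weight_le t
  have hP : 0 ≤ P := (abs_nonneg _).trans (hpP 0)
  have hB0 : 0 ≤ B := (abs_nonneg _).trans (hB 0)
  obtain ⟨Y, hYc, hY⟩ := exists_radial_solution D M.continuous_weight hpP hL hB a₀
  have hpc := M.continuous_weight
  have hGc' := hGc.continuous
  have hev : ∀ᶠ k in atTop, R + 1 ≤ ν k := hν.eventually_ge_atTop _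
  have hVN : ∀ k, R + 1 ≤ ν k → ∀ r, 0 ≤ r → r ≤ R → V k r < N := fun k hk =>
    (hN (κ k) (a k) (V k) (h k) (hκ k) (ha k) (H k) fun t ht0 ht => hh k t ht0 (ht.trans hk)).2
      (ham k)
  have hlim : ∀ r, 0 ≤ r → r ≤ R → Tendsto (fun k => V k r) atTop (nhds (Y r)) := by
    intro r hr0 hr
    have hb : Tendsto (fun k => (2 * |a k - a₀| + P * B * (1 - κ k)) *
        Real.exp ((P * L + 1) * R ^ 2)) atTop (nhds 0) := by
      have h1 : Tendsto (fun k => |a k - a₀|) atTop (nhds 0) := by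
        simpa using (halim.sub_const a₀).abs
      have h2 : Tendsto (fun k => 1 - κ k) atTop (nhds 0) := by
        simpa using hκlim.const_sub 1
      simpa using ((h1.const_mul 2).add (h2.const_mul (P * B))).mul_const
        (Real.exp ((P * L + 1) * R ^ 2))
    rw [tendsto_iff_dist_tendsto_zero]
    refine squeeze_zero' (Eventually.of_forall fun _ => dist_nonneg) ?_ hb
    filter_upwards [hev] with k hk
    rw [Real.dist_eq]
    refine radial_stability (D := D) (R := R) (C := P * L) (H k).continuous hYc
      (H k).continuous_source (h₂ := fun t => p t * G (Y t)) (by fun_prop) (by positivity)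
      (mul_nonneg (mul_nonneg hP hB0) (by linarith [hκ1 k])) (fun r _ _ => (H k).eq r)
      (fun r _ _ => hY r) (fun t ht0 ht => ?_) hr0 hr
    rw [hh k t ht0 (by linarith), ← hGN _ (hVN k hk t ht0 ht).le]
    have h1 : κ k * (p t * G (V k t)) - p t * G (Y t)
        = -(p t * G (V k t) * (1 - κ k)) + p t * (G (V k t) - G (Y t)) := by ring
    rw [h1]
    refine (abs_add_le _ _).trans (add_le_add ?_ ?_)
    · rw [abs_neg, abs_mul, abs_mul, abs_of_pos (show 0 < 1 - κ k by linarith [hκ1 k])]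
      exact mul_le_mul_of_nonneg_right (mul_le_mul (hpP t) (hB _) (abs_nonneg _) hP)
        (by linarith [hκ1 k])
    · rw [abs_mul, mul_assoc]
      exact mul_le_mul (hpP t) (hL.dist_le_mul _ _) (abs_nonneg _) hP
  refine ⟨G, Y, hGc, hYc, hY, fun r hr0 hr => ⟨?_, hGN _ ?_, hlim r hr0 hr⟩⟩
  · exact ge_of_tendsto' (hlim r hr0 hr) fun k => (ha k).trans ((H k).le_apply hr0)
  · refine le_of_tendsto (hlim r hr0 hr) ?_
    filter_upwards [hev] with k hk
    exact (hVN k hk r hr0 hr).le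

lemma IsRadialModel.exists_entire_radial {D : ℕ} (hD : 1 ≤ D) {p g F : ℝ → ℝ} {P α b : ℝ}
    (M : IsRadialModel p g F P α b) {ρ u : EuclideanSpace ℝ (Fin D) → ℝ} (hρ : ContDiff ℝ 1 ρ)
    (hρp : ∀ x, ρ x = p ‖x‖) (hu : ContDiff ℝ 2 u) (hu0 : α ≤ u 0)
    (hsub : ∀ x, α ≤ u x → p ‖x‖ * g (u x) ≤ laplacian u x) :
    ∃ v : EuclideanSpace ℝ (Fin D) → ℝ, ContDiff ℝ 2 v ∧ (∀ x, α ≤ v x) ∧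
      (∀ x, laplacian v x = ρ x * g (v x)) ∧ (∀ x y, ‖x‖ = ‖y‖ → v x = v y) ∧
      ∀ x, u x ≤ v x := by
  obtain ⟨m, hm⟩ := M.exists_dominating hD hρ hρp hu hu0 hsub
  set κ : ℕ → ℝ := fun k => 1 - 1 / ((k : ℝ) + 2) with hκdef
  have hκ : ∀ k, 1 / 2 ≤ κ k := fun k => by
    have : 1 / ((k : ℝ) + 2) ≤ 1 / 2 :=
      one_div_le_one_div_of_le two_pos (by linarith [(Nat.cast_nonneg k : (0:ℝ) ≤ k)])
    simp only [hκdef]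
    linarith
  have hκ1 : ∀ k, κ k < 1 := fun k => sub_lt_self _ (by positivity)
  have hκlim : Tendsto κ atTop (nhds 1) := by
    have h1 : Tendsto (fun k : ℕ => 1 / ((k : ℝ) + 2)) atTop (nhds 0) := by
      simp only [one_div]
      exact (tendsto_natCast_atTop_atTop.atTop_add tendsto_const_nhds).inv_tendsto_atTop
    have h2 := h1.const_sub 1
    rwa [sub_zero] at h2
  choose a V h ha ham H hh hV using fun k : ℕ => hm (κ k) k (hκ k) (hκ1 k) (Nat.cast_nonneg k)
  obtain ⟨a₀, -, φ, hφ, hlim⟩ := isCompact_Icc.tendsto_subseq fun k => (⟨ha k, ham k⟩ : a k ∈ Icc α m)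
  choose G Y hG hYc hY hprop using fun j : ℕ => M.exists_limit (κ := κ ∘ φ) (a := a ∘ φ)
    (V := V ∘ φ) (h := h ∘ φ) (ν := fun k => (φ k : ℝ)) hD (fun k => hκ _) (fun k => hκ1 _)
    (hκlim.comp hφ.tendsto_atTop) (fun k => ha _) (fun k => ham _) hlim (fun k => H _)
    (tendsto_natCast_atTop_atTop.comp hφ.tendsto_atTop) (fun k => hh _)
    (R := (j : ℝ) + 1) (by linarith [(Nat.cast_nonneg j : (0:ℝ) ≤ j)])
  set v : EuclideanSpace ℝ (Fin D) → ℝ := fun x => Y ⌈‖x‖⌉₊ ‖x‖ with hv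
  have hceil : ∀ x : EuclideanSpace ℝ (Fin D), ‖x‖ ≤ (⌈‖x‖⌉₊ : ℝ) + 1 := fun x =>
    (Nat.le_ceil _).trans (by linarith)
  have hagree : ∀ (j : ℕ) (x : EuclideanSpace ℝ (Fin D)), ‖x‖ ≤ (j : ℝ) + 1 → v x = Y j ‖x‖ :=
    fun j x hx => tendsto_nhds_unique (hprop _ _ (norm_nonneg x) (hceil x)).2.2
      (hprop j _ (norm_nonneg x) hx).2.2
  have hlocal : ∀ x : EuclideanSpace ℝ (Fin D), v =ᶠ[nhds x] fun y => Y ⌈‖x‖⌉₊ ‖y‖ := fun x => by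
    have hlt : ‖x‖ < (⌈‖x‖⌉₊ : ℝ) + 1 := (Nat.le_ceil _).trans_lt (by linarith)
    filter_upwards [continuous_norm.continuousAt.eventually_lt continuousAt_const hlt] with y hy
    exact hagree _ y hy.le
  have hsol := fun j : ℕ => contDiff_and_laplacian_of_radial hD hρ M.continuous_weight hρp (hG j)
    (hYc j) (hY j)
  refine ⟨v, contDiff_iff_contDiffAt.2 fun x => ?_, fun x => ?_, fun x => ?_, fun x y hxy => ?_,
    fun x => ?_⟩
  · exact (hsol _).1.contDiffAt.congr_of_eventuallyEq (hlocal x)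
  · exact (hprop _ _ (norm_nonneg x) (hceil x)).1
  · rw [(hlocal x).laplacian_eq, (hsol _).2, (hprop _ _ (norm_nonneg x) (hceil x)).2.1]
  · simp only [hv, hxy]
  · refine ge_of_tendsto (hprop _ _ (norm_nonneg x) (hceil x)).2.2 ?_
    have h1 : Tendsto (fun k => (φ k : ℝ)) atTop atTop :=
      tendsto_natCast_atTop_atTop.comp hφ.tendsto_atTop
    filter_upwards [h1.eventually_ge_atTop ‖x‖] with k hk
    exact hV _ x hk

/-- Smooth truncation of `f` below the level `α`. -/
noncomputable def lowerTruncation (f : ℝ → ℝ) (α t : ℝ) : ℝ :=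
  f t * Real.smoothTransition (2 * t / α - 1)

lemma lowerTruncation_of_le {f : ℝ → ℝ} {α t : ℝ} (hα : 0 < α) (ht : α ≤ t) :
    lowerTruncation f α t = f t := by
  have : 1 ≤ t / α := (one_le_div hα).2 ht
  rw [lowerTruncation, Real.smoothTransition.one_of_one_le (by rw [mul_div_assoc]; linarith),
    mul_one]

lemma lowerTruncation_of_le_half {f : ℝ → ℝ} {α t : ℝ} (hα : 0 < α) (ht : t ≤ α / 2) :
    lowerTruncation f α t = 0 := by
  have : 2 * t / α ≤ 1 := (div_le_one hα).2 (by linarith)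
  rw [lowerTruncation, Real.smoothTransition.zero_of_nonpos (by linarith), mul_zero]

lemma contDiff_lowerTruncation {f : ℝ → ℝ} (hf : ContDiffOn ℝ 1 f (Ici 0)) {α : ℝ} (hα : 0 < α) :
    ContDiff ℝ 1 (lowerTruncation f α) := by
  refine contDiff_iff_contDiffAt.2 fun t => ?_
  rcases lt_or_ge 0 t with ht | ht
  · have h1 : ContDiff ℝ 1 fun t : ℝ => Real.smoothTransition (2 * t / α - 1) :=
      Real.smoothTransition.contDiff.comp
        (((contDiff_const.mul contDiff_id).div_const α).sub contDiff_const)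
    exact (hf.contDiffAt (Ici_mem_nhds ht)).mul h1.contDiffAt
  · refine (contDiffAt_const (c := (0:ℝ))).congr_of_eventuallyEq ?_
    filter_upwards [Iio_mem_nhds (show t < α / 2 by linarith)] with s hs
    exact lowerTruncation_of_le_half hα (le_of_lt hs)

lemma isRadialModel_lowerTruncation {p f : ℝ → ℝ} {P α b : ℝ} (hp : Continuous p)
    (hp0 : ∀ t, 0 < p t) (hpP : ∀ t, p t ≤ P) (hf : ContDiffOn ℝ 1 f (Ici 0))
    (hfpos : ∀ t, 0 < t → 0 < f t) (hα : 0 < α) (hb : 0 < b)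
    (hKO : IntegrableOn (fun s => 1 / Real.sqrt (∫ t in (0:ℝ)..s, f t)) (Ici b)) :
    IsRadialModel p (lowerTruncation f α) (fun s => ∫ t in (0:ℝ)..s, f (max t 0)) P α b := by
  have hc : Continuous fun t => f (max t 0) :=
    hf.continuousOn.comp_continuous (by fun_prop) fun t => le_max_right t 0
  have hd : ∀ s, HasDerivAt (fun s => ∫ t in (0:ℝ)..s, f (max t 0)) (f (max s 0)) s := fun s =>
    (hc.integral_hasStrictDerivAt 0 s).hasDerivAt
  have hFc : Continuous fun s => ∫ t in (0:ℝ)..s, f (max t 0) :=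
    continuous_iff_continuousAt.2 fun s => (hd s).continuousAt
  refine ⟨hp, hp0, hpP, contDiff_lowerTruncation hf hα, fun t => ?_, fun t ht => ?_, hα,
    fun t ht => ?_, hFc, fun s hs => ?_, ?_, fun s hs => ?_, hb, ?_⟩
  · rcases le_or_gt t (α / 2) with ht | ht
    · rw [lowerTruncation_of_le_half hα ht]
    · exact mul_nonneg (hfpos t (by linarith)).le (Real.smoothTransition.nonneg _)
  · exact lowerTruncation_of_le_half hα (by linarith)
  · rw [lowerTruncation_of_le hα ht]
    exact hfpos t (hα.trans_le ht)
  · refine intervalIntegral.intervalIntegral_pos_of_pos_on (hc.intervalIntegrable _ _)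
      (fun t ht => hfpos _ (lt_max_of_lt_left ht.1)) hs
  · refine monotoneOn_of_deriv_nonneg (convex_Ici 0) hFc.continuousOn
      (fun s _ => (hd s).differentiableAt.differentiableWithinAt) fun s hs => ?_
    rw [interior_Ici] at hs
    rw [(hd s).deriv]
    exact (hfpos _ (lt_max_of_lt_left hs)).le
  · have h1 := hd s
    rwa [max_eq_left (hα.le.trans hs), ← lowerTruncation_of_le (f := f) hα hs] at h1
  · refine hKO.congr_fun (fun s hs => ?_) measurableSet_Ici
    have hs0 : 0 ≤ s := hb.le.trans hs
    have : ∫ t in (0:ℝ)..s, f t = ∫ t in (0:ℝ)..s, f (max t 0) := by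
      refine intervalIntegral.integral_congr fun t ht => ?_
      rw [uIcc_of_le hs0] at ht
      simp only [max_eq_left ht.1]
    simp only [this]

/-- (Sandwich lemma.) Under (SA) with `ρ` radially symmetric and
radially nonincreasing, every positive subsolution is dominated by some radially
symmetric solution of `Δu = ρ f(u)`, `u > 0`. -/
theorem stmt10 (D : ℕ) (hD : 3 ≤ D)
    (f : ℝ → ℝ) (ρ : EuclideanSpace ℝ (Fin D) → ℝ)
    (hf : ContDiffOn ℝ 1 f (Ici 0)) (hf0 : f 0 = 0)
    (hfpos : ∀ t : ℝ, 0 < t → 0 < f t)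
    (hKO : ∃ b : ℝ, 0 < b ∧
      IntegrableOn (fun s => 1 / Real.sqrt (∫ t in (0:ℝ)..s, f t)) (Ici b))
    (hρ : ContDiff ℝ 1 ρ) (hρpos : ∀ x, 0 < ρ x)
    (hHρ : Tendsto (fun x : EuclideanSpace ℝ (Fin D) =>
      ∫ y : EuclideanSpace ℝ (Fin D), ‖x - y‖ ^ (2 - (D:ℝ)) * ρ y) (cocompact _) (nhds 0))
    (ρ₀ : ℝ → ℝ) (hρ₀ : ∀ x, ρ x = ρ₀ ‖x‖) (hρ₀pos : ∀ r : ℝ, 0 ≤ r → 0 < ρ₀ r)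
    (hρ₀anti : AntitoneOn ρ₀ (Ici 0))
    (u : EuclideanSpace ℝ (Fin D) → ℝ)
    (hu : ContDiff ℝ 2 u) (hupos : ∀ x, 0 < u x)
    (husub : ∀ x, ρ₀ ‖x‖ * f (u x) ≤ laplacian u x) :
    ∃ v : EuclideanSpace ℝ (Fin D) → ℝ,
      ContDiff ℝ 2 v ∧ (∀ x, 0 < v x) ∧
      (∀ x, laplacian v x = ρ x * f (v x)) ∧
      (∀ x y : EuclideanSpace ℝ (Fin D), ‖x‖ = ‖y‖ → v x = v y) ∧
      (∀ x, u x ≤ v x) := by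
  obtain ⟨b, hb, hint⟩ := hKO
  set e : EuclideanSpace ℝ (Fin D) := EuclideanSpace.single ⟨0, by omega⟩ 1 with he
  have hnorm : ∀ t : ℝ, ‖t • e‖ = |t| := fun t => by simp [he, norm_smul]
  have hρc := hρ.continuous
  have hρp : ∀ x : EuclideanSpace ℝ (Fin D), ρ x = ρ (‖x‖ • e) := fun x => by
    rw [hρ₀, hρ₀ (‖x‖ • e), hnorm, abs_norm]
  have hρP : ∀ t : ℝ, ρ (t • e) ≤ ρ₀ 0 := fun t => by
    rw [hρ₀]
    exact hρ₀anti (mem_Ici.2 le_rfl) (norm_nonneg _) (norm_nonneg _)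
  have hα := hupos 0
  obtain ⟨v, hv, hvα, hlap, hrad, huv⟩ := (isRadialModel_lowerTruncation
    (p := fun t : ℝ => ρ (t • e)) (by fun_prop) (fun t => hρpos _) hρP hf hfpos hα hb
    hint).exists_entire_radial (D := D) (by omega) hρ hρp hu le_rfl fun x hx => by
      rw [lowerTruncation_of_le hα hx, ← hρp, hρ₀]
      exact husub x
  refine ⟨v, hv, fun x => hα.trans_le (hvα x), fun x => ?_, hrad, huv⟩
  rw [hlap, lowerTruncation_of_le hα (hvα x)]
end

section
/- Let K < 1 be a real number, a > 0, f : [a, +∞) → (0, +∞) continuous. For i = 1, 2, let V_i : [a, +∞) → (0, +∞) be C¹ with ∫_a^{+∞} ds/V_i(s) < +∞, set t_i(v) = ∫_v^{+∞} ds/V_i(s), and assume V_i(v) V_i'(v) − K V_i(v)/t_i(v) = f(v) for all v ≥ a. If t₁(v) ≤ t₂(v) for all v ≥ a, then there exists v₀ ≥ a such that V₂(v) ≤ V₁(v) for all v ≥ v₀. -/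
open MeasureTheory Filter Set

/-- Strict comparison of the tail-integral increments of `g` and `h` when `h < g` on `(x, y)`. -/
theorem integral_Ioi_add_integral_Ioi_lt {g h : ℝ → ℝ} {x y : ℝ} (hxy : x < y)
    (hg : IntegrableOn g (Ioi x)) (hh : IntegrableOn h (Ioi x))
    (hlt : ∀ s ∈ Ioo x y, h s < g s) :
    (∫ s in Ioi x, h s) + ∫ s in Ioi y, g s < (∫ s in Ioi x, g s) + ∫ s in Ioi y, h s := by
  have hgi : IntervalIntegrable g volume x y :=
    (intervalIntegrable_iff_integrableOn_Ioc_of_le hxy.le).2 (hg.mono_set Ioc_subset_Ioi_self)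
  have hhi : IntervalIntegrable h volume x y :=
    (intervalIntegrable_iff_integrableOn_Ioc_of_le hxy.le).2 (hh.mono_set Ioc_subset_Ioi_self)
  have hpos : 0 < ∫ s in x..y, (g s - h s) :=
    intervalIntegral.intervalIntegral_pos_of_pos_on (hgi.sub hhi)
      (fun s hs => sub_pos.2 (hlt s hs)) hxy
  rw [intervalIntegral.integral_sub hgi hhi] at hpos
  have h₁ := intervalIntegral.integral_interval_add_Ioi hg
    (hg.mono_set (Ioi_subset_Ioi hxy.le))
  have h₂ := intervalIntegral.integral_interval_add_Ioi hh
    (hh.mono_set (Ioi_subset_Ioi hxy.le))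
  linarith

/-- A strict inequality between integrable functions on a half-line passes to the integrals. -/
theorem integral_Ioi_lt_integral_Ioi {g h : ℝ → ℝ} {x : ℝ}
    (hg : IntegrableOn g (Ioi x)) (hh : IntegrableOn h (Ioi x))
    (hlt : ∀ s ∈ Ioi x, h s < g s) :
    ∫ s in Ioi x, h s < ∫ s in Ioi x, g s := by
  have hx : x < x + 1 := lt_add_one x
  have h₁ := integral_Ioi_add_integral_Ioi_lt hx hg hh fun s hs => hlt s hs.1
  have h₂ : ∫ s in Ioi (x + 1), h s ≤ ∫ s in Ioi (x + 1), g s :=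
    setIntegral_mono_on (hh.mono_set (Ioi_subset_Ioi hx.le))
      (hg.mono_set (Ioi_subset_Ioi hx.le)) measurableSet_Ioi
      fun s hs => (hlt s (hx.trans hs)).le
  linarith

/-- A function which is nonpositive at `x` and has nonpositive derivative wherever it is positive
stays nonpositive. -/
theorem nonpos_of_hasDerivAt_nonpos_of_pos {W W' : ℝ → ℝ} {x y : ℝ} (hxy : x ≤ y)
    (hW : ∀ s ∈ Icc x y, HasDerivAt W (W' s) s) (hx : W x ≤ 0)
    (hW' : ∀ s ∈ Icc x y, 0 < W s → W' s ≤ 0) : W y ≤ 0 := by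
  have hc : ContinuousOn W (Icc x y) := fun s hs => (hW s hs).continuousAt.continuousWithinAt
  have hclosed : IsClosed (Icc x y ∩ W ⁻¹' Iic 0) := hc.preimage_isClosed_of_isClosed
    isClosed_Icc isClosed_Iic
  obtain ⟨s, ⟨hs, hWs⟩, hmax⟩ := (isCompact_Icc.of_isClosed_subset hclosed
    inter_subset_left).exists_isGreatest ⟨x, left_mem_Icc.2 hxy, hx⟩
  have hsub : Icc s y ⊆ Icc x y := Icc_subset_Icc_left hs.1
  have hanti : AntitoneOn W (Icc s y) := by
    refine antitoneOn_of_deriv_nonpos (convex_Icc s y) (hc.mono hsub)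
      (fun r hr => (hW r (hsub (interior_subset hr))).differentiableAt.differentiableWithinAt)
      fun r hr => ?_
    have hr' := hsub (interior_subset hr)
    rw [(hW r hr').deriv]
    rw [interior_Icc] at hr
    refine hW' r hr' (not_le.1 fun hle => ?_)
    exact (hmax ⟨hr', hle⟩).not_gt hr.1
  exact (hanti (left_mem_Icc.2 hs.2) (right_mem_Icc.2 hs.2) hs.2).trans hWs

/-- If `W` is positive at `x` and nonpositive at `y`, there is a first point after `x` at which `W`
is nonpositive, and the derivative there is nonpositive. -/
theorem exists_first_nonpos {W W' : ℝ → ℝ} {x y : ℝ} (hxy : x ≤ y)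
    (hW : ∀ s ∈ Icc x y, HasDerivAt W (W' s) s) (hx : 0 < W x) (hy : W y ≤ 0) :
    ∃ w ∈ Ioc x y, (∀ s ∈ Ico x w, 0 < W s) ∧ W w ≤ 0 ∧ W' w ≤ 0 := by
  have hc : ContinuousOn W (Icc x y) := fun s hs => (hW s hs).continuousAt.continuousWithinAt
  have hclosed : IsClosed (Icc x y ∩ W ⁻¹' Iic 0) := hc.preimage_isClosed_of_isClosed
    isClosed_Icc isClosed_Iic
  obtain ⟨w, ⟨hw, hWw⟩, hmin⟩ := (isCompact_Icc.of_isClosed_subset hclosed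
    inter_subset_left).exists_isLeast ⟨y, right_mem_Icc.2 hxy, hy⟩
  have hxw : x < w := hw.1.lt_of_ne (by rintro rfl; exact hx.not_ge hWw)
  have hpos : ∀ s ∈ Ico x w, 0 < W s := fun s hs => not_le.1 fun hle =>
    (hmin ⟨⟨hs.1, hs.2.le.trans hw.2⟩, hle⟩).not_gt hs.2
  refine ⟨w, ⟨hxw, hw.2⟩, hpos, hWw, ?_⟩
  refine le_of_tendsto (hasDerivAt_iff_tendsto_slope_left_right.1 (hW w hw)).1 ?_
  filter_upwards [Ioo_mem_nhdsLT hxw] with s hs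
  rw [slope_def_field]
  have hWw' : W w ≤ 0 := hWw
  exact div_nonpos_of_nonneg_of_nonpos (by linarith [hpos s ⟨hs.1.le, hs.2⟩])
    (by linarith [hs.2])

/-- (Eventual comparison.) For two solutions `(t_i, V_i)` of
`V V' − K V / t = f`, `t(v) = ∫_v^∞ ds/V(s)`, with `t₁ ≤ t₂`, one has
`V₂ ≤ V₁` eventually. -/
theorem stmt13 (K : ℝ) (hK : K < 1) (a : ℝ) (ha : 0 < a)
    (f : ℝ → ℝ) (hfc : ContinuousOn f (Ici a)) (hfpos : ∀ v : ℝ, a ≤ v → 0 < f v)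
    (V₁ V₁' V₂ V₂' : ℝ → ℝ)
    (hV₁pos : ∀ v : ℝ, a ≤ v → 0 < V₁ v) (hV₂pos : ∀ v : ℝ, a ≤ v → 0 < V₂ v)
    (hV₁ : ∀ v : ℝ, a ≤ v → HasDerivAt V₁ (V₁' v) v)
    (hV₂ : ∀ v : ℝ, a ≤ v → HasDerivAt V₂ (V₂' v) v)
    (hV₁'c : ContinuousOn V₁' (Ici a)) (hV₂'c : ContinuousOn V₂' (Ici a))
    (hV₁int : IntegrableOn (fun s => (V₁ s)⁻¹) (Ici a))
    (hV₂int : IntegrableOn (fun s => (V₂ s)⁻¹) (Ici a))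
    (t₁ t₂ : ℝ → ℝ)
    (ht₁ : ∀ v : ℝ, t₁ v = ∫ s in Ioi v, (V₁ s)⁻¹)
    (ht₂ : ∀ v : ℝ, t₂ v = ∫ s in Ioi v, (V₂ s)⁻¹)
    (hODE₁ : ∀ v : ℝ, a ≤ v → V₁ v * V₁' v - K * V₁ v / t₁ v = f v)
    (hODE₂ : ∀ v : ℝ, a ≤ v → V₂ v * V₂' v - K * V₂ v / t₂ v = f v)
    (htle : ∀ v : ℝ, a ≤ v → t₁ v ≤ t₂ v) :
    ∃ v₀ : ℝ, a ≤ v₀ ∧ ∀ v : ℝ, v₀ ≤ v → V₂ v ≤ V₁ v := by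
  have sub_Ioi : ∀ {x}, a ≤ x → Ioi x ⊆ Ici a := fun hx s hs => hx.trans (le_of_lt hs)
  have tpos : ∀ {V : ℝ → ℝ}, (∀ v, a ≤ v → 0 < V v) →
      IntegrableOn (fun s => (V s)⁻¹) (Ici a) → ∀ v, a ≤ v → 0 < ∫ s in Ioi v, (V s)⁻¹ := by
    intro V hV hint v hv
    simpa using integral_Ioi_lt_integral_Ioi (hint.mono_set (sub_Ioi hv))
      (integrableOn_zero (s := Ioi v)) fun s hs => inv_pos.2 (hV s (sub_Ioi hv hs))
  have ht₁pos : ∀ v, a ≤ v → 0 < t₁ v := fun v hv => ht₁ v ▸ tpos hV₁pos hV₁int v hv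
  have ht₂pos : ∀ v, a ≤ v → 0 < t₂ v := fun v hv => ht₂ v ▸ tpos hV₂pos hV₂int v hv
  have inv_lt : ∀ s, a ≤ s → 0 < V₂ s - V₁ s → (V₂ s)⁻¹ < (V₁ s)⁻¹ := fun s hs h =>
    inv_strictAnti₀ (hV₁pos s hs) (sub_pos.1 h)
  have hW : ∀ s, a ≤ s → HasDerivAt (fun s => V₂ s - V₁ s) (V₂' s - V₁' s) s :=
    fun s hs => (hV₂ s hs).sub (hV₁ s hs)
  have hW' : ∀ s, a ≤ s → V₂' s - V₁' s =
      -(f s / (V₁ s * V₂ s)) * (V₂ s - V₁ s) + -K * ((t₂ s - t₁ s) / (t₁ s * t₂ s)) := by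
    intro s hs
    have h₁ := (hV₁pos s hs).ne'
    have h₂ := (hV₂pos s hs).ne'
    have h₃ := (ht₁pos s hs).ne'
    have h₄ := (ht₂pos s hs).ne'
    have e₁ : V₁' s = f s / V₁ s + K / t₁ s := by
      rw [← hODE₁ s hs]; field_simp; ring
    have e₂ : V₂' s = f s / V₂ s + K / t₂ s := by
      rw [← hODE₂ s hs]; field_simp; ring
    rw [e₁, e₂]
    field_simp
    ring
  have hfV : ∀ s, a ≤ s → 0 < f s / (V₁ s * V₂ s) := fun s hs =>
    div_pos (hfpos s hs) (mul_pos (hV₁pos s hs) (hV₂pos s hs))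
  have exists_nonpos : ∀ b, a ≤ b → ∃ y, b ≤ y ∧ V₂ y - V₁ y ≤ 0 := by
    intro b hb
    by_contra! hcon
    have := integral_Ioi_lt_integral_Ioi (hV₁int.mono_set (sub_Ioi hb))
      (hV₂int.mono_set (sub_Ioi hb)) fun s hs =>
        inv_lt s (sub_Ioi hb hs) (hcon s (le_of_lt hs))
    rw [← ht₁, ← ht₂] at this
    exact this.not_ge (htle b hb)
  rcases le_or_gt 0 K with hK0 | hK0
  · obtain ⟨v₀, hv₀, hWv₀⟩ := exists_nonpos a le_rfl
    refine ⟨v₀, hv₀, fun v hv => sub_nonpos.1 ?_⟩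
    refine nonpos_of_hasDerivAt_nonpos_of_pos (W := fun s => V₂ s - V₁ s) hv
      (fun s hs => hW s (hv₀.trans hs.1)) hWv₀ fun s hs hpos => ?_
    have has := hv₀.trans hs.1
    rw [hW' s has]
    have h₁ := mul_pos (hfV s has) hpos
    have h₂ := mul_nonneg hK0 (div_nonneg (sub_nonneg.2 (htle s has))
      (mul_pos (ht₁pos s has) (ht₂pos s has)).le)
    linarith
  · refine ⟨a, le_rfl, fun v hv => not_lt.1 fun hlt => ?_⟩
    obtain ⟨y, hvy, hy⟩ := exists_nonpos v hv
    obtain ⟨w, hw, hpos, hWw, hW'w⟩ := exists_first_nonpos (W := fun s => V₂ s - V₁ s) hvy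
      (fun s hs => hW s (hv.trans hs.1)) (sub_pos.2 hlt) hy
    have haw := hv.trans hw.1.le
    have ht := integral_Ioi_add_integral_Ioi_lt hw.1 (hV₁int.mono_set (sub_Ioi hv))
      (hV₂int.mono_set (sub_Ioi hv)) fun s hs =>
        inv_lt s (hv.trans hs.1.le) (hpos s ⟨hs.1.le, hs.2⟩)
    rw [← ht₁, ← ht₁, ← ht₂, ← ht₂] at ht
    have hδ : 0 < t₂ w - t₁ w := by linarith [htle v hv]
    have h₁ := mul_nonneg_of_nonpos_of_nonpos (neg_nonpos.2 (hfV w haw).le) hWw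
    have h₂ := mul_pos (neg_pos.2 hK0) (div_pos hδ (mul_pos (ht₁pos w haw) (ht₂pos w haw)))
    rw [hW' w haw] at hW'w
    linarith
end
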